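/- arXiv:1709.03664 — 6 statements merged into one kernel-verified Lean document; each statement's English description precedes it below -/
import Mathlib

section
/- Let K be a number field with ring of integers O_K. The following two statements are equivalent: (i) for every pair P, Q ∈ K[x,y] satisfying the Jacobian condition ∂P/∂x·∂Q/∂y − ∂P/∂y·∂Q/∂x = 1, the map F = (P,Q) is invertible over K; (ii) for every pair P, Q ∈ O_K[x,y] satisfying ∂P/∂x·∂Q/∂y − ∂P/∂y·∂Q/∂x = 1, there exist at least two distinct pairs (a,b), (c,d) ∈ O_K × O_K with P(a,b) = 0 and P(c,d) = 0. -/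
open MvPolynomial NumberField

theorem pderiv_aeval {R σ τ : Type*} [CommRing R] [Fintype σ] (g : σ → MvPolynomial τ R)
    (f : MvPolynomial σ R) (i : τ) :
    pderiv i (aeval g f) = ∑ j, aeval g (pderiv j f) * pderiv i (g j) := by
  classical
  induction f using MvPolynomial.induction_on with
  | C a => simp [← algebraMap_eq]
  | add p q hp hq => simp only [map_add, hp, hq, add_mul, Finset.sum_add_distrib]
  | mul_X p k hp =>
    simp only [map_mul, aeval_X, Derivation.leibniz, hp, smul_eq_mul, map_add, add_mul,
      Finset.sum_add_distrib, Finset.mul_sum, pderiv_X, Pi.single_apply, apply_ite (aeval g),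
      map_zero, mul_ite, ite_mul, mul_one, mul_zero, zero_mul, Finset.sum_ite_eq,
      Finset.mem_univ, if_true]
    congr 1
    exact Finset.sum_congr rfl fun j _ => by ring

theorem aeval_sub_aeval_mem {R S σ : Type*} [CommRing R] [CommRing S] [Algebra R S]
    {I : Ideal S} {a b : σ → S} (h : ∀ i, a i - b i ∈ I) (f : MvPolynomial σ R) :
    aeval a f - aeval b f ∈ I := by
  rw [← Ideal.Quotient.eq]
  have h2 : ∀ c : σ → S, Ideal.Quotient.mk I (aeval c f) =
      aeval (fun i => Ideal.Quotient.mk I (c i)) f := fun c => by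
    simpa using (map_aeval c (Ideal.Quotient.mk I) f).trans (by rw [aeval_def]; rfl)
  rw [h2, h2]
  congr 2
  exact funext fun i => Ideal.Quotient.eq.2 (h i)

theorem aeval_taylor_mem {R S σ : Type*} [CommRing R] [CommRing S] [Algebra R S] [Fintype σ]
    {I : Ideal S} {a b : σ → S} (h : ∀ i, a i - b i ∈ I) (f : MvPolynomial σ R) :
    aeval a f - aeval b f - ∑ i, aeval b (pderiv i f) * (a i - b i) ∈ I ^ 2 := by
  classical
  induction f using MvPolynomial.induction_on with
  | C r => simp
  | add p q hp hq =>
    convert add_mem hp hq using 1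
    simp only [map_add, add_mul, Finset.sum_add_distrib]
    ring
  | mul_X p k hp =>
    have h1 : (aeval a p - aeval b p) * (a k - b k) ∈ I ^ 2 := by
      rw [sq]; exact Ideal.mul_mem_mul (aeval_sub_aeval_mem h p) (h k)
    convert add_mem (Ideal.mul_mem_right (b k) _ hp) h1 using 1
    simp only [map_mul, aeval_X, Derivation.leibniz, smul_eq_mul, map_add, add_mul,
      Finset.sum_add_distrib, pderiv_X, Pi.single_apply, apply_ite (aeval b),
      map_zero, mul_ite, ite_mul, mul_one, mul_zero, zero_mul, Finset.sum_ite_eq,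
      Finset.mem_univ, if_true, sub_mul, Finset.sum_mul]
    rw [Finset.sum_congr rfl fun j _ => show b k * aeval b (pderiv j p) * (a j - b j) =
      aeval b (pderiv j p) * (a j - b j) * b k by ring]
    ring

/-- The Jacobian determinant of a polynomial self-map of the plane. -/
noncomputable def jac {R : Type*} [CommRing R] (F : Fin 2 → MvPolynomial (Fin 2) R) :
    MvPolynomial (Fin 2) R :=
  pderiv 0 (F 0) * pderiv 1 (F 1) - pderiv 1 (F 0) * pderiv 0 (F 1)

theorem jac_comp {R : Type*} [CommRing R] (F G : Fin 2 → MvPolynomial (Fin 2) R) :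
    jac (fun i => aeval G (F i)) = aeval G (jac F) * jac G := by
  simp only [jac, pderiv_aeval, Fin.sum_univ_two, map_sub, map_mul]
  ring

theorem jac_map {R S : Type*} [CommRing R] [CommRing S] (φ : R →+* S)
    (F : Fin 2 → MvPolynomial (Fin 2) R) :
    jac (fun i => map φ (F i)) = map φ (jac F) := by
  simp [jac, pderiv_map]

theorem map_aeval_eq_aeval_map {R S σ τ : Type*} [CommRing R] [CommRing S] (φ : R →+* S)
    (g : σ → MvPolynomial τ R) (f : MvPolynomial σ R) :
    map φ (aeval g f) = aeval (fun i => map φ (g i)) (map φ f) :=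
  map_bind₁ φ g f

open TensorProduct in
theorem mem_range_algebraMap_of_tmul_one_eq {L E : Type*} [Field L] [Field E] [Algebra L E] {x : E}
    (h : x ⊗ₜ[L] (1 : E) = 1 ⊗ₜ x) : x ∈ (algebraMap L E).range := by
  by_contra hx
  have hx' : x ∉ Submodule.span L {(1 : E)} := fun h' => by
    obtain ⟨c, rfl⟩ := Submodule.mem_span_singleton.1 h'
    exact hx ⟨c, Algebra.algebraMap_eq_smul_one c⟩
  obtain ⟨f, hf, hker⟩ := Submodule.exists_le_ker_of_notMem hx'
  have h1 : f 1 = 0 := hker (Submodule.mem_span_singleton_self 1)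
  have := congr(TensorProduct.rid L E (TensorProduct.map LinearMap.id f $h))
  simp [h1] at this
  exact hf (by simpa using this.symm)

/-- If the differential of `F` has unit determinant, two points with the same image under `F`
that differ by nilpotents coincide. -/
theorem eq_of_aeval_eq_of_isNilpotent {R T : Type*} [CommRing R] [CommRing T] [Algebra R T]
    {F : Fin 2 → MvPolynomial (Fin 2) R} (hF : jac F = 1) {a b : Fin 2 → T}
    (h : ∀ j, aeval a (F j) = aeval b (F j)) (hn : ∀ i, IsNilpotent (a i - b i)) : a = b := by
  set I : Ideal T := Ideal.span (Set.range fun i => a i - b i) with hI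
  have hmem : ∀ i, a i - b i ∈ I := fun i => Ideal.subset_span ⟨i, rfl⟩
  have ht : ∀ j, aeval b (pderiv 0 (F j)) * (a 0 - b 0) +
      aeval b (pderiv 1 (F j)) * (a 1 - b 1) ∈ I ^ 2 := fun j => by
    have := neg_mem (aeval_taylor_mem hmem (F j))
    rwa [h j, sub_self, zero_sub, neg_neg, Fin.sum_univ_two] at this
  have hdet := congr(aeval b $hF)
  simp only [jac, map_sub, map_mul, map_one] at hdet
  have hsq : ∀ i, a i - b i ∈ I ^ 2 := by
    intro i
    fin_cases i
    · convert sub_mem (Ideal.mul_mem_left _ (aeval b (pderiv 1 (F 1))) (ht 0))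
        (Ideal.mul_mem_left _ (aeval b (pderiv 1 (F 0))) (ht 1)) using 1
      simp only [Fin.zero_eta]
      linear_combination -(a 0 - b 0) * hdet
    · convert sub_mem (Ideal.mul_mem_left _ (aeval b (pderiv 0 (F 0))) (ht 1))
        (Ideal.mul_mem_left _ (aeval b (pderiv 0 (F 1))) (ht 0)) using 1
      simp only [Fin.mk_one]
      linear_combination -(a 1 - b 1) * hdet
  have hidem : IsIdempotentElem I := by
    rw [IsIdempotentElem, ← sq]
    refine le_antisymm (Ideal.pow_le_self two_ne_zero) (Ideal.span_le.2 ?_)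
    rintro _ ⟨i, rfl⟩
    exact hsq i
  have hnil : IsNilpotent I := by
    refine Ideal.FG.isNilpotent_iff_le_nilradical (Submodule.fg_span (Set.finite_range _)) |>.2 ?_
    refine Ideal.span_le.2 ?_
    rintro _ ⟨i, rfl⟩
    exact hn i
  obtain ⟨n, hn'⟩ := hnil
  have hbot : I = ⊥ := by
    rw [← hidem.pow_succ_eq n, pow_succ, hn']
    simp
  funext i
  have := hmem i
  rwa [hbot, Ideal.mem_bot, sub_eq_zero] at this

open TensorProduct in
/-- A plane polynomial map of Jacobian `1` that is injective over the algebraic closure is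
birational: the coordinates are rational functions of the components. -/
theorem X_mem_adjoin_of_injective {K Ω : Type*} [Field K] [Field Ω] [IsAlgClosed Ω] [Algebra K Ω]
    [Algebra.IsAlgebraic K Ω]
    {F : Fin 2 → MvPolynomial (Fin 2) K} (hF : jac F = 1)
    (hinj : Function.Injective fun (v : Fin 2 → Ω) i => aeval v (F i)) (i : Fin 2) :
    algebraMap (MvPolynomial (Fin 2) K) (FractionRing (MvPolynomial (Fin 2) K)) (X i) ∈
      IntermediateField.adjoin K
        (Set.range fun j => algebraMap (MvPolynomial (Fin 2) K)
          (FractionRing (MvPolynomial (Fin 2) K)) (F j)) := by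
  set E := FractionRing (MvPolynomial (Fin 2) K)
  set L := IntermediateField.adjoin K
    (Set.range fun j => algebraMap (MvPolynomial (Fin 2) K) E (F j))
  let x : Fin 2 → E := fun i => algebraMap (MvPolynomial (Fin 2) K) E (X i)
  let a : Fin 2 → E ⊗[L] E := fun i => x i ⊗ₜ 1
  let b : Fin 2 → E ⊗[L] E := fun i => 1 ⊗ₜ x i
  have hx : ∀ f : MvPolynomial (Fin 2) K,
      aeval x f = algebraMap (MvPolynomial (Fin 2) K) E f := fun f => by
    have := (aeval_algebraMap_apply E (X : Fin 2 → MvPolynomial (Fin 2) K) f)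
    rwa [aeval_X_left_apply] at this
  have ha : ∀ f : MvPolynomial (Fin 2) K,
      aeval a f = (algebraMap (MvPolynomial (Fin 2) K) E f) ⊗ₜ[L] 1 := fun f => by
    rw [← hx]
    exact (comp_aeval_apply x
      ((Algebra.TensorProduct.includeLeft : E →ₐ[L] E ⊗[L] E).restrictScalars K) f).symm
  have hb : ∀ f : MvPolynomial (Fin 2) K,
      aeval b f = 1 ⊗ₜ[L] (algebraMap (MvPolynomial (Fin 2) K) E f) := fun f => by
    rw [← hx]
    exact (comp_aeval_apply x
      ((Algebra.TensorProduct.includeRight : E →ₐ[L] E ⊗[L] E).restrictScalars K) f).symm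
  have hab : ∀ j, aeval a (F j) = aeval b (F j) := fun j => by
    rw [ha, hb]
    have : algebraMap (MvPolynomial (Fin 2) K) E (F j) ∈ L :=
      IntermediateField.subset_adjoin _ _ ⟨j, rfl⟩
    exact Algebra.TensorProduct.tmul_one_eq_one_tmul (⟨_, this⟩ : L)
  have hnil : ∀ i, IsNilpotent (a i - b i) := fun i => by
    let Φ : MvPolynomial (Fin 2 ⊕ Fin 2) K →ₐ[K] E ⊗[L] E := aeval (Sum.elim a b)
    have hrad : X (Sum.inl i) - X (Sum.inr i) ∈ (RingHom.ker Φ).radical := by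
      rw [← vanishingIdeal_zeroLocus_eq_radical (K := Ω), mem_vanishingIdeal_iff]
      intro v hv
      have key : ∀ j, aeval (v ∘ Sum.inl) (F j) = aeval (v ∘ Sum.inr) (F j) := fun j => by
        have := hv (rename Sum.inl (F j) - rename Sum.inr (F j)) (by
          simp [Φ, RingHom.mem_ker, aeval_rename, hab])
        simpa [aeval_rename, sub_eq_zero] using this
      have := congrFun (hinj (funext key)) i
      simpa [sub_eq_zero] using this
    obtain ⟨n, hn⟩ := hrad
    refine ⟨n, ?_⟩
    rw [RingHom.mem_ker, map_pow, map_sub] at hn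
    simpa only [Φ, aeval_X, Sum.elim_inl, Sum.elim_inr] using hn
  obtain ⟨y, hy⟩ := mem_range_algebraMap_of_tmul_one_eq
    (congrFun (eq_of_aeval_eq_of_isNilpotent hF hab hnil) i)
  change x i ∈ L
  rw [← hy]
  exact y.2

/-- If `f` is a quotient of polynomials in the components of `F`, and `F` hits every geometric
point, then `f` is a polynomial in the components of `F`. -/
theorem exists_aeval_eq_of_mul_aeval_eq {K Ω σ : Type*} [Field K] [Field Ω] [IsAlgClosed Ω]
    [Algebra K Ω] [Finite σ] {F : σ → MvPolynomial σ K}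
    (hsurj : Function.Surjective fun (v : σ → Ω) i => aeval v (F i))
    {f g h : MvPolynomial σ K} (hh : aeval F h ≠ 0) (hfg : f * aeval F h = aeval F g) :
    ∃ U : MvPolynomial σ K, aeval F U = f := by
  have hh0 : h ≠ 0 := fun h0 => hh (by simp [h0])
  obtain ⟨h', g', d, hcop, rfl, rfl⟩ := UniqueFactorizationMonoid.exists_reduced_factors h hh0 g
  rw [map_mul] at hh
  have hd : aeval F d ≠ 0 := left_ne_zero_of_mul hh
  have hh' : aeval F h' ≠ 0 := right_ne_zero_of_mul hh
  have hfg' : f * aeval F h' = aeval F g' := by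
    apply mul_left_cancel₀ hd
    rw [← map_mul, ← hfg, map_mul]
    ring
  have hunit : IsUnit h' := by
    by_contra hnu
    obtain ⟨q, hq, hqh⟩ := WfDvdMonoid.exists_irreducible_factor hnu fun h0 => hh' (by simp [h0])
    have hqp : (Ideal.span {q}).IsPrime := (Ideal.span_singleton_prime hq.ne_zero).2 hq.prime
    have hmem : g' ∈ Ideal.span {q} := by
      rw [← IsPrime.vanishingIdeal_zeroLocus (K := Ω) (Ideal.span {q}), mem_vanishingIdeal_iff]
      intro w hw
      obtain ⟨v, rfl⟩ := hsurj w
      have hq0 := hw q (Ideal.mem_span_singleton_self q)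
      have hh0 := map_dvd (aeval fun i => aeval v (F i)) hqh
      rw [hq0, zero_dvd_iff] at hh0
      have := congr(aeval v $hfg')
      rw [map_mul, comp_aeval_apply, comp_aeval_apply, hh0, mul_zero] at this
      exact this.symm
    exact hq.not_isUnit (hcop hqh (Ideal.mem_span_singleton.1 hmem))
  obtain ⟨u, rfl⟩ := hunit
  refine ⟨g' * ↑u⁻¹, ?_⟩
  rw [map_mul, ← hfg', mul_assoc, ← map_mul, Units.mul_inv, map_one, mul_one]

theorem exists_inverse_of_injective {K Ω : Type*} [Field K] [Field Ω] [IsAlgClosed Ω] [Algebra K Ω]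
    [Algebra.IsAlgebraic K Ω]
    {F : Fin 2 → MvPolynomial (Fin 2) K} (hF : jac F = 1)
    (hinj : Function.Injective fun (v : Fin 2 → Ω) i => aeval v (F i)) :
    ∃ G : Fin 2 → MvPolynomial (Fin 2) K,
      (∀ i, aeval F (G i) = X i) ∧ ∀ i, aeval G (F i) = X i := by
  have hsurj : Function.Surjective fun (v : Fin 2 → Ω) i => aeval v (F i) := by
    have := ax_grothendieck_univ (fun i => map (algebraMap K Ω) (F i))
    simp only [eval_map, ← aeval_def] at this
    exact this hinj
  have hG : ∀ i, ∃ U, aeval F U = (X i : MvPolynomial (Fin 2) K) := fun i => by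
    obtain ⟨g, h, hgh⟩ := (IntermediateField.mem_adjoin_range_iff ..).1
      (X_mem_adjoin_of_injective hF hinj i)
    have hx : ∀ f : MvPolynomial (Fin 2) K, aeval (fun j => algebraMap (MvPolynomial (Fin 2) K)
        (FractionRing (MvPolynomial (Fin 2) K)) (F j)) f = algebraMap _ _ (aeval F f) :=
      fun f => aeval_algebraMap_apply _ F f
    rw [hx, hx] at hgh
    have hh : aeval F h ≠ 0 := fun h0 => by
      rw [h0, map_zero, div_zero] at hgh
      exact X_ne_zero (R := K) i
        ((map_eq_zero_iff _ (IsFractionRing.injective (MvPolynomial (Fin 2) K) _)).1 hgh)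
    refine exists_aeval_eq_of_mul_aeval_eq hsurj hh (g := g) ?_
    apply IsFractionRing.injective (MvPolynomial (Fin 2) K)
      (FractionRing (MvPolynomial (Fin 2) K))
    rw [map_mul, hgh, div_mul_cancel₀]
    exact fun h0 => hh
      ((map_eq_zero_iff _ (IsFractionRing.injective (MvPolynomial (Fin 2) K) _)).1 h0)
  choose G hG using hG
  refine ⟨G, hG, fun i => ?_⟩
  apply map_injective _ (algebraMap K Ω).injective
  apply MvPolynomial.funext
  intro w
  obtain ⟨v, rfl⟩ := hsurj w
  have hv : (fun k => aeval (fun j => aeval v (F j)) (G k)) = v := funext fun k => by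
    rw [← comp_aeval_apply, hG, aeval_X]
  rw [eval_map, eval_map, ← aeval_def, ← aeval_def, comp_aeval_apply, hv, aeval_X]

/-- A compositional inverse, fixing the origin up to translation, of a polynomial map of Jacobian
`1` has coefficients in any ring containing the coefficients of the map. -/
theorem mem_range_map_of_aeval_eq {R S : Type*} [CommRing R] [CommRing S] [Algebra R S]
    {F : Fin 2 → MvPolynomial (Fin 2) R} (hF : jac F = 1) {G : Fin 2 → MvPolynomial (Fin 2) S}
    (hG0 : ∀ i, constantCoeff (G i) = 0)
    (hG : ∀ j, aeval G (F j) = X j + C (algebraMap R S (constantCoeff (F j)))) (i : Fin 2) :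
    G i ∈ (map (algebraMap R S) : MvPolynomial (Fin 2) R →+* MvPolynomial (Fin 2) S).range := by
  set φ : MvPolynomial (Fin 2) R →+* MvPolynomial (Fin 2) S := map (algebraMap R S)
  have hφ : ∀ r, φ (C r) = C (algebraMap R S r) := map_C _
  set I := idealOfVars (Fin 2) S
  have hGI : ∀ i, G i ∈ I := fun i => by
    rw [← pow_one I, mem_pow_idealOfVars_iff']
    intro x hx
    rw [(Finsupp.degree_eq_zero_iff x).1 (Nat.lt_one_iff.1 hx)]
    exact hG0 i
  have hconst : ∀ f : MvPolynomial (Fin 2) R, aeval G f - φ (C (constantCoeff f)) ∈ I := by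
    intro f
    have := aeval_sub_aeval_mem (I := I) (a := G) (b := 0) (fun i => by simpa using hGI i) f
    rwa [aeval_zero, MvPolynomial.algebraMap_apply, ← hφ] at this
  set m : Fin 2 → Fin 2 → R := fun j i => constantCoeff (pderiv i (F j)) with hm
  have hdet : m 0 0 * m 1 1 - m 0 1 * m 1 0 = 1 := by
    simpa [jac] using congr(constantCoeff $hF)
  have key : ∀ n, 1 ≤ n → ∃ H : Fin 2 → MvPolynomial (Fin 2) R, ∀ i, φ (H i) - G i ∈ I ^ n := by
    intro n hn
    induction n, hn using Nat.le_induction with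
    | base => exact ⟨0, fun i => by simpa using hGI i⟩
    | succ n hn ih =>
      obtain ⟨H, hH⟩ := ih
      set e : Fin 2 → MvPolynomial (Fin 2) R :=
        fun j => aeval H (F j) - X j - C (constantCoeff (F j)) with he
      have hcomp : ∀ f : MvPolynomial (Fin 2) R, φ (aeval H f) = aeval (fun i => φ (H i)) f :=
        fun f => comp_aeval_apply H (mapAlgHom (Algebra.ofId R S)) f
      have he' : ∀ j, φ (e j) = aeval (fun i => φ (H i)) (F j) - aeval G (F j) := fun j => by
        simp only [he, map_sub, hcomp, hG, hφ]
        simp only [φ, map_X]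
        ring
      have hlin : ∀ j, φ (e j) - ∑ i, φ (C (m j i)) * (φ (H i) - G i) ∈ I ^ (n + 1) := fun j => by
        have h1 := aeval_taylor_mem hH (F j)
        rw [← he', ← pow_mul] at h1
        have h2 : ∑ i, (aeval G (pderiv i (F j)) - φ (C (m j i))) * (φ (H i) - G i) ∈
            I ^ (n + 1) := Ideal.sum_mem _ fun i _ => by
          rw [pow_succ']
          exact Ideal.mul_mem_mul (hconst _) (hH i)
        convert add_mem (Ideal.pow_le_pow_right (by omega) h1) h2 using 1
        simp only [sub_mul, Finset.sum_sub_distrib]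
        ring
      have hdet' := congr(φ (C $hdet))
      simp only [map_sub, map_mul, map_one] at hdet'
      refine ⟨![H 0 - (C (m 1 1) * e 0 - C (m 0 1) * e 1),
        H 1 - (C (m 0 0) * e 1 - C (m 1 0) * e 0)], fun i => ?_⟩
      simp only [Fin.sum_univ_two] at hlin
      fin_cases i
      · convert sub_mem (Ideal.mul_mem_left _ (φ (C (m 0 1))) (hlin 1))
          (Ideal.mul_mem_left _ (φ (C (m 1 1))) (hlin 0)) using 1
        simp
        linear_combination -(φ (H 0) - G 0) * hdet'
      · convert sub_mem (Ideal.mul_mem_left _ (φ (C (m 1 0))) (hlin 0))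
          (Ideal.mul_mem_left _ (φ (C (m 0 0))) (hlin 1)) using 1
        simp
        linear_combination -(φ (H 1) - G 1) * hdet'
  obtain ⟨H, hH⟩ := key ((G i).totalDegree + 1) (by omega)
  change G i ∈ Set.range (map (algebraMap R S))
  rw [mem_range_map_iff_coeffs_subset]
  intro r hr
  obtain ⟨x, hx, rfl⟩ := mem_coeffs_iff.1 hr
  have hdeg : x.degree ≤ (G i).totalDegree := le_totalDegree hx
  have := (mem_pow_idealOfVars_iff' _ _).1 (hH i) x (by omega)
  rw [coeff_sub, sub_eq_zero, coeff_map] at this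
  exact ⟨_, this⟩

/-- A plane polynomial map of Jacobian `1` which becomes invertible over a larger ring is already
invertible. -/
theorem exists_inverse_of_exists_inverse_map {R S : Type*} [CommRing R] [CommRing S] [Algebra R S]
    (hinj : Function.Injective (algebraMap R S))
    {F : Fin 2 → MvPolynomial (Fin 2) R} (hF : jac F = 1) {U : Fin 2 → MvPolynomial (Fin 2) S}
    (hFU : ∀ i, aeval (fun j => map (algebraMap R S) (F j)) (U i) = X i)
    (hUF : ∀ j, aeval U (map (algebraMap R S) (F j)) = X j) :
    ∃ V : Fin 2 → MvPolynomial (Fin 2) R, ∀ j, aeval V (F j) = X j := by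
  set c : Fin 2 → R := fun j => constantCoeff (F j)
  set G : Fin 2 → MvPolynomial (Fin 2) S :=
    fun i => aeval (fun j => X j + C (algebraMap R S (c j))) (U i)
  have hUF' : ∀ j, aeval U (F j) = (X j : MvPolynomial (Fin 2) S) := fun j => by
    rw [← hUF j, aeval_map_algebraMap]
  have h0 : ∀ i, constantCoeff (G i) = 0 := fun i => by
    have := congr(aeval (0 : Fin 2 → S) $(hFU i))
    have hz : ∀ p : MvPolynomial (Fin 2) S, constantCoeff p = aeval (0 : Fin 2 → S) p :=
      fun p => (aeval_zero p).symm
    rw [comp_aeval_apply] at this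
    rw [hz, comp_aeval_apply]
    simpa [c, aeval_zero] using this
  have h1 : ∀ j, aeval G (F j) = X j + C (algebraMap R S (constantCoeff (F j))) := fun j => by
    have := congr(aeval (fun j => X j + C (algebraMap R S (c j)) :
      Fin 2 → MvPolynomial (Fin 2) S) $(hUF j))
    rwa [comp_aeval_apply, aeval_map_algebraMap, aeval_X] at this
  choose H hH using mem_range_map_of_aeval_eq hF h0 h1
  refine ⟨fun i => aeval (fun j => X j - C (c j)) (H i), fun j => ?_⟩
  apply map_injective _ hinj
  have hV : ∀ i, map (algebraMap R S) (aeval (fun j => X j - C (c j)) (H i)) = U i := fun i => by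
    rw [map_aeval_eq_aeval_map, hH, comp_aeval_apply]
    simp
  rw [map_aeval_eq_aeval_map, funext hV, hUF, map_X]

/-- A nonconstant integer polynomial has a root modulo some prime not dividing a given `N ≠ 0`. -/
theorem exists_prime_dvd_eval_not_dvd {f : Polynomial ℤ} (hf : 0 < f.natDegree) {N : ℤ}
    (hN : N ≠ 0) : ∃ p : ℕ, p.Prime ∧ ∃ n : ℤ, ¬ (p : ℤ) ∣ N ∧ (p : ℤ) ∣ f.eval n := by
  by_cases h0 : f.eval 0 = 0
  · obtain ⟨p, hp, hpp⟩ := Nat.exists_infinite_primes (N.natAbs + 1)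
    refine ⟨p, hpp, 0, fun h => ?_, by simp [h0]⟩
    have := Nat.le_of_dvd (Int.natAbs_pos.2 hN) (Int.natCast_dvd.1 h)
    omega
  set c := f.eval 0 with hc
  have hne : ((f - Polynomial.C c) * (f + Polynomial.C c)).comp
      (Polynomial.C (c * N) * Polynomial.X) ≠ 0 := by
    intro h
    have h1 : ((f - Polynomial.C c) * (f + Polynomial.C c)).natDegree = 0 := by
      have := congr(($h).natDegree)
      rw [Polynomial.natDegree_comp, Polynomial.natDegree_C_mul_X _ (mul_ne_zero h0 hN)] at this
      simpa using this
    rw [Polynomial.natDegree_mul, Polynomial.natDegree_sub_C, Polynomial.natDegree_add_C] at h1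
    · omega
    · intro h
      have := Polynomial.natDegree_sub_C (p := f) (a := c)
      rw [h, Polynomial.natDegree_zero] at this
      omega
    · intro h
      have := Polynomial.natDegree_add_C (p := f) (a := c)
      rw [h, Polynomial.natDegree_zero] at this
      omega
  obtain ⟨x, hx⟩ : ∃ x : ℤ, (((f - Polynomial.C c) * (f + Polynomial.C c)).comp
      (Polynomial.C (c * N) * Polynomial.X)).eval x ≠ 0 := by
    by_contra! h
    exact hne (Polynomial.funext fun r => by simpa using h r)
  simp only [Polynomial.eval_comp, Polynomial.eval_mul, Polynomial.eval_C, Polynomial.eval_X,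
    Polynomial.eval_sub, Polynomial.eval_add] at hx
  obtain ⟨t, ht⟩ : c * N * x ∣ f.eval (c * N * x) - c := by
    simpa using Polynomial.sub_dvd_eval_sub (c * N * x) 0 f
  have hk : f.eval (c * N * x) = c * (1 + N * (x * t)) := by linear_combination ht
  rw [hk] at hx
  obtain ⟨p, hp, hpk⟩ := Nat.exists_prime_and_dvd (n := (1 + N * (x * t)).natAbs) fun h => by
    rcases Int.natAbs_eq_iff.1 h with h | h <;> · rw [h] at hx; simp at hx
  have hpk := Int.natCast_dvd.2 hpk
  refine ⟨p, hp, c * N * x, fun h => ?_, hk ▸ hpk.mul_left c⟩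
  have := (Int.dvd_add_left (h.mul_right (x * t))).1 hpk
  exact hp.one_lt.ne' (Nat.dvd_one.1 (by exact_mod_cast this))

/-- A number field embeds into some `ℚ_[p]` in such a way that the elements of a given finite set
become `p`-adic integers. -/
theorem exists_ringHom_padic_norm_le_one {L : Type*} [Field L] [NumberField L] (s : Finset L) :
    ∃ (p : ℕ) (_ : Fact p.Prime) (φ : L →+* ℚ_[p]), ∀ x ∈ s, ‖φ x‖ ≤ 1 := by
  classical
  set B := Field.powerBasisOfFiniteOfSeparable ℚ L
  set m := minpoly ℚ B.gen
  have hint : IsIntegral ℚ B.gen := B.isIntegral_gen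
  have key : ∀ q : Polynomial ℚ, ∃ b : ℤ, b ≠ 0 ∧ ∃ Q : Polynomial ℤ,
      Q.map (algebraMap ℤ ℚ) = Polynomial.C (algebraMap ℤ ℚ b) * q := fun q => by
    obtain ⟨b, hb, h⟩ := IsLocalization.integerNormalization_spec (nonZeroDivisors ℤ) q
    exact ⟨b, nonZeroDivisors.ne_zero hb, _, by rw [h]; simp⟩
  obtain ⟨u, v, huv⟩ := (minpoly.irreducible hint).separable
  obtain ⟨b, hb, F, hF⟩ := key m
  obtain ⟨bu, hbu, U, hU⟩ := key u
  obtain ⟨bv, hbv, V, hV⟩ := key v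
  have hD : Polynomial.C bv * U * F + Polynomial.C bu * V * F.derivative =
      Polynomial.C bu * Polynomial.C bv * Polynomial.C b := by
    apply Polynomial.map_injective (algebraMap ℤ ℚ) Int.cast_injective
    simp only [Polynomial.map_add, Polynomial.map_mul, Polynomial.map_C, hU, hV, hF,
      ← Polynomial.derivative_map, Polynomial.derivative_C_mul]
    linear_combination Polynomial.C (algebraMap ℤ ℚ bu) * Polynomial.C (algebraMap ℤ ℚ bv) *
      Polynomial.C (algebraMap ℤ ℚ b) * huv
  have hFdeg : 0 < F.natDegree := by
    rw [← Polynomial.natDegree_map_eq_of_injective (f := algebraMap ℤ ℚ) Int.cast_injective, hF,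
      Polynomial.natDegree_C_mul (by simpa using hb)]
    exact minpoly.natDegree_pos hint
  have hd : ∀ x : L, ∃ d : ℤ, d ≠ 0 ∧ IsIntegral ℤ (d • x) := fun x => by
    exact ((IsFractionRing.isAlgebraic_iff ℤ ℚ L).2
      (Algebra.IsAlgebraic.isAlgebraic x)).exists_integral_multiple
  choose d hd0 hdi using hd
  obtain ⟨p, hp, n, hpN, hpF⟩ := exists_prime_dvd_eval_not_dvd hFdeg
    (N := bu * bv * b * ∏ x ∈ s, d x) (by simp [*, Finset.prod_eq_zero_iff])
  have : Fact p.Prime := ⟨hp⟩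
  have hev : ∀ Q : Polynomial ℤ, Q.aeval (n : ℤ_[p]) = ((Q.eval n : ℤ) : ℤ_[p]) := fun Q => by
    simpa using Polynomial.aeval_algebraMap_apply ℤ_[p] n Q
  have hnF : ‖F.aeval (n : ℤ_[p])‖ < 1 := by
    rw [hev]; exact (PadicInt.norm_int_lt_one_iff_dvd _).2 hpF
  have hnF' : ‖F.derivative.aeval (n : ℤ_[p])‖ = 1 := by
    refine le_antisymm (PadicInt.norm_le_one _) (not_lt.1 fun h => hpN ?_)
    rw [hev, PadicInt.norm_int_lt_one_iff_dvd] at h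
    have := congr(Polynomial.eval n $hD)
    simp only [Polynomial.eval_add, Polynomial.eval_mul, Polynomial.eval_C] at this
    rw [← this]
    exact (dvd_add (hpF.mul_left _) (h.mul_left _)).mul_right _
  obtain ⟨z, hz, -⟩ := hensels_lemma (F := F) (a := (n : ℤ_[p])) (by rw [hnF']; simpa using hnF)
  have hz' : Polynomial.aeval (z : ℚ_[p]) m = 0 := by
    have h1 : Polynomial.aeval (z : ℚ_[p]) F = 0 := by
      have := Polynomial.aeval_algebraMap_apply ℚ_[p] z F
      rwa [hz, map_zero] at this
    rw [← Polynomial.aeval_map_algebraMap ℚ, hF] at h1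
    simpa [hb] using h1
  refine ⟨p, ‹_›, (B.lift (z : ℚ_[p]) hz').toRingHom, fun x hx => ?_⟩
  set φ := (B.lift (z : ℚ_[p]) hz').toRingHom
  have h1 : IsIntegral ℤ_[p] (φ (d x • x)) := ((hdi x).map (φ.toIntAlgHom)).tower_top
  obtain ⟨y, hy⟩ := IsIntegrallyClosed.isIntegral_iff.1 h1
  have h2 : ‖φ (d x • x)‖ ≤ 1 := hy ▸ PadicInt.norm_le_one y
  have h3 : ‖((d x : ℤ) : ℚ_[p])‖ = 1 := by
    refine le_antisymm (Padic.norm_int_le_one _) (not_lt.1 fun h => hpN ?_)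
    rw [Padic.norm_intCast_lt_one_iff] at h
    exact (h.trans (Finset.dvd_prod_of_mem d hx)).mul_left _
  rwa [zsmul_eq_mul, map_mul, map_intCast, norm_mul, h3, one_mul] at h2

/-- A polynomial map over the integers of a number field which is not injective over the algebraic
closure fails to be injective modulo some prime of degree `1`. -/
theorem exists_ringHom_zmod_not_injective {K Ω σ τ : Type*} [Field K] [NumberField K] [Field Ω]
    [Algebra K Ω] [Algebra.IsAlgebraic K Ω] [Finite σ] {T : τ → MvPolynomial σ (𝓞 K)}
    (h : ¬ Function.Injective fun (v : σ → Ω) i => aeval v (map (algebraMap (𝓞 K) K) (T i))) :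
    ∃ (p : ℕ) (_ : Fact p.Prime) (π : 𝓞 K →+* ZMod p),
      ¬ Function.Injective fun (v : σ → ZMod p) i => eval v (map π (T i)) := by
  classical
  have := Fintype.ofFinite σ
  obtain ⟨α, β, hαβ, hne⟩ : ∃ α β : σ → Ω, (∀ i, aeval α (map (algebraMap (𝓞 K) K) (T i)) =
      aeval β (map (algebraMap (𝓞 K) K) (T i))) ∧ α ≠ β := by
    simpa [Function.Injective, funext_iff] using h
  set S : Set Ω := Set.range α ∪ Set.range β
  have hS : S.Finite := (Set.finite_range α).union (Set.finite_range β)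
  have : Finite S := hS
  set L := IntermediateField.adjoin K S
  have : FiniteDimensional K L := IntermediateField.finiteDimensional_adjoin fun x _ =>
    (Algebra.IsAlgebraic.isAlgebraic x).isIntegral
  have : NumberField L := NumberField.of_module_finite K L
  obtain ⟨a, ha⟩ : ∃ a : σ → L, ∀ i, (a i : Ω) = α i :=
    ⟨fun i => ⟨α i, IntermediateField.subset_adjoin K S (Or.inl ⟨i, rfl⟩)⟩, fun i => rfl⟩
  obtain ⟨b, hb⟩ : ∃ b : σ → L, ∀ i, (b i : Ω) = β i :=
    ⟨fun i => ⟨β i, IntermediateField.subset_adjoin K S (Or.inr ⟨i, rfl⟩)⟩, fun i => rfl⟩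
  have hab : ∀ i, eval₂ ((algebraMap K L).comp (algebraMap (𝓞 K) K)) a (T i) =
      eval₂ ((algebraMap K L).comp (algebraMap (𝓞 K) K)) b (T i) := fun i => by
    rw [← eval₂_map, ← eval₂_map, ← aeval_def, ← aeval_def]
    apply L.val.injective
    change L.val _ = L.val _
    rw [comp_aeval_apply, comp_aeval_apply]
    simpa [ha, hb] using hαβ i
  obtain ⟨j, hj⟩ : ∃ j, a j ≠ b j := by
    by_contra! hall
    exact hne (funext fun i => by rw [← ha, ← hb, hall])
  obtain ⟨p, hp, φ, hφ⟩ := exists_ringHom_padic_norm_le_one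
    (Finset.univ.image a ∪ Finset.univ.image b ∪ {(a j - b j)⁻¹})
  have hφa : ∀ i, ‖φ (a i)‖ ≤ 1 := fun i => hφ _ (by simp)
  have hφb : ∀ i, ‖φ (b i)‖ ≤ 1 := fun i => hφ _ (by simp)
  have hint : ∀ x : 𝓞 K, ‖φ (algebraMap K L (algebraMap (𝓞 K) K x))‖ ≤ 1 := fun x => by
    have h1 : IsIntegral ℤ_[p] (φ (algebraMap K L (algebraMap (𝓞 K) K x))) :=
      (x.isIntegral_coe.map ((φ.comp (algebraMap K L)).toIntAlgHom)).tower_top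
    obtain ⟨y, hy⟩ := IsIntegrallyClosed.isIntegral_iff.1 h1
    exact hy ▸ PadicInt.norm_le_one y
  let ρ : 𝓞 K →+* ℤ_[p] :=
    { toFun := fun x => ⟨_, hint x⟩
      map_one' := Subtype.ext (by simp)
      map_zero' := Subtype.ext (by simp)
      map_mul' := fun x y => Subtype.ext (by simp only [map_mul]; rfl)
      map_add' := fun x y => Subtype.ext (by simp only [map_add]; rfl) }
  have hρ : PadicInt.Coe.ringHom.comp ρ =
    φ.comp ((algebraMap K L).comp (algebraMap (𝓞 K) K)) := rfl
  set a' : σ → ℤ_[p] := fun i => ⟨_, hφa i⟩ with ha'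
  set b' : σ → ℤ_[p] := fun i => ⟨_, hφb i⟩ with hb'
  have hab' : ∀ i, eval₂ ρ a' (T i) = eval₂ ρ b' (T i) := fun i => by
    apply Subtype.coe_injective
    change PadicInt.Coe.ringHom _ = PadicInt.Coe.ringHom _
    rw [eval₂_comp_left, eval₂_comp_left, hρ]
    have := congr(φ $(hab i))
    rwa [eval₂_comp_left, eval₂_comp_left] at this
  refine ⟨p, hp, PadicInt.toZMod.comp ρ, fun hinj => ?_⟩
  have heq := @hinj (PadicInt.toZMod ∘ a') (PadicInt.toZMod ∘ b') (funext fun i => by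
    simp only [eval_map]
    rw [← eval₂_comp_left, ← eval₂_comp_left, hab'])
  set c : ℤ_[p] := ⟨φ (a j - b j)⁻¹, hφ _ (by simp)⟩
  have h1 : (a' j - b' j) * c = 1 := by
    apply Subtype.coe_injective
    change (φ (a j) - φ (b j)) * φ (a j - b j)⁻¹ = 1
    rw [← map_sub, ← map_mul, mul_inv_cancel₀ (sub_ne_zero.2 hj), map_one]
  have h2 := congr(PadicInt.toZMod $h1)
  rw [map_mul, map_sub, map_one, show PadicInt.toZMod (a' j) = PadicInt.toZMod (b' j) from
    congrFun heq j, sub_self, zero_mul] at h2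
  exact zero_ne_one h2

/-- A set of self-maps of the affine plane which is closed under composition and contains all
shears is transitive on pairs of distinct points. -/
theorem exists_comp_shears_map_pair {k : Type*} [Field k] {M : Set (k × k → k × k)}
    (hc : ∀ f ∈ M, ∀ g ∈ M, f ∘ g ∈ M)
    (hx : ∀ g : k → k, (fun z : k × k => (z.1 + g z.2, z.2)) ∈ M)
    (hy : ∀ g : k → k, (fun z : k × k => (z.1, z.2 + g z.1)) ∈ M)
    {z w a b : k × k} (hzw : z ≠ w) (hab : a ≠ b) : ∃ f ∈ M, f z = a ∧ f w = b := by
  classical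
  have stepx : ∀ (c d : k) (z w : k × k), z.2 ≠ w.2 → ∃ f ∈ M, f z = (c, z.2) ∧ f w = (d, w.2) := by
    intro c d z w h
    refine ⟨_, hx (fun t => if t = z.2 then c - z.1 else d - w.1), ?_, ?_⟩
    · simp
    · simp [h.symm]
  have stepy : ∀ (c d : k) (z w : k × k), z.1 ≠ w.1 → ∃ f ∈ M, f z = (z.1, c) ∧ f w = (w.1, d) := by
    intro c d z w h
    refine ⟨_, hy (fun t => if t = z.1 then c - z.2 else d - w.2), ?_, ?_⟩
    · simp
    · simp [h.symm]
  have sep : ∃ f ∈ M, (f z).2 ≠ (f w).2 := by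
    by_cases h : z.2 = w.2
    · obtain ⟨f, hf, h1, h2⟩ := stepy 0 1 z w fun h' => hzw (Prod.ext h' h)
      exact ⟨f, hf, by simp [h1, h2]⟩
    · exact ⟨_, hx 0, by simpa using h⟩
  have any : ∀ c d : k × k, c.1 ≠ d.1 → ∃ f ∈ M, f z = c ∧ f w = d := by
    intro c d hcd
    obtain ⟨f, hf, h⟩ := sep
    obtain ⟨f', hf', h1, h2⟩ := stepx c.1 d.1 _ _ h
    obtain ⟨g, hg, h3, h4⟩ := stepy c.2 d.2 (f' (f z)) (f' (f w)) (by simpa [h1, h2] using hcd)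
    exact ⟨g ∘ (f' ∘ f), hc _ hg _ (hc _ hf' _ hf),
      by simp only [Function.comp, h3]; rw [h1],
      by simp only [Function.comp, h4]; rw [h2]⟩
  by_cases h : a.1 = b.1
  · have h' : a.2 ≠ b.2 := fun h' => hab (Prod.ext h h')
    obtain ⟨f, hf, h1, h2⟩ := any (0, a.2) (1, b.2) (by simp)
    obtain ⟨g, hg, h3, h4⟩ := stepx a.1 b.1 (f z) (f w) (by simpa [h1, h2] using h')
    exact ⟨g ∘ f, hc _ hg _ hf,
      by simp only [Function.comp, h3]; rw [h1],
      by simp only [Function.comp, h4]; rw [h2]⟩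
  · exact any a b h

/-- A set of self-maps of a finite plane which is closed under composition and contains all shears
and some noninjective map contains a map whose first coordinate is not surjective. -/
theorem exists_forall_fst_ne {k : Type*} [Field k] [Finite k] {M : Set (k × k → k × k)}
    (hc : ∀ f ∈ M, ∀ g ∈ M, f ∘ g ∈ M)
    (hx : ∀ g : k → k, (fun z : k × k => (z.1 + g z.2, z.2)) ∈ M)
    (hy : ∀ g : k → k, (fun z : k × k => (z.1, z.2 + g z.1)) ∈ M)
    {h : k × k → k × k} (hM : h ∈ M) (hinj : ¬ Function.Injective h) :
    ∃ f ∈ M, ∃ c, ∀ z, (f z).1 ≠ c := by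
  obtain ⟨a, b, hab, hne⟩ : ∃ a b, h a = h b ∧ a ≠ b := by
    simpa [Function.Injective] using hinj
  obtain ⟨m, hm, hmin⟩ := exists_minimalFor_of_wellFoundedLT (· ∈ M)
    (fun f => (Set.range f).ncard) ⟨h, hM⟩
  have hsub : (Set.range m).Subsingleton := by
    rintro z hz w hw
    by_contra hzw
    obtain ⟨f, hf, h1, h2⟩ := exists_comp_shears_map_pair hc hx hy hzw hne
    have key : (Set.range (h ∘ f ∘ m)).ncard < (Set.range m).ncard := by
      rw [Set.range_comp, Set.range_comp, ← Set.image_comp]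
      refine lt_of_le_of_ne (Set.ncard_image_le (Set.toFinite _)) fun he => hzw ?_
      exact (Set.ncard_image_iff (Set.toFinite _)).1 he hz hw (by simp [h1, h2, hab])
    exact absurd (hmin (hc _ hM _ (hc _ hf _ hm)) key.le) (not_le.2 key)
  obtain ⟨c, hcne⟩ := exists_ne (m (0, 0)).1
  exact ⟨m, hm, c, fun z hz => hcne (by rw [← hz, hsub ⟨z, rfl⟩ ⟨(0, 0), rfl⟩])⟩

theorem coeff_aeval_C_mul_X {R σ : Type*} [CommRing R] (d : R) (f : MvPolynomial σ R)
    (s : σ →₀ ℕ) : coeff s (aeval (fun j => C d * X j) f) = d ^ s.degree * coeff s f := by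
  classical
  induction f using MvPolynomial.induction_on' with
  | monomial t r =>
    have : aeval (fun j => C d * X j) (monomial t r) = monomial t (d ^ t.degree * r) := by
      rw [aeval_monomial, Finsupp.prod, Finset.prod_congr rfl fun i _ => mul_pow (C d) (X i) (t i),
        Finset.prod_mul_distrib, Finset.prod_pow_eq_pow_sum, monomial_eq, C_mul, C_pow]
      simp only [Finsupp.degree_apply, Finsupp.prod, algebraMap_eq]
      ring
    rw [this, coeff_monomial, coeff_monomial]
    split_ifs with h
    · rw [h]
    · simp
  | add p q hp hq => simp only [map_add, coeff_add, hp, hq, mul_add]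

/-- After composition with a translation and a linear map, a polynomial map of the plane with
Jacobian `1` is tangent to the identity at the origin. -/
theorem exists_tangent_to_id {K : Type*} [Field K] {F : Fin 2 → MvPolynomial (Fin 2) K}
    (hF : jac F = 1) : ∃ E : Fin 2 → MvPolynomial (Fin 2) K, jac E = 1 ∧
      (∀ i, constantCoeff (E i) = 0) ∧
      (∀ i j, coeff (Finsupp.single j 1) (E i) = if j = i then 1 else 0) ∧
      ∃ (N : Fin 2 → Fin 2 → K) (c : Fin 2 → K), ∀ i, E i = ∑ j, C (N i j) * (F j - C (c j)) := by
  set m : Fin 2 → Fin 2 → K := fun j i => coeff (Finsupp.single i 1) (F j) with hm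
  set c : Fin 2 → K := fun j => constantCoeff (F j) with hc
  have hdet : m 0 0 * m 1 1 - m 0 1 * m 1 0 = 1 := by
    have h : ∀ i j, constantCoeff (pderiv i (F j)) = m j i := fun i j => by
      simp [constantCoeff_eq, coeff_pderiv, hm]
    simpa only [jac, map_sub, map_mul, h, map_one] using congr(constantCoeff $hF)
  refine ⟨![C (m 1 1) * (F 0 - C (c 0)) + C (-m 0 1) * (F 1 - C (c 1)),
    C (-m 1 0) * (F 0 - C (c 0)) + C (m 0 0) * (F 1 - C (c 1))], ?_, ?_, ?_,
    ![![m 1 1, -m 0 1], ![-m 1 0, m 0 0]], c, ?_⟩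
  · have := congr(C (σ := Fin 2) $hdet)
    simp only [map_sub, map_mul, map_one] at this
    simp only [jac] at hF ⊢
    simp
    linear_combination
      (pderiv 0 (F 0) * pderiv 1 (F 1) - pderiv 1 (F 0) * pderiv 0 (F 1)) * this + hF
  · intro i
    fin_cases i <;> simp [hc]
  · intro i j
    have h : ∀ j r, coeff (Finsupp.single j 1) (C r : MvPolynomial (Fin 2) K) = 0 := fun j r => by
      rw [coeff_C, if_neg (by simp [eq_comm])]
    have h' : ∀ i j, coeff (Finsupp.single i 1) (F j) = m j i := fun i j => rfl
    fin_cases i <;> fin_cases j <;> simp [-map_neg, coeff_C_mul, h, h'] <;>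
      first | ring1 | linear_combination hdet
  · intro i
    fin_cases i <;> simp

/-- A noninjective plane polynomial map of Jacobian `1` over the fraction field of a domain gives
rise to one with coefficients in the domain. -/
theorem exists_jac_eq_one_not_injective {A K Ω : Type*} [CommRing A] [IsDomain A] [Field K]
    [Algebra A K] [IsFractionRing A K] [Field Ω] [Algebra K Ω]
    {F : Fin 2 → MvPolynomial (Fin 2) K} (hF : jac F = 1)
    (h : ¬ Function.Injective fun (v : Fin 2 → Ω) i => aeval v (F i)) :
    ∃ T : Fin 2 → MvPolynomial (Fin 2) A, jac T = 1 ∧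
      ¬ Function.Injective fun (v : Fin 2 → Ω) i => aeval v (map (algebraMap A K) (T i)) := by
  classical
  obtain ⟨E, hE, hE0, hE1, N, c, hN⟩ := exists_tangent_to_id hF
  obtain ⟨⟨d, hd⟩, hint⟩ := IsLocalization.exist_integer_multiples_of_finset (nonZeroDivisors A)
    ((E 0).coeffs ∪ (E 1).coeffs)
  have hd' : algebraMap A K d ≠ 0 :=
    IsFractionRing.to_map_ne_zero_of_mem_nonZeroDivisors hd
  set δ := algebraMap A K d
  have hint' : ∀ i s, ∃ r, algebraMap A K r = δ * coeff s (E i) := fun i s => by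
    by_cases hs : coeff s (E i) = 0
    · exact ⟨0, by simp [hs]⟩
    · have : coeff s (E i) ∈ (E 0).coeffs ∪ (E 1).coeffs := by
        have h := coeff_mem_coeffs s hs
        fin_cases i
        · exact Finset.mem_union_left _ h
        · exact Finset.mem_union_right _ h
      obtain ⟨r, hr⟩ := hint _ this
      exact ⟨r, by simpa [Algebra.smul_def] using hr⟩
  set T' : Fin 2 → MvPolynomial (Fin 2) K :=
    fun i => C δ⁻¹ * aeval (fun j => C δ * X j) (E i) with hT'
  have hmem : ∀ i, T' i ∈ Set.range (map (algebraMap A K)) := fun i => by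
    rw [mem_range_map_iff_coeffs_subset]
    intro r hr
    obtain ⟨s, -, rfl⟩ := mem_coeffs_iff.1 hr
    rw [hT', coeff_C_mul, coeff_aeval_C_mul_X]
    obtain hs | hs | hs : s.degree = 0 ∨ s.degree = 1 ∨ 2 ≤ s.degree := by omega
    · rw [(Finsupp.degree_eq_zero_iff s).1 hs]
      exact ⟨0, by simpa [constantCoeff_eq] using Or.inr (hE0 i)⟩
    · obtain ⟨j, rfl⟩ : s ∈ Set.range fun j => Finsupp.single j 1 := by
        rw [Finsupp.range_single_one]; exact hs
      rw [hs, hE1]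
      exact ⟨if j = i then 1 else 0, by split_ifs <;> simp [hd']⟩
    · obtain ⟨r, hr⟩ := hint' i s
      obtain ⟨n, hn⟩ := Nat.exists_eq_add_of_le hs
      refine ⟨d ^ n * r, ?_⟩
      rw [hn, map_mul, map_pow, hr]
      field_simp
      ring
  choose T hT using hmem
  have hTjac : jac T' = 1 := by
    have h1 : jac (fun i => aeval (fun j => C δ * X j) (E i)) = C δ * C δ := by
      rw [jac_comp, hE, map_one]
      simp [jac, Derivation.leibniz]
    have h2 : (C δ⁻¹ * C δ : MvPolynomial (Fin 2) K) = 1 := by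
      rw [← C_mul, inv_mul_cancel₀ hd', C_1]
    simp only [jac, hT', pderiv_C_mul] at h1 ⊢
    linear_combination (C δ⁻¹) ^ 2 * h1 + (C δ⁻¹ * C δ + 1) * h2
  refine ⟨T, map_injective _ (IsFractionRing.injective A K) ?_, fun hinj => h fun α β hαβ => ?_⟩
  · rw [← jac_map, funext hT, hTjac, map_one]
  set δ' := algebraMap K Ω δ
  have hδ' : δ' ≠ 0 := by simpa [δ'] using hd'
  have hev : ∀ (v : Fin 2 → Ω) i, aeval (fun j => δ'⁻¹ * v j) (map (algebraMap A K) (T i)) =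
      δ'⁻¹ * aeval v (E i) := fun v i => by
    rw [hT, hT', map_mul, comp_aeval_apply]
    simp [δ', hδ', ← algebraMap_eq]
  have := @hinj (fun j => δ'⁻¹ * α j) (fun j => δ'⁻¹ * β j) (funext fun i => by
    simp only [hev]
    rw [hN]
    have h' : ∀ j, aeval α (F j) = aeval β (F j) := congrFun hαβ
    simp [h'])
  exact funext fun j => mul_left_cancel₀ (inv_ne_zero hδ') (congrFun this j)

theorem eval_aeval_eq_eval {R σ τ : Type*} [CommRing R] (v : τ → R) (G : σ → MvPolynomial τ R)
    (f : MvPolynomial σ R) : eval v (aeval G f) = eval (fun i => eval v (G i)) f := by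
  rw [← coe_aeval_eq_eval, ← coe_aeval_eq_eval, RingHom.coe_coe, RingHom.coe_coe, comp_aeval_apply]

/-- If `π` maps onto a finite field and there is a polynomial map of Jacobian `1` which is not
injective after reduction along `π`, then there is another one whose first component has no zero
after reduction along `π`. -/
theorem exists_forall_eval_map_ne_zero {A k : Type*} [CommRing A] [Field k] [Finite k]
    {π : A →+* k} (hπ : Function.Surjective π) {T : Fin 2 → MvPolynomial (Fin 2) A}
    (hT : jac T = 1)
    (hinj : ¬ Function.Injective fun (v : Fin 2 → k) i => eval v (map π (T i))) :
    ∃ F : Fin 2 → MvPolynomial (Fin 2) A, jac F = 1 ∧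
      ∀ v : Fin 2 → k, eval v (map π (F 0)) ≠ 0 := by
  classical
  have := Fintype.ofFinite k
  let red (F : Fin 2 → MvPolynomial (Fin 2) A) (z : k × k) : k × k :=
    (eval ![z.1, z.2] (map π (F 0)), eval ![z.1, z.2] (map π (F 1)))
  have hred : ∀ F (v : Fin 2 → k), red F (v 0, v 1) =
      (eval v (map π (F 0)), eval v (map π (F 1))) := fun F v => by
    have : ![v 0, v 1] = v := by ext i; fin_cases i <;> rfl
    simp only [red, this]
  set M : Set (k × k → k × k) := {f | ∃ F, jac F = 1 ∧ f = red F}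
  have hlift : ∀ g : k → k, ∃ q : Polynomial A, ∀ t, (q.map π).eval t = g t := fun g => by
    obtain ⟨q, hq⟩ := Polynomial.map_surjective π hπ (Lagrange.interpolate Finset.univ id g)
    refine ⟨q, fun t => ?_⟩
    rw [hq]
    exact Lagrange.eval_interpolate_at_node g Function.injective_id.injOn (Finset.mem_univ t)
  have hev : ∀ (q : Polynomial A) (i : Fin 2) (v : Fin 2 → k),
      eval v (map π (Polynomial.aeval (X i) q)) = (q.map π).eval (v i) := fun q i v => by
    rw [Polynomial.aeval_def, Polynomial.hom_eval₂, Polynomial.hom_eval₂, Polynomial.eval_map,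
      map_X, eval_X]
    congr 1
    ext a
    simp [algebraMap_eq]
  have hpd : ∀ (q : Polynomial A) (i j : Fin 2), i ≠ j →
      pderiv i (Polynomial.aeval (X j : MvPolynomial (Fin 2) A) q) = 0 := fun q i j hij => by
    rw [Derivation.map_aeval, pderiv_X_of_ne hij.symm, smul_zero]
  have hcomp : ∀ f ∈ M, ∀ g ∈ M, f ∘ g ∈ M := by
    rintro _ ⟨F, hF, rfl⟩ _ ⟨G, hG, rfl⟩
    refine ⟨fun i => aeval G (F i), by rw [jac_comp, hF, hG, map_one, one_mul], ?_⟩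
    funext z
    have h : ∀ i, eval ![(red G z).1, (red G z).2] (map π (F i)) =
        eval ![z.1, z.2] (map π (aeval G (F i))) := fun i => by
      rw [map_aeval_eq_aeval_map, eval_aeval_eq_eval]
      congr 2
      funext j
      fin_cases j <;> rfl
    exact Prod.ext (h 0) (h 1)
  have hshearX : ∀ g : k → k, (fun z : k × k => (z.1 + g z.2, z.2)) ∈ M := by
    intro g
    obtain ⟨q, hq⟩ := hlift g
    refine ⟨![X 0 + Polynomial.aeval (X 1) q, X 1], ?_, ?_⟩
    · simp [jac, hpd]
    · funext z
      simp [red, -eval_map, hev, hq]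
  have hshearY : ∀ g : k → k, (fun z : k × k => (z.1, z.2 + g z.1)) ∈ M := by
    intro g
    obtain ⟨q, hq⟩ := hlift g
    refine ⟨![X 0, X 1 + Polynomial.aeval (X 0) q], ?_, ?_⟩
    · simp [jac, hpd]
    · funext z
      simp [red, -eval_map, hev, hq]
  have hred_inj : ¬ Function.Injective (red T) := by
    intro h
    refine hinj fun v w hvw => ?_
    have h2 := @h (v 0, v 1) (w 0, w 1) (by
      rw [hred, hred]; exact Prod.ext (congrFun hvw 0) (congrFun hvw 1))
    funext i
    fin_cases i
    · exact congr(($h2).1)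
    · exact congr(($h2).2)
  obtain ⟨-, ⟨F, hF, rfl⟩, c, hc⟩ := exists_forall_fst_ne hcomp hshearX hshearY
    ⟨T, hT, rfl⟩ hred_inj
  obtain ⟨a, rfl⟩ := hπ c
  refine ⟨![F 0 - C a, F 1], by simpa [jac] using hF, fun v => ?_⟩
  have := hc (v 0, v 1)
  rw [hred] at this
  simpa [sub_eq_zero] using this

/-- **Plane Jacobian conjecture over a number field vs integral points.**
Let `K` be a number field with ring of integers `𝓞 K`. The following are equivalent:
(i) every pair `P, Q ∈ K[x,y]` with Jacobian determinant identically `1` is invertible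
over `K`; (ii) for every pair `P, Q ∈ 𝓞 K[x,y]` with Jacobian determinant identically `1`,
the curve `P = 0` has at least two distinct integral points. -/
theorem plane_jacobian_iff_two_integral_points
    (K : Type*) [Field K] [NumberField K] :
    (∀ P Q : MvPolynomial (Fin 2) K,
        pderiv 0 P * pderiv 1 Q - pderiv 1 P * pderiv 0 Q = 1 →
        ∃ U V : MvPolynomial (Fin 2) K,
          aeval ![P, Q] U = X 0 ∧ aeval ![P, Q] V = X 1 ∧
          aeval ![U, V] P = X 0 ∧ aeval ![U, V] Q = X 1) ↔
    (∀ P Q : MvPolynomial (Fin 2) (𝓞 K),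
        pderiv 0 P * pderiv 1 Q - pderiv 1 P * pderiv 0 Q = 1 →
        ∃ a b c d : 𝓞 K, (a, b) ≠ (c, d) ∧
          eval ![a, b] P = 0 ∧ eval ![c, d] P = 0) := by
  constructor
  · intro h P Q hPQ
    have hjac := jac_map (algebraMap (𝓞 K) K) ![P, Q]
    rw [show jac ![P, Q] = 1 from hPQ, map_one] at hjac
    obtain ⟨U, V, hU, hV, hP, hQ⟩ := h (map (algebraMap (𝓞 K) K) P)
      (map (algebraMap (𝓞 K) K) Q) hjac
    have hvec : (fun j => map (algebraMap (𝓞 K) K) (![P, Q] j)) =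
        ![map (algebraMap (𝓞 K) K) P, map (algebraMap (𝓞 K) K) Q] := by
      ext1 j; fin_cases j <;> rfl
    obtain ⟨W, hW⟩ := exists_inverse_of_exists_inverse_map
      (RingOfIntegers.coe_injective) (F := ![P, Q]) hPQ (U := ![U, V])
      (by rw [hvec]; exact Fin.forall_fin_two.2 ⟨hU, hV⟩)
      (Fin.forall_fin_two.2 ⟨hP, hQ⟩)
    have hroot : ∀ (t : 𝓞 K) (f : MvPolynomial (Fin 2) (𝓞 K)),
        eval ![eval ![0, t] (W 0), eval ![0, t] (W 1)] f = eval ![0, t] (aeval W f) := by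
      intro t f
      rw [eval_aeval_eq_eval]
      congr 2
      funext j
      fin_cases j <;> rfl
    have hWP := hW 0
    have hWQ := hW 1
    simp only [Matrix.cons_val_zero, Matrix.cons_val_one] at hWP hWQ
    refine ⟨_, _, _, _, fun heq => ?_, (hroot 0 P).trans ?_, (hroot 1 P).trans ?_⟩
    · have h0 := hroot 0 Q
      have h1 := hroot 1 Q
      rw [Prod.ext_iff] at heq
      simp only at heq
      rw [hWQ] at h0 h1
      rw [heq.1, heq.2, h1] at h0
      simp at h0
    · rw [hWP]; simp
    · rw [hWP]; simp
  · intro h P Q hPQ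
    suffices hinj : Function.Injective
        fun (v : Fin 2 → AlgebraicClosure K) i => aeval v (![P, Q] i) by
      obtain ⟨G, hG, hG'⟩ := exists_inverse_of_injective (F := ![P, Q]) hPQ hinj
      have hvec : ![G 0, G 1] = G := by ext1 j; fin_cases j <;> rfl
      exact ⟨G 0, G 1, hG 0, hG 1, hvec ▸ hG' 0, hvec ▸ hG' 1⟩
    by_contra hinj
    obtain ⟨T, hT, hTinj⟩ := exists_jac_eq_one_not_injective (A := 𝓞 K) (F := ![P, Q]) hPQ hinj
    obtain ⟨p, hp, π, hπ⟩ := exists_ringHom_zmod_not_injective hTinj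
    obtain ⟨F, hF, hne⟩ := exists_forall_eval_map_ne_zero (ZMod.ringHom_surjective π) hT hπ
    obtain ⟨a, b, -, -, -, hab, -⟩ := h (F 0) (F 1) hF
    refine hne (π ∘ ![a, b]) ?_
    rw [eval_map, ← eval₂_comp, hab, map_zero]
end

section
/- Let K be a number field with ring of integers O_K, let Φ ∈ O_K[X₁,…,Xₙ]ⁿ have the form Φ(X) = X + Φ₂(X) + ⋯ + Φ_m(X) where each Φ_i is homogeneous of degree i, and let L be a 1-dimensional K-linear subspace of Kⁿ. If the set {x ∈ O_Kⁿ : Φ(x) ∈ L} is finite, then there exists a nonzero r ∈ O_K such that the only point x ∈ O_Kⁿ with ʳΦ(x) ∈ L is the origin x = (0,…,0), where ʳΦ(X) = (1/r)Φ(rX). -/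
open MvPolynomial NumberField

/-- In a domain that is not a field, some nonzero element divides no nonzero element of a given
finite set. -/
theorem exists_ne_zero_forall_mem_dvd_eq_zero {R : Type*} [CommRing R] [IsDomain R]
    (hR : ¬ IsField R) {T : Set R} (hT : T.Finite) :
    ∃ r : R, r ≠ 0 ∧ ∀ c ∈ T, r ∣ c → c = 0 := by
  classical
  obtain ⟨p, hp0, hp⟩ := Ring.exists_not_isUnit_of_not_isField hR
  set S := hT.toFinset.filter (· ≠ 0) with hS
  have hprod : ∏ c ∈ S, c ≠ 0 := Finset.prod_ne_zero_iff.mpr fun c hc => (Finset.mem_filter.mp hc).2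
  refine ⟨p * ∏ c ∈ S, c, mul_ne_zero hp0 hprod, fun c hc hdvd => ?_⟩
  by_contra hc0
  have hcS : c ∈ S := by simp [hS, hc, hc0]
  have h : p * c ∣ 1 * c := by
    rw [one_mul]
    exact (mul_dvd_mul_left p (Finset.dvd_prod_of_mem _ hcS)).trans hdvd
  exact hp (isUnit_of_dvd_one ((mul_dvd_mul_iff_right hc0).mp h))

/-- Evaluating a homogeneous polynomial at a scaled point. -/
theorem MvPolynomial.IsHomogeneous.eval_smul_point {σ R : Type*} [CommSemiring R]
    {p : MvPolynomial σ R} {d : ℕ} (hp : p.IsHomogeneous d) (r : R) (x : σ → R) :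
    eval (r • x) p = r ^ d * eval x p := by
  rw [eval_eq, eval_eq, Finset.mul_sum]
  refine Finset.sum_congr rfl fun s hs => ?_
  have hdeg : ∑ i ∈ s.support, s i = d := by
    have := hp (mem_support_iff.mp hs)
    simpa [Finsupp.weight_apply, Finsupp.sum] using this
  simp only [Pi.smul_apply, smul_eq_mul, mul_pow, Finset.prod_mul_distrib,
    Finset.prod_pow_eq_pow_sum, hdeg]
  ring

/-- The clearing identity `r · ʳΦ(x) = Φ(rx)`, for one coordinate of `Φ`. -/
theorem mul_eval_clearing {σ R : Type*} [CommSemiring R] (m : ℕ)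
    {g : ℕ → MvPolynomial σ R} (hg : ∀ d, (g d).IsHomogeneous d) (r : R) (x : σ → R) (i : σ) :
    r * eval x (X i + ∑ d ∈ Finset.Icc 2 m, C (r ^ (d - 1)) * g d) =
      eval (r • x) (X i + ∑ d ∈ Finset.Icc 2 m, g d) := by
  simp only [map_add, eval_X, map_sum, map_mul, eval_C, mul_add, Finset.mul_sum, Pi.smul_apply,
    smul_eq_mul, (hg _).eval_smul_point]
  congr 1
  refine Finset.sum_congr rfl fun d hd => ?_
  rw [← mul_assoc, mul_pow_sub_one (by have := (Finset.mem_Icc.mp hd).1; omega)]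

/-- Let `Φ(X) = X + Φ₂(X) + ⋯ + Φ_m(X)` be a polynomial map with coefficients in `𝓞 K`
(`Φ_i` homogeneous of degree `i`), and let `L` be a `1`-dimensional `K`-subspace of `Kⁿ`.
If only finitely many integral points `x ∈ (𝓞 K)ⁿ` satisfy `Φ(x) ∈ L`, then there is a
nonzero `r ∈ 𝓞 K` such that the origin is the unique integral point `x` with
`ʳΦ(x) = X + rΦ₂ + ⋯ + r^(m-1)Φ_m` evaluated at `x` lying in `L`. -/
theorem exists_clearing_map_unique_integral_point_in_line
    (K : Type*) [Field K] [NumberField K] (n m : ℕ)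
    (Φ : Fin n → MvPolynomial (Fin n) (𝓞 K))
    (G : ℕ → Fin n → MvPolynomial (Fin n) (𝓞 K))
    (hG : ∀ d i, (G d i).IsHomogeneous d)
    (hform : ∀ i, Φ i = X i + ∑ d ∈ Finset.Icc 2 m, G d i)
    (L : Submodule K (Fin n → K)) (hL : Module.finrank K L = 1)
    (hfin : {x : Fin n → 𝓞 K |
        (fun i => algebraMap (𝓞 K) K (eval x (Φ i))) ∈ L}.Finite) :
    ∃ r : 𝓞 K, r ≠ 0 ∧ ∀ x : Fin n → 𝓞 K,
      (fun i => algebraMap (𝓞 K) K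
          (eval x (X i + ∑ d ∈ Finset.Icc 2 m, C (r ^ (d - 1)) * G d i))) ∈ L →
      x = 0 := by
  set S := {x : Fin n → 𝓞 K | (fun i => algebraMap (𝓞 K) K (eval x (Φ i))) ∈ L}
  have hT : (⋃ i, (fun x : Fin n → 𝓞 K => x i) '' S).Finite :=
    Set.finite_iUnion fun i => hfin.image _
  obtain ⟨r, hr0, hr⟩ :=
    exists_ne_zero_forall_mem_dvd_eq_zero (RingOfIntegers.not_isField K) hT
  refine ⟨r, hr0, fun x hx => ?_⟩
  have hmem : r • x ∈ S := by
    have h := L.smul_mem (algebraMap (𝓞 K) K r) hx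
    change (fun i => algebraMap (𝓞 K) K (eval (r • x) (Φ i))) ∈ L
    convert h using 1
    funext i
    rw [Pi.smul_apply, smul_eq_mul, ← map_mul, mul_eval_clearing m (fun d => hG d i), hform i]
  funext i
  have h := hr (r * x i) (Set.mem_iUnion.mpr ⟨i, r • x, hmem, rfl⟩) (dvd_mul_right r _)
  exact (mul_eq_zero.mp h).resolve_left hr0
end

section
/- Let K be a number field with ring of integers O_K. The following two statements are equivalent: (i) every pair P, Q ∈ K[x,y] with ∂P/∂x·∂Q/∂y − ∂P/∂y·∂Q/∂x = 1 gives a map F = (P,Q) that is invertible over K; (i') every pair P, Q ∈ O_K[x,y] with ∂P/∂x·∂Q/∂y − ∂P/∂y·∂Q/∂x = 1 gives a map F = (P,Q) that is invertible over O_K, i.e., has a polynomial inverse with coefficients in O_K. -/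
open MvPolynomial NumberField

namespace MvPolynomial

section Composition

variable {σ R : Type*} [CommRing R]

theorem aeval_aeval_comp (F G : σ → MvPolynomial σ R) (p : MvPolynomial σ R) :
    aeval (fun i => aeval F (G i)) p = aeval F (aeval G p) :=
  (comp_aeval_apply G (aeval F) p).symm

theorem map_aeval_map {S : Type*} [CommRing S] (f : R →+* S) (F : σ → MvPolynomial σ R)
    (p : MvPolynomial σ R) :
    map f (aeval F p) = aeval (fun i => map f (F i)) (map f p) :=
  map_bind₁ f F p

/-- A polynomial map is invertible iff the induced substitution homomorphism is bijective. -/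
theorem bijective_aeval_iff {F : σ → MvPolynomial σ R} :
    Function.Bijective (aeval F : MvPolynomial σ R →ₐ[R] MvPolynomial σ R) ↔
      ∃ G : σ → MvPolynomial σ R, (∀ i, aeval F (G i) = X i) ∧ ∀ i, aeval G (F i) = X i := by
  constructor
  · rintro ⟨hinj, hsurj⟩
    choose G hG using fun i => hsurj (X i)
    refine ⟨G, hG, fun i => hinj ?_⟩
    rw [← aeval_aeval_comp, aeval_X]
    simp only [hG, aeval_X_left_apply]
  · rintro ⟨G, h₁, h₂⟩
    refine Function.bijective_iff_has_inverse.mpr ⟨aeval G, fun p => ?_, fun p => ?_⟩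
    · simp only [← aeval_aeval_comp, h₂, aeval_X_left_apply]
    · simp only [← aeval_aeval_comp, h₁, aeval_X_left_apply]

theorem bijective_aeval_map {S : Type*} [CommRing S] (f : R →+* S) {F : σ → MvPolynomial σ R}
    (h : Function.Bijective (aeval F : MvPolynomial σ R →ₐ[R] MvPolynomial σ R)) :
    Function.Bijective
      (aeval fun i => map f (F i) : MvPolynomial σ S →ₐ[S] MvPolynomial σ S) := by
  obtain ⟨G, h₁, h₂⟩ := bijective_aeval_iff.mp h
  refine bijective_aeval_iff.mpr ⟨fun i => map f (G i), fun i => ?_, fun i => ?_⟩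
  · rw [← map_aeval_map, h₁, map_X]
  · rw [← map_aeval_map, h₂, map_X]

theorem aeval_sub_mem_pow_idealOfVars {G : σ → MvPolynomial σ R}
    (hG : ∀ i, G i - X i ∈ idealOfVars σ R ^ 2) {n : ℕ} {p : MvPolynomial σ R}
    (hp : p ∈ idealOfVars σ R ^ n) : aeval G p - p ∈ idealOfVars σ R ^ (n + 1) := by
  have h₀ (p : MvPolynomial σ R) : aeval G p - p ∈ idealOfVars σ R := by
    have h : (Ideal.Quotient.mkₐ R (idealOfVars σ R)).comp (aeval G) =
        Ideal.Quotient.mkₐ R (idealOfVars σ R) := by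
      ext i
      rw [AlgHom.comp_apply, aeval_X]
      exact (Ideal.Quotient.mk_eq_mk_iff_sub_mem _ _).mpr (Ideal.pow_le_self two_ne_zero (hG i))
    exact (Ideal.Quotient.mk_eq_mk_iff_sub_mem _ _).mp (DFunLike.congr_fun h p)
  have h₁ {p : MvPolynomial σ R} (hp : p ∈ idealOfVars σ R) :
      aeval G p - p ∈ idealOfVars σ R ^ 2 := by
    induction hp using Submodule.span_induction with
    | mem x hx =>
      obtain ⟨i, rfl⟩ := hx
      simpa using hG i
    | zero => simp
    | add x y _ _ hx hy => simpa [add_sub_add_comm] using add_mem hx hy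
    | smul a x hx ih =>
      have h : aeval G (a • x) - a • x = aeval G a * (aeval G x - x) + (aeval G a - a) * x := by
        simp only [smul_eq_mul, map_mul]
        ring
      rw [h]
      refine add_mem (Ideal.mul_mem_left _ _ ih) ?_
      rw [pow_two]
      exact Ideal.mul_mem_mul (h₀ a) hx
  induction n generalizing p with
  | zero => simpa using h₀ p
  | succ n ih =>
    rw [pow_succ] at hp
    induction hp using Submodule.mul_induction_on' with
    | mem_mul_mem a ha b hb =>
      have h : aeval G (a * b) - a * b = aeval G a * (aeval G b - b) + (aeval G a - a) * b := by
        rw [map_mul]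
        ring
      have ha' : aeval G a ∈ idealOfVars σ R ^ n := by
        simpa using add_mem (Ideal.pow_le_pow_right n.le_succ (ih ha)) ha
      rw [h]
      refine add_mem ?_ ?_
      · rw [add_assoc, pow_add]
        exact Ideal.mul_mem_mul ha' (h₁ hb)
      · rw [pow_succ]
        exact Ideal.mul_mem_mul (ih ha) hb
    | add x _ y _ hx hy => simpa [add_sub_add_comm] using add_mem hx hy

theorem injective_aeval_of_sub_X_mem {G : σ → MvPolynomial σ R}
    (hG : ∀ i, G i - X i ∈ idealOfVars σ R ^ 2) :
    Function.Injective (aeval G : MvPolynomial σ R →ₐ[R] MvPolynomial σ R) := by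
  refine (injective_iff_map_eq_zero _).mpr fun p hp => ?_
  have h (n : ℕ) : p ∈ idealOfVars σ R ^ n := by
    induction n with
    | zero => simp
    | succ n ih =>
      have := aeval_sub_mem_pow_idealOfVars hG ih
      rwa [hp, zero_sub, neg_mem_iff] at this
  ext m
  exact (mem_pow_idealOfVars_iff' _ _).mp (h (m.degree + 1)) m (Nat.lt_succ_self _)

theorem coeff_aeval_C_mul_X (c : R) (p : MvPolynomial σ R) (m : σ →₀ ℕ) :
    coeff m (aeval (fun i => C c * X i) p) = c ^ m.degree * coeff m p := by
  classical
  induction p using MvPolynomial.induction_on' with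
  | monomial u a =>
    have h : aeval (fun i => C c * X i) (monomial u a) =
        (monomial u (c ^ u.degree * a) : MvPolynomial σ R) := by
      rw [aeval_monomial, monomial_eq (a := c ^ u.degree * a), Finsupp.degree_apply]
      simp only [mul_pow, Finsupp.prod_mul]
      simp [Finsupp.prod, Finset.prod_pow_eq_pow_sum]
      ring
    rw [h, coeff_monomial, coeff_monomial]
    split_ifs with hm <;> simp [hm]
  | add p q hp hq => simp only [map_add, coeff_add, hp, hq, mul_add]

theorem pderiv_aeval_C_mul_X (c : R) (p : MvPolynomial σ R) (i : σ) :
    pderiv i (aeval (fun j => C c * X j) p) =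
      C c * aeval (fun j => C c * X j) (pderiv i p) := by
  ext m
  simp only [coeff_pderiv, coeff_C_mul, coeff_aeval_C_mul_X, map_add, Finsupp.degree_single]
  ring

end Composition

section Jacobian

variable {R : Type*} [CommRing R]

/-- The Jacobian determinant of a plane polynomial map. -/
noncomputable def planeJacobian (F : Fin 2 → MvPolynomial (Fin 2) R) : MvPolynomial (Fin 2) R :=
  pderiv 0 (F 0) * pderiv 1 (F 1) - pderiv 1 (F 0) * pderiv 0 (F 1)

theorem planeJacobian_map {S : Type*} [CommRing S] (f : R →+* S)
    (F : Fin 2 → MvPolynomial (Fin 2) R) :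
    planeJacobian (fun i => map f (F i)) = map f (planeJacobian F) := by
  simp [planeJacobian, pderiv_map]

theorem sub_X_mem_idealOfVars_sq {p : MvPolynomial (Fin 2) R} {i : Fin 2}
    (h₀ : constantCoeff p = 0) (h : ∀ j, constantCoeff (pderiv j p) = if j = i then 1 else 0) :
    p - X i ∈ idealOfVars (Fin 2) R ^ 2 := by
  refine (mem_pow_idealOfVars_iff' _ _).mpr fun m hm => ?_
  obtain hm | hm : m.degree = 0 ∨ m.degree = 1 := by omega
  · rw [Finsupp.degree_eq_zero_iff] at hm
    simpa [hm, constantCoeff_eq] using h₀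
  · obtain ⟨j, rfl⟩ : ∃ j, m = Finsupp.single j 1 := by
      rw [Finsupp.degree_eq_sum, Fin.sum_univ_two] at hm
      obtain h | h : m 0 = 1 ∧ m 1 = 0 ∨ m 0 = 0 ∧ m 1 = 1 := by omega
      · exact ⟨0, by ext i; fin_cases i <;> simp [h]⟩
      · exact ⟨1, by ext i; fin_cases i <;> simp [h]⟩
    have := h j
    simp only [constantCoeff_eq, coeff_pderiv, zero_add] at this
    rw [coeff_sub, coeff_X]
    by_cases hji : j = i
    · subst hji
      simpa [sub_eq_zero] using this
    · simpa [hji, Ne.symm hji, Finsupp.single_left_inj] using this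

/-- A plane polynomial map with Jacobian one can be composed with an affine automorphism to become
tangent to the identity at the origin. -/
theorem exists_affine_normalization {F : Fin 2 → MvPolynomial (Fin 2) R}
    (hF : planeJacobian F = 1) :
    ∃ B : Fin 2 → MvPolynomial (Fin 2) R,
      Function.Bijective (aeval B : MvPolynomial (Fin 2) R →ₐ[R] MvPolynomial (Fin 2) R) ∧
      planeJacobian (fun i => aeval F (B i)) = 1 ∧
      ∀ i, aeval F (B i) - X i ∈ idealOfVars (Fin 2) R ^ 2 := by
  set a := constantCoeff (pderiv 0 (F 0)) with ha
  set b := constantCoeff (pderiv 1 (F 0)) with hb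
  set c := constantCoeff (pderiv 0 (F 1)) with hc
  set d := constantCoeff (pderiv 1 (F 1)) with hd
  set p := constantCoeff (F 0) with hp
  set q := constantCoeff (F 1) with hq
  have hdet : a * d - b * c = 1 := by
    simpa [planeJacobian] using congrArg constantCoeff hF
  have hdetC : (C a * C d - C b * C c : MvPolynomial (Fin 2) R) = 1 := by
    simp only [← C_mul, ← C_sub, hdet, C_1]
  refine ⟨![C d * (X 0 - C p) - C b * (X 1 - C q), C a * (X 1 - C q) - C c * (X 0 - C p)],
    ?_, ?_, ?_⟩
  · refine bijective_aeval_iff.mpr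
      ⟨![C a * X 0 + C b * X 1 + C p, C c * X 0 + C d * X 1 + C q], ?_, ?_⟩
    · simp only [Fin.forall_fin_two, Matrix.cons_val_zero, Matrix.cons_val_one, map_add, map_mul,
        aeval_X, aeval_C, algebraMap_eq]
      constructor
      · linear_combination (X 0 - C p) * hdetC
      · linear_combination (X 1 - C q) * hdetC
    · simp only [Fin.forall_fin_two, Matrix.cons_val_zero, Matrix.cons_val_one, map_mul, map_sub,
        aeval_X, aeval_C, algebraMap_eq]
      constructor
      · linear_combination X 0 * hdetC
      · linear_combination X 1 * hdetC
  · unfold planeJacobian at hF ⊢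
    simp only [Matrix.cons_val_zero, Matrix.cons_val_one, map_mul, map_sub, aeval_X, aeval_C,
      algebraMap_eq, pderiv_C_mul, pderiv_C, sub_zero]
    linear_combination (C a * C d - C b * C c) * hF + hdetC
  · refine Fin.forall_fin_two.mpr ⟨sub_X_mem_idealOfVars_sq ?_ ?_, sub_X_mem_idealOfVars_sq ?_ ?_⟩
    · simp [← hp, ← hq]
    · simp [Fin.forall_fin_two, ← ha, ← hb, ← hc, ← hd]
      exact ⟨by linear_combination hdet, by ring⟩
    · simp [← hp, ← hq]
    · simp [Fin.forall_fin_two, ← ha, ← hb, ← hc, ← hd]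
      exact ⟨by ring, by linear_combination hdet⟩

theorem injective_aeval_of_planeJacobian_eq_one {F : Fin 2 → MvPolynomial (Fin 2) R}
    (hF : planeJacobian F = 1) :
    Function.Injective (aeval F : MvPolynomial (Fin 2) R →ₐ[R] MvPolynomial (Fin 2) R) := by
  obtain ⟨B, hB, -, hG⟩ := exists_affine_normalization hF
  intro p q hpq
  obtain ⟨p, rfl⟩ := hB.2 p
  obtain ⟨q, rfl⟩ := hB.2 q
  rw [← aeval_aeval_comp, ← aeval_aeval_comp] at hpq
  rw [injective_aeval_of_sub_X_mem hG hpq]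

theorem C_dvd_of_C_dvd_aeval {F : Fin 2 → MvPolynomial (Fin 2) R} (hF : planeJacobian F = 1)
    {c : R} {p : MvPolynomial (Fin 2) R} (h : C c ∣ aeval F p) : C c ∣ p := by
  have hc (r : R) : Ideal.Quotient.mk (Ideal.span {c}) r = 0 ↔ c ∣ r := by
    rw [Ideal.Quotient.eq_zero_iff_mem, Ideal.mem_span_singleton]
  rw [C_dvd_iff_map_hom_eq_zero _ _ hc] at h ⊢
  refine injective_aeval_of_planeJacobian_eq_one
    (F := fun i => map (Ideal.Quotient.mk (Ideal.span {c})) (F i)) ?_ ?_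
  · rw [planeJacobian_map, hF, map_one]
  · rw [← map_aeval_map, h, map_zero]

end Jacobian

section FractionField

variable {R K : Type*} [CommRing R] [IsDomain R] [Field K] [Algebra R K] [IsFractionRing R K]

variable (R) in
theorem exists_C_mul_eq_map {σ : Type*} (p : MvPolynomial σ K) :
    ∃ c : R, c ≠ 0 ∧ ∃ q : MvPolynomial σ R,
      C (algebraMap R K c) * p = map (algebraMap R K) q := by
  let _ : Algebra (MvPolynomial σ R) (MvPolynomial σ K) := algebraMvPolynomial
  obtain ⟨⟨q, s⟩, h⟩ := IsLocalization.surj ((nonZeroDivisors R).map (C (σ := σ))) p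
  obtain ⟨c, hc, hcs⟩ := s.2
  refine ⟨c, nonZeroDivisors.ne_zero hc, q, ?_⟩
  rw [mul_comm, ← map_C, hcs]
  exact h

variable (K) in
theorem bijective_aeval_of_bijective_aeval_map {F : Fin 2 → MvPolynomial (Fin 2) R}
    (hF : planeJacobian F = 1)
    (h : Function.Bijective (aeval fun i => map (algebraMap R K) (F i) :
      MvPolynomial (Fin 2) K →ₐ[K] MvPolynomial (Fin 2) K)) :
    Function.Bijective (aeval F : MvPolynomial (Fin 2) R →ₐ[R] MvPolynomial (Fin 2) R) := by
  refine ⟨injective_aeval_of_planeJacobian_eq_one hF, fun t => ?_⟩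
  obtain ⟨u, hu⟩ := h.2 (map (algebraMap R K) t)
  obtain ⟨c, hc, w, hw⟩ := exists_C_mul_eq_map R u
  have hcw : aeval F w = C c * t := by
    apply map_injective _ (IsFractionRing.injective R K)
    rw [map_aeval_map, ← hw, map_mul, aeval_C, algebraMap_eq, hu, map_mul, map_C]
  obtain ⟨v, rfl⟩ := C_dvd_of_C_dvd_aeval hF (Dvd.intro t hcw.symm)
  refine ⟨v, mul_left_cancel₀ (C_ne_zero.mpr hc) ?_⟩
  rw [← hcw, map_mul, aeval_C, algebraMap_eq]

theorem bijective_aeval_of_forall_bijective_aeval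
    (h : ∀ F : Fin 2 → MvPolynomial (Fin 2) R, planeJacobian F = 1 →
      Function.Bijective (aeval F : MvPolynomial (Fin 2) R →ₐ[R] MvPolynomial (Fin 2) R))
    {F : Fin 2 → MvPolynomial (Fin 2) K} (hF : planeJacobian F = 1) :
    Function.Bijective (aeval F : MvPolynomial (Fin 2) K →ₐ[K] MvPolynomial (Fin 2) K) := by
  obtain ⟨B, hB, hJ, hG⟩ := exists_affine_normalization hF
  set G := fun i => aeval F (B i) with hGdef
  suffices hGbij : Function.Bijective (aeval G : MvPolynomial (Fin 2) K →ₐ[K] _) by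
    refine (Function.Bijective.of_comp_iff (aeval F) hB).mp ?_
    convert hGbij using 1
    ext1 p
    exact (aeval_aeval_comp F B p).symm
  choose b hb q hq using fun i => exists_C_mul_eq_map R (G i - X i)
  set c : K := algebraMap R K (b 0 * b 1) with hcdef
  have hc : c ≠ 0 := by
    simpa [hcdef] using ⟨hb 0, hb 1⟩
  have hcC : (C c * C c⁻¹ : MvPolynomial (Fin 2) K) = 1 := by
    rw [← C_mul, mul_inv_cancel₀ hc, C_1]
  have hint (i : Fin 2) (m : Fin 2 →₀ ℕ) :
      c * coeff m (G i - X i) ∈ (algebraMap R K).range := by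
    have hi : algebraMap R K (b i) * coeff m (G i - X i) ∈ (algebraMap R K).range :=
      ⟨coeff m (q i), by rw [← coeff_C_mul, hq, coeff_map]⟩
    obtain ⟨j, hj⟩ : ∃ j, b 0 * b 1 = b j * b i := by
      fin_cases i
      exacts [⟨1, mul_comm _ _⟩, ⟨0, rfl⟩]
    rw [hcdef, hj, map_mul, mul_assoc]
    exact mul_mem ⟨b j, rfl⟩ hi
  set S : Fin 2 → MvPolynomial (Fin 2) K := fun i => C c * X i with hS
  set S' : Fin 2 → MvPolynomial (Fin 2) K := fun i => C c⁻¹ * X i with hS'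
  have hSbij : Function.Bijective (aeval S : MvPolynomial (Fin 2) K →ₐ[K] _) := by
    refine bijective_aeval_iff.mpr ⟨S', fun i => ?_, fun i => ?_⟩ <;>
    · simp only [hS, hS', map_mul, aeval_C, aeval_X, algebraMap_eq]
      linear_combination X i * hcC
  have hSbij' : Function.Bijective (aeval S' : MvPolynomial (Fin 2) K →ₐ[K] _) := by
    refine bijective_aeval_iff.mpr ⟨S, fun i => ?_, fun i => ?_⟩ <;>
    · simp only [hS, hS', map_mul, aeval_C, aeval_X, algebraMap_eq]
      linear_combination X i * hcC
  have hrange (i : Fin 2) :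
      ∃ H : MvPolynomial (Fin 2) R, map (algebraMap R K) H = C c⁻¹ * aeval S (G i) := by
    have hsplit : C c⁻¹ * aeval S (G i) = X i + C c⁻¹ * aeval S (G i - X i) := by
      rw [map_sub, aeval_X]
      linear_combination X i * hcC
    have hmem : C c⁻¹ * aeval S (G i - X i) ∈ (map (σ := Fin 2) (algebraMap R K)).range := by
      refine mem_range_map_iff_coeffs_subset.mpr ?_
      intro x hx
      obtain ⟨m, -, rfl⟩ := mem_coeffs_iff.mp hx
      change _ ∈ (algebraMap R K).range
      rw [coeff_C_mul, coeff_aeval_C_mul_X]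
      by_cases hm : m.degree < 2
      · rw [(mem_pow_idealOfVars_iff' _ _).mp (hG i) m hm]
        simp
      · obtain ⟨k, hk⟩ := Nat.exists_eq_add_of_le (not_lt.mp hm)
        have hpow : c⁻¹ * (c ^ m.degree * coeff m (G i - X i)) =
            c ^ k * (c * coeff m (G i - X i)) := by
          rw [hk]
          field_simp
          ring
        rw [hpow]
        exact mul_mem (pow_mem (RingHom.mem_range_self _ _) k) (hint i m)
    obtain ⟨H, hH⟩ := hmem
    exact ⟨X i + H, by rw [map_add, map_X, hH, hsplit]⟩
  choose H hH using hrange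
  have hHJ : planeJacobian H = 1 := by
    apply map_injective _ (IsFractionRing.injective R K)
    have hSJ := congrArg (aeval S) hJ
    rw [← planeJacobian_map, map_one]
    unfold planeJacobian at hSJ ⊢
    simp only [hH, pderiv_C_mul, hS, pderiv_aeval_C_mul_X]
    simp only [map_sub, map_mul, map_one, ← hS] at hSJ ⊢
    linear_combination (C c * C c⁻¹) ^ 2 * hSJ + (C c * C c⁻¹ + 1) * hcC
  have hbij := bijective_aeval_map (algebraMap R K) (h H hHJ)
  simp only [hH] at hbij
  have hcomp : (aeval fun i => C c⁻¹ * aeval S (G i) : MvPolynomial (Fin 2) K →ₐ[K] _) =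
      (aeval S).comp ((aeval G).comp (aeval S')) := by
    ext1 i
    simp [hS', algebraMap_eq]
  rw [hcomp, AlgHom.coe_comp, AlgHom.coe_comp] at hbij
  exact (Function.Bijective.of_comp_iff _ hSbij').mp
    ((Function.Bijective.of_comp_iff' hSbij _).mp hbij)

end FractionField

theorem bijective_aeval_pair_iff {R : Type*} [CommRing R] {P Q : MvPolynomial (Fin 2) R} :
    Function.Bijective (aeval ![P, Q] : MvPolynomial (Fin 2) R →ₐ[R] MvPolynomial (Fin 2) R) ↔
      ∃ U V : MvPolynomial (Fin 2) R,
        aeval ![P, Q] U = X 0 ∧ aeval ![P, Q] V = X 1 ∧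
        aeval ![U, V] P = X 0 ∧ aeval ![U, V] Q = X 1 := by
  rw [bijective_aeval_iff]
  constructor
  · rintro ⟨G, h₁, h₂⟩
    have hG : G = ![G 0, G 1] := by
      ext1 i
      fin_cases i <;> rfl
    exact ⟨G 0, G 1, h₁ 0, h₁ 1, hG ▸ h₂ 0, hG ▸ h₂ 1⟩
  · rintro ⟨U, V, hU, hV, hP, hQ⟩
    exact ⟨![U, V], Fin.forall_fin_two.mpr ⟨hU, hV⟩, Fin.forall_fin_two.mpr ⟨hP, hQ⟩⟩

theorem forall_planeJacobian_bijective_iff {R : Type*} [CommRing R] :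
    (∀ F : Fin 2 → MvPolynomial (Fin 2) R, planeJacobian F = 1 →
      Function.Bijective (aeval F : MvPolynomial (Fin 2) R →ₐ[R] MvPolynomial (Fin 2) R)) ↔
    ∀ P Q : MvPolynomial (Fin 2) R,
      pderiv 0 P * pderiv 1 Q - pderiv 1 P * pderiv 0 Q = 1 →
      ∃ U V : MvPolynomial (Fin 2) R,
        aeval ![P, Q] U = X 0 ∧ aeval ![P, Q] V = X 1 ∧
        aeval ![U, V] P = X 0 ∧ aeval ![U, V] Q = X 1 := by
  simp only [← bijective_aeval_pair_iff]
  refine ⟨fun h P Q hPQ => h ![P, Q] hPQ, fun h F hF => ?_⟩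
  have hF' : F = ![F 0, F 1] := by
    ext1 i
    fin_cases i <;> rfl
  rw [hF']
  exact h _ _ hF

end MvPolynomial

/-- The plane Jacobian conjecture over a number field `K` is equivalent to the plane
Jacobian conjecture over its ring of integers `𝓞 K`: every Jacobian pair over `K` is
invertible over `K` iff every Jacobian pair over `𝓞 K` is invertible over `𝓞 K`. -/
theorem plane_jacobian_over_K_iff_over_ring_of_integers
    (K : Type*) [Field K] [NumberField K] :
    (∀ P Q : MvPolynomial (Fin 2) K,
        pderiv 0 P * pderiv 1 Q - pderiv 1 P * pderiv 0 Q = 1 →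
        ∃ U V : MvPolynomial (Fin 2) K,
          aeval ![P, Q] U = X 0 ∧ aeval ![P, Q] V = X 1 ∧
          aeval ![U, V] P = X 0 ∧ aeval ![U, V] Q = X 1) ↔
    (∀ P Q : MvPolynomial (Fin 2) (𝓞 K),
        pderiv 0 P * pderiv 1 Q - pderiv 1 P * pderiv 0 Q = 1 →
        ∃ U V : MvPolynomial (Fin 2) (𝓞 K),
          aeval ![P, Q] U = X 0 ∧ aeval ![P, Q] V = X 1 ∧
          aeval ![U, V] P = X 0 ∧ aeval ![U, V] Q = X 1) := by
  rw [← forall_planeJacobian_bijective_iff, ← forall_planeJacobian_bijective_iff]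
  constructor
  · intro h F hF
    refine bijective_aeval_of_bijective_aeval_map K hF (h _ ?_)
    rw [planeJacobian_map, hF, map_one]
  · intro h F hF
    exact bijective_aeval_of_forall_bijective_aeval h hF
end

section
/- Let K be a number field with ring of integers O_K. The following two statements are equivalent: (ii) for every pair P, Q ∈ O_K[x,y] with ∂P/∂x·∂Q/∂y − ∂P/∂y·∂Q/∂x = 1, the curve P = 0 has more than one integral point, i.e., there exist two distinct pairs (a,b), (c,d) ∈ O_K × O_K with P(a,b) = P(c,d) = 0; (ii') for every pair P, Q ∈ O_K[x,y] with ∂P/∂x·∂Q/∂y − ∂P/∂y·∂Q/∂x = 1 and every k ∈ O_K, the set {(a,b) ∈ O_K × O_K : P(a,b) = k} is infinite. -/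
open MvPolynomial NumberField

section AffineSubstitution

variable {R : Type*} [CommRing R]

/-- The substitution `(x, y) ↦ (a + m x, b + m y)` on bivariate polynomials. -/
noncomputable def homothety (a b m : R) :
    MvPolynomial (Fin 2) R →ₐ[R] MvPolynomial (Fin 2) R :=
  aeval ![C a + C m * X 0, C b + C m * X 1]

theorem eval_homothety (a b m u v : R) (P : MvPolynomial (Fin 2) R) :
    eval ![u, v] (homothety a b m P) = eval ![a + m * u, b + m * v] P := by
  induction P using MvPolynomial.induction_on with
  | C r => simp [homothety]
  | add p q hp hq => simp [hp, hq]
  | mul_X p i hp =>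
    rw [map_mul, map_mul, hp, map_mul]
    fin_cases i <;> simp [homothety]

theorem pderiv_homothety (a b m : R) (i : Fin 2) (P : MvPolynomial (Fin 2) R) :
    pderiv i (homothety a b m P) = C m * homothety a b m (pderiv i P) := by
  induction P using MvPolynomial.induction_on with
  | C r => simp [homothety]
  | add p q hp hq => simp only [map_add, hp, hq, mul_add]
  | mul_X p j hp =>
    rw [map_mul, Derivation.leibniz, Derivation.leibniz, hp]
    fin_cases i <;> fin_cases j <;>
      simp [homothety, pderiv_X] <;> ring

theorem C_dvd_homothety_sub (a b m : R) (P : MvPolynomial (Fin 2) R) :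
    C m ∣ homothety a b m P - C (eval ![a, b] P) := by
  induction P using MvPolynomial.induction_on with
  | C r => simp [homothety]
  | add p q hp hq =>
    simp only [map_add]
    rw [add_sub_add_comm]
    exact dvd_add hp hq
  | mul_X p i hp =>
    obtain ⟨r, hr⟩ := hp
    rw [sub_eq_iff_eq_add] at hr
    rw [map_mul, map_mul, map_mul, hr]
    fin_cases i
    · exact ⟨r * (C a + C m * X 0) + C (eval ![a, b] p) * X 0, by simp [homothety]; ring⟩
    · exact ⟨r * (C b + C m * X 1) + C (eval ![a, b] p) * X 1, by simp [homothety]; ring⟩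

/-- Conjugating a Jacobian pair by a homothety centred at `(a, b)` gives a Jacobian pair. -/
theorem exists_jacobian_pair_homothety [IsDomain R] (a b : R) {m : R} (hm : m ≠ 0)
    {P Q : MvPolynomial (Fin 2) R}
    (h : pderiv 0 P * pderiv 1 Q - pderiv 1 P * pderiv 0 Q = 1) :
    ∃ P' Q' : MvPolynomial (Fin 2) R,
      pderiv 0 P' * pderiv 1 Q' - pderiv 1 P' * pderiv 0 Q' = 1 ∧
      ∀ u v : R, eval ![a + m * u, b + m * v] P = eval ![a, b] P + m * eval ![u, v] P' := by
  have hC : (C m : MvPolynomial (Fin 2) R) ≠ 0 := by simpa using hm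
  obtain ⟨P', hP⟩ := C_dvd_homothety_sub a b m P
  obtain ⟨Q', hQ⟩ := C_dvd_homothety_sub a b m Q
  have key : ∀ {S S' : MvPolynomial (Fin 2) R},
      homothety a b m S - C (eval ![a, b] S) = C m * S' →
      ∀ i, pderiv i S' = homothety a b m (pderiv i S) := by
    intro S S' hS i
    have := congrArg (pderiv i) hS
    rw [map_sub, pderiv_C, sub_zero, pderiv_homothety, pderiv_C_mul] at this
    exact (mul_left_cancel₀ hC this).symm
  refine ⟨P', Q', ?_, fun u v => ?_⟩
  · simp only [key hP, key hQ, ← map_mul, ← map_sub, h, map_one]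
  · have := congrArg (eval ![u, v]) hP
    simp only [map_sub, map_mul, eval_C, eval_homothety] at this
    rw [← this]; ring

end AffineSubstitution

/-- A finite set of points other than `(a, b)` avoids a lattice `(a, b) + m R²` with `m ≠ 0`. -/
theorem exists_homothety_avoiding {R : Type*} [CommRing R] [IsDomain R] (hR : ¬ IsField R)
    (a b : R) (S : Finset (R × R)) :
    ∃ m : R, m ≠ 0 ∧ ∀ u v : R, (a + m * u, b + m * v) ∈ S → (u, v) = (0, 0) := by
  classical
  obtain ⟨π, hπ0, hπ⟩ := Ring.exists_not_isUnit_of_not_isField hR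
  let d : R × R → R := fun p => if p.1 - a ≠ 0 then p.1 - a else p.2 - b
  have hd : ∀ p ∈ S.erase (a, b), d p ≠ 0 := by
    intro p hp h0
    refine (Finset.mem_erase.1 hp).1 ?_
    simp only [d] at h0
    split_ifs at h0 with h1
    · exact absurd h0 h1
    · exact Prod.ext (sub_eq_zero.1 (not_not.1 h1)) (sub_eq_zero.1 h0)
  set D := ∏ p ∈ S.erase (a, b), d p with hD
  have hD0 : D ≠ 0 := Finset.prod_ne_zero_iff.2 hd
  refine ⟨π * D, mul_ne_zero hπ0 hD0, fun u v huv => ?_⟩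
  by_contra hne
  have hmem : (a + π * D * u, b + π * D * v) ∈ S.erase (a, b) := by
    refine Finset.mem_erase.2 ⟨fun h => hne ?_, huv⟩
    simpa [hπ0, hD0] using h
  have h1 : π * D ∣ d (a + π * D * u, b + π * D * v) := by
    simp only [d]
    split_ifs <;> simp
  have h2 : π * D ∣ 1 * D := by
    rw [one_mul]
    exact h1.trans (Finset.dvd_prod_of_mem d hmem)
  exact hπ (isUnit_of_dvd_one ((mul_dvd_mul_iff_right hD0).1 h2))

/-- For Jacobian pairs `(P,Q)` over the ring of integers `𝓞 K` of a number field `K`,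
the condition "the curve `P = 0` has more than one integral point" for all such pairs is
equivalent to the condition "every fiber `P = k`, `k ∈ 𝓞 K`, has infinitely many
integral points" for all such pairs. -/
theorem two_integral_points_iff_all_fibers_infinite
    (K : Type*) [Field K] [NumberField K] :
    (∀ P Q : MvPolynomial (Fin 2) (𝓞 K),
        pderiv 0 P * pderiv 1 Q - pderiv 1 P * pderiv 0 Q = 1 →
        ∃ a b c d : 𝓞 K, (a, b) ≠ (c, d) ∧
          eval ![a, b] P = 0 ∧ eval ![c, d] P = 0) ↔
    (∀ P Q : MvPolynomial (Fin 2) (𝓞 K),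
        pderiv 0 P * pderiv 1 Q - pderiv 1 P * pderiv 0 Q = 1 →
        ∀ k : 𝓞 K, {p : 𝓞 K × 𝓞 K | eval ![p.1, p.2] P = k}.Infinite) := by
  refine ⟨fun H P Q hPQ k hfin => ?_, fun H P Q hPQ => ?_⟩
  · obtain ⟨a, b, -, -, -, hab, -⟩ := H (P - C k) Q (by simpa using hPQ)
    have hab' : eval ![a, b] P = k := by simpa [sub_eq_zero] using hab
    obtain ⟨m, hm, hS⟩ :=
      exists_homothety_avoiding (RingOfIntegers.not_isField K) a b hfin.toFinset
    obtain ⟨P', Q', hJ, hev⟩ := exists_jacobian_pair_homothety a b hm hPQ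
    have hzero : ∀ u v : 𝓞 K, eval ![u, v] P' = 0 → (u, v) = (0, 0) := by
      intro u v huv
      refine hS u v (hfin.mem_toFinset.2 ?_)
      simp only [Set.mem_ofPred_eq, hev, huv, mul_zero, add_zero, hab']
    obtain ⟨u, v, u', v', hne, h1, h2⟩ := H P' Q' hJ
    exact hne ((hzero u v h1).trans (hzero u' v' h2).symm)
  · obtain ⟨p, hp, q, hq, hne⟩ := (H P Q hPQ 0).nontrivial
    exact ⟨p.1, p.2, q.1, q.2, hne, hp, hq⟩
end

section
/- Let K be a number field with ring of integers O_K, and let F = (P,Q) with P, Q ∈ O_K[x,y] satisfy ∂P/∂x·∂Q/∂y − ∂P/∂y·∂Q/∂x = 1. If F is invertible over K, then its inverse also has coefficients in O_K; that is, there exist U, V ∈ O_K[x,y] with U(P(x,y),Q(x,y)) = x, V(P(x,y),Q(x,y)) = y, P(U(x,y),V(x,y)) = x and Q(U(x,y),V(x,y)) = y. -/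
open MvPolynomial NumberField

namespace MvPolynomial

variable {σ R S : Type*} [CommRing R] [CommRing S]

lemma algHom_sub_self_mem_idealOfVars {φ : MvPolynomial σ R →ₐ[R] MvPolynomial σ R}
    (hφ : ∀ i, φ (X i) - X i ∈ idealOfVars σ R) (f : MvPolynomial σ R) :
    φ f - f ∈ idealOfVars σ R := by
  induction f using MvPolynomial.induction_on with
  | C a => simp [← algebraMap_eq]
  | add p q hp hq =>
    rw [map_add, add_sub_add_comm]
    exact add_mem hp hq
  | mul_X p i hp =>
    have h : φ (p * X i) - p * X i = φ p * (φ (X i) - X i) + X i * (φ p - p) := by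
      rw [map_mul]; ring
    rw [h]
    exact add_mem (Ideal.mul_mem_left _ _ (hφ i)) (Ideal.mul_mem_left _ _ hp)

/-- An endomorphism tangent to the identity at the origin fixes each polynomial up to terms of
higher order. -/
lemma algHom_sub_self_mem_pow_idealOfVars {φ : MvPolynomial σ R →ₐ[R] MvPolynomial σ R}
    (hφ : ∀ i, φ (X i) - X i ∈ idealOfVars σ R ^ 2) (d : ℕ) {f : MvPolynomial σ R}
    (hf : f ∈ idealOfVars σ R ^ d) : φ f - f ∈ idealOfVars σ R ^ (d + 1) := by
  have hφ' := algHom_sub_self_mem_idealOfVars fun i ↦ Ideal.pow_le_self two_ne_zero (hφ i)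
  have hX : ∀ a ∈ idealOfVars σ R, φ a ∈ idealOfVars σ R := fun a ha ↦ by
    simpa using add_mem (hφ' a) ha
  have hsq : ∀ a ∈ idealOfVars σ R, φ a - a ∈ idealOfVars σ R ^ 2 := by
    intro a ha
    induction ha using Submodule.span_induction with
    | mem x hx =>
      obtain ⟨i, rfl⟩ := hx
      exact hφ i
    | zero => simp
    | add x y _ _ hx hy =>
      rw [map_add, add_sub_add_comm]
      exact add_mem hx hy
    | smul a x hx' hx =>
      have h : φ (a • x) - a • x = φ a * (φ x - x) + (φ a - a) * x := by
        rw [smul_eq_mul, map_mul]; ring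
      rw [h]
      refine add_mem (Ideal.mul_mem_left _ _ hx) ?_
      rw [sq]
      exact Ideal.mul_mem_mul (hφ' a) hx'
  induction d generalizing f with
  | zero => simpa using hφ' f
  | succ d ih =>
    rw [pow_succ'] at hf
    induction hf using Submodule.mul_induction_on' with
    | mem_mul_mem a ha b hb =>
      have h : φ (a * b) - a * b = φ a * (φ b - b) + (φ a - a) * b := by
        rw [map_mul]; ring
      rw [h]
      refine add_mem ?_ ?_
      · rw [pow_succ']
        exact Ideal.mul_mem_mul (hX a ha) (ih hb)
      · rw [show d + 1 + 1 = 2 + d by ring, pow_add]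
        exact Ideal.mul_mem_mul (hsq a ha) hb
    | add x _ y _ hx hy =>
      rw [map_add, add_sub_add_comm]
      exact add_mem hx hy

/-- If an endomorphism tangent to the identity preserves the polynomials with coefficients in a
subring, then it also reflects them. -/
lemma mem_range_map_of_algHom_mem {g : R →+* S} {φ : MvPolynomial σ S →ₐ[S] MvPolynomial σ S}
    (hφ : ∀ i, φ (X i) - X i ∈ idealOfVars σ S ^ 2)
    (hg : ∀ f ∈ (map (σ := σ) g).range, φ f ∈ (map (σ := σ) g).range)
    {f : MvPolynomial σ S} (hf : φ f ∈ (map (σ := σ) g).range) :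
    f ∈ (map (σ := σ) g).range := by
  have key : ∀ d : ℕ, ∃ s ∈ (map (σ := σ) g).range, f - s ∈ idealOfVars σ S ^ d := by
    intro d
    induction d with
    | zero => exact ⟨0, zero_mem _, by simp⟩
    | succ d ih =>
      obtain ⟨s, hs, hfs⟩ := ih
      refine ⟨s + (φ f - φ s), add_mem hs (sub_mem hf (hg s hs)), ?_⟩
      have h := algHom_sub_self_mem_pow_idealOfVars hφ d hfs
      rw [← neg_mem_iff, map_sub] at h
      convert h using 1
      ring
  have hcoeff : f ∈ Set.range (map g) := by
    rw [mem_range_map_iff_coeffs_subset]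
    intro c hc
    obtain ⟨n, -, rfl⟩ := mem_coeffs_iff.mp hc
    obtain ⟨s, ⟨t, rfl⟩, hs⟩ := key (n.degree + 1)
    have h := (mem_pow_idealOfVars_iff' _ _).mp hs n (Nat.lt_succ_self _)
    rw [coeff_sub, sub_eq_zero] at h
    exact ⟨coeff n t, by rw [h]; exact (coeff_map g t n).symm⟩
  exact hcoeff

lemma sub_C_constantCoeff_mem_idealOfVars (p : MvPolynomial σ R) :
    p - C (constantCoeff p) ∈ idealOfVars σ R := by
  induction p using MvPolynomial.induction_on with
  | C a => simp
  | add p q hp hq =>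
    rw [map_add, map_add, add_sub_add_comm]
    exact add_mem hp hq
  | mul_X p i hp =>
    simpa using Ideal.mul_mem_left _ p (Ideal.subset_span (Set.mem_range_self i))

/-- The first-order Taylor expansion at the origin. -/
lemma sub_taylor_mem_idealOfVars_sq [Fintype σ] (p : MvPolynomial σ R) :
    p - (C (constantCoeff p) + ∑ i, C (constantCoeff (pderiv i p)) * X i) ∈
      idealOfVars σ R ^ 2 := by
  classical
  induction p using MvPolynomial.induction_on with
  | C a => simp
  | add p q hp hq =>
    convert add_mem hp hq using 1
    simp only [map_add, add_mul, Finset.sum_add_distrib]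
    ring
  | mul_X p j hp =>
    have h := Ideal.mul_mem_mul (sub_C_constantCoeff_mem_idealOfVars p)
      (Ideal.subset_span (Set.mem_range_self j) : X j ∈ idealOfVars σ R)
    rw [← sq] at h
    convert h using 1
    simp [Derivation.leibniz, Pi.single_apply, sub_mul, apply_ite, ite_mul]

lemma map_aeval_pair (g : R →+* S) (A B f : MvPolynomial (Fin 2) R) :
    map g (aeval ![A, B] f) = aeval ![map g A, map g B] (map g f) := by
  induction f using MvPolynomial.induction_on with
  | C a => simp [algebraMap_eq]
  | add p q hp hq => simp only [map_add, hp, hq]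
  | mul_X p i hp =>
    simp only [map_mul, hp, map_X, aeval_X]
    fin_cases i <;> rfl

/-- A left inverse over an extension ring of a plane polynomial map with Jacobian determinant `1`
has coefficients in the base ring. -/
lemma mem_range_map_of_aeval_mem {g : R →+* S} {P Q : MvPolynomial (Fin 2) R}
    (hJac : pderiv 0 P * pderiv 1 Q - pderiv 1 P * pderiv 0 Q = 1)
    {U : MvPolynomial (Fin 2) S}
    (hU : aeval ![map g P, map g Q] U ∈ (map (σ := Fin 2) g).range) :
    U ∈ (map (σ := Fin 2) g).range := by
  have hrange : ∀ A B : MvPolynomial (Fin 2) R, ∀ f ∈ (map (σ := Fin 2) g).range,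
      aeval ![map g A, map g B] f ∈ (map (σ := Fin 2) g).range := by
    rintro A B _ ⟨t, rfl⟩
    exact ⟨aeval ![A, B] t, map_aeval_pair g A B t⟩
  set a := constantCoeff P
  set b := constantCoeff Q
  set p₀ := constantCoeff (pderiv 0 P)
  set p₁ := constantCoeff (pderiv 1 P)
  set q₀ := constantCoeff (pderiv 0 Q)
  set q₁ := constantCoeff (pderiv 1 Q)
  have hdet : p₀ * q₁ - p₁ * q₀ = 1 := by
    simpa using congrArg constantCoeff hJac
  have hdetC : C (σ := Fin 2) (g p₀) * C (g q₁) - C (g p₁) * C (g q₀) = 1 := by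
    simpa using congrArg (fun r ↦ C (σ := Fin 2) (g r)) hdet
  let L : MvPolynomial (Fin 2) S →ₐ[S] MvPolynomial (Fin 2) S :=
    aeval ![map g (C a + C p₀ * X 0 + C p₁ * X 1), map g (C b + C q₀ * X 0 + C q₁ * X 1)]
  let L' : MvPolynomial (Fin 2) S →ₐ[S] MvPolynomial (Fin 2) S :=
    aeval ![map g (C q₁ * (X 0 - C a) - C p₁ * (X 1 - C b)),
      map g (C p₀ * (X 1 - C b) - C q₀ * (X 0 - C a))]
  let φ : MvPolynomial (Fin 2) S →ₐ[S] MvPolynomial (Fin 2) S :=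
    aeval ![map g (C q₁ * (P - C a) - C p₁ * (Q - C b)),
      map g (C p₀ * (Q - C b) - C q₀ * (P - C a))]
  have hC : ∀ (ψ : MvPolynomial (Fin 2) S →ₐ[S] MvPolynomial (Fin 2) S) (c : S),
      ψ (C c) = C c := fun ψ c ↦ ψ.commutes c
  have hL' : L'.comp L = AlgHom.id S _ := by
    ext1 i
    fin_cases i
    · simp [L, L', hC]
      linear_combination (X 0 - C (g a)) * hdetC
    · simp [L, L', hC]
      linear_combination (X 1 - C (g b)) * hdetC
  have hφL : φ.comp L = aeval ![map g P, map g Q] := by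
    ext1 i
    fin_cases i
    · simp [L, φ, hC]
      linear_combination (map g P - C (g a)) * hdetC
    · simp [L, φ, hC]
      linear_combination (map g Q - C (g b)) * hdetC
  have hP := sub_taylor_mem_idealOfVars_sq (map g P)
  have hQ := sub_taylor_mem_idealOfVars_sq (map g Q)
  simp only [Fin.sum_univ_two, pderiv_map, constantCoeff_map] at hP hQ
  have hφ : ∀ i, φ (X i) - X i ∈ idealOfVars (Fin 2) S ^ 2 := by
    intro i
    fin_cases i
    · convert sub_mem (Ideal.mul_mem_left _ (C (g q₁)) hP)
        (Ideal.mul_mem_left _ (C (g p₁)) hQ) using 1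
      simp [φ]
      linear_combination X 0 * hdetC
    · convert sub_mem (Ideal.mul_mem_left _ (C (g p₀)) hQ)
        (Ideal.mul_mem_left _ (C (g q₀)) hP) using 1
      simp [φ]
      linear_combination X 1 * hdetC
  have hLU : L U ∈ (map (σ := Fin 2) g).range := by
    refine mem_range_map_of_algHom_mem hφ (hrange _ _) ?_
    rwa [← hφL] at hU
  have h : L' (L U) = U := DFunLike.congr_fun hL' U
  rw [← h]
  exact hrange _ _ _ hLU

end MvPolynomial

/-- If a Jacobian pair `F = (P,Q)` over `𝓞 K` is invertible over `K`, then its inverse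
has coefficients in `𝓞 K`. -/
theorem inverse_has_integral_coefficients
    (K : Type*) [Field K] [NumberField K]
    (P Q : MvPolynomial (Fin 2) (𝓞 K))
    (hJac : pderiv 0 P * pderiv 1 Q - pderiv 1 P * pderiv 0 Q = 1)
    (hinv : ∃ U V : MvPolynomial (Fin 2) K,
      aeval ![MvPolynomial.map (algebraMap (𝓞 K) K) P,
              MvPolynomial.map (algebraMap (𝓞 K) K) Q] U = X 0 ∧
      aeval ![MvPolynomial.map (algebraMap (𝓞 K) K) P,
              MvPolynomial.map (algebraMap (𝓞 K) K) Q] V = X 1 ∧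
      aeval ![U, V] (MvPolynomial.map (algebraMap (𝓞 K) K) P) = X 0 ∧
      aeval ![U, V] (MvPolynomial.map (algebraMap (𝓞 K) K) Q) = X 1) :
    ∃ U V : MvPolynomial (Fin 2) (𝓞 K),
      aeval ![P, Q] U = X 0 ∧ aeval ![P, Q] V = X 1 ∧
      aeval ![U, V] P = X 0 ∧ aeval ![U, V] Q = X 1 := by
  obtain ⟨U, V, hU, hV, hP, hQ⟩ := hinv
  obtain ⟨U, rfl⟩ := mem_range_map_of_aeval_mem (g := algebraMap (𝓞 K) K) hJac
    ⟨X 0, (map_X _ _).trans hU.symm⟩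
  obtain ⟨V, rfl⟩ := mem_range_map_of_aeval_mem (g := algebraMap (𝓞 K) K) hJac
    ⟨X 1, (map_X _ _).trans hV.symm⟩
  have hinj := map_injective (σ := Fin 2) (algebraMap (𝓞 K) K)
    (FaithfulSMul.algebraMap_injective (𝓞 K) K)
  refine ⟨U, V, hinj ?_, hinj ?_, hinj ?_, hinj ?_⟩ <;> rw [map_aeval_pair, map_X]
  exacts [hU, hV, hP, hQ]
end

section
/- Let K be a number field that is either ℚ or an imaginary quadratic field (i.e., [K:ℚ] = 1, or [K:ℚ] = 2 and there is no ring homomorphism from K to ℝ), let d = [K:ℚ], and let O_K be its ring of integers. Let F = (P,Q) with P, Q ∈ O_K[x,y] satisfy ∂P/∂x·∂Q/∂y − ∂P/∂y·∂Q/∂x = 1, and suppose F is not invertible over K. Then there exist a real constant c > 0 and a real R₀ such that for all real R ≥ R₀, the number of pairs (u,v) ∈ O_K × O_K lying in the image F(O_K²) (i.e., such that there exists (a,b) ∈ O_K × O_K with P(a,b) = u and Q(a,b) = v) and satisfying house(u) ≤ R and house(v) ≤ R is at most c·R^d. -/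
open MvPolynomial NumberField

/-- Over `ℚ` or an imaginary quadratic field all complex absolute values agree. -/
theorem house_eq_norm_embedding {K : Type*} [Field K] [NumberField K]
    (hK : Module.finrank ℚ K = 1 ∨ (Module.finrank ℚ K = 2 ∧ IsEmpty (K →+* ℝ)))
    (σ : K →+* ℂ) (z : K) : house z = ‖σ z‖ := by
  have key : ∀ φ : K →+* ℂ, ‖φ z‖ = ‖σ z‖ := by
    intro φ
    rcases hK with h1 | ⟨h2, he⟩
    · have hc : Fintype.card (K →+* ℂ) = 1 := by rw [Embeddings.card, h1]
      obtain ⟨τ, hτ⟩ := Fintype.card_eq_one_iff.1 hc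
      rw [hτ φ, hτ σ]
    · have hc : Fintype.card (K →+* ℂ) = 2 := by rw [Embeddings.card, h2]
      have hne : ComplexEmbedding.conjugate σ ≠ σ := fun h =>
        he.false (ComplexEmbedding.IsReal.embedding h)
      by_cases h : φ = σ
      · rw [h]
      by_cases h' : φ = ComplexEmbedding.conjugate σ
      · rw [h', ComplexEmbedding.conjugate_coe_eq, RCLike.norm_conj]
      · exfalso
        classical
        have : ({φ, σ, ComplexEmbedding.conjugate σ} : Finset (K →+* ℂ)).card ≤ 2 :=
          hc ▸ Finset.card_le_univ _
        rw [Finset.card_eq_three.2 ⟨φ, σ, _, h, h', hne.symm, rfl⟩] at this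
        omega
  rw [house_eq_sup']
  refine le_antisymm ?_ ?_
  · refine NNReal.coe_le_coe.2 (Finset.sup'_le _ _ fun φ _ => ?_) |>.trans_eq (coe_nnnorm _)
    exact NNReal.coe_le_coe.1 (key φ).le
  · exact_mod_cast Finset.le_sup' (fun φ : K →+* ℂ => ‖φ z‖₊) (Finset.mem_univ σ)

theorem one_le_norm_embedding {K : Type*} [Field K] [NumberField K]
    (hK : Module.finrank ℚ K = 1 ∨ (Module.finrank ℚ K = 2 ∧ IsEmpty (K →+* ℝ)))
    (σ : K →+* ℂ) {z : 𝓞 K} (hz : z ≠ 0) : 1 ≤ ‖σ z‖ := by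
  rw [← house_eq_norm_embedding hK]
  exact one_le_house_of_isIntegral z.isIntegral_coe (by simpa using hz)

theorem floor_mem_of_abs_le {R x : ℝ} (h : |x| ≤ R) :
    ⌊2 * x⌋ ∈ Finset.Icc (-⌈2 * R⌉) ⌈2 * R⌉ := by
  have := abs_le.1 h
  rw [Finset.mem_Icc]
  constructor
  · rw [Int.le_floor]
    push_cast
    linarith [Int.le_ceil (2 * R)]
  · have h1 := Int.floor_le (2 * x)
    have h2 := Int.le_ceil (2 * R)
    exact_mod_cast (by linarith : ((⌊2 * x⌋ : ℤ) : ℝ) ≤ (⌈2 * R⌉ : ℤ))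

theorem card_Icc_ceil_le {R : ℝ} (hR : 1 ≤ R) :
    ((Finset.Icc (-⌈2 * R⌉) ⌈2 * R⌉).card : ℝ) ≤ 7 * R := by
  have h0 : 0 ≤ ⌈2 * R⌉ := Int.ceil_nonneg (by linarith)
  rw [Int.card_Icc]
  have : ((⌈2 * R⌉ + 1 - -⌈2 * R⌉).toNat : ℝ) = ((⌈2 * R⌉ + 1 - -⌈2 * R⌉ : ℤ) : ℝ) := by
    exact_mod_cast Int.toNat_of_nonneg (by omega)
  rw [this]
  push_cast
  linarith [Int.ceil_lt_add_one (2 * R)]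

theorem abs_sub_le_of_floor_eq {x y : ℝ} (h : ⌊2 * x⌋ = ⌊2 * y⌋) : |x - y| ≤ 1 / 2 := by
  have := Int.abs_sub_lt_one_of_floor_eq_floor h
  rw [abs_lt] at this
  rw [abs_le]
  constructor <;> linarith [this.1, this.2]

theorem card_ringOfIntegers_ball_le {K : Type*} [Field K] [NumberField K]
    (hK : Module.finrank ℚ K = 1 ∨ (Module.finrank ℚ K = 2 ∧ IsEmpty (K →+* ℝ)))
    (σ : K →+* ℂ) {R : ℝ} (hR : 1 ≤ R) :
    ∃ s : Finset (𝓞 K), (∀ u, u ∈ s ↔ ‖σ u‖ ≤ R) ∧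
      (s.card : ℝ) ≤ 49 * R ^ Module.finrank ℚ K := by
  have key : ∃ (I : Finset (ℤ × ℤ)) (f : 𝓞 K → ℤ × ℤ), Function.Injective f ∧
      (∀ u : 𝓞 K, ‖σ u‖ ≤ R → f u ∈ I) ∧ (I.card : ℝ) ≤ 49 * R ^ Module.finrank ℚ K := by
    have inj : ∀ u v : 𝓞 K, |(σ u).re - (σ v).re| ≤ 1 / 2 → |(σ u).im - (σ v).im| ≤ 1 / 2 →
        u = v := by
      intro u v h1 h2
      by_contra hne
      have h3 := one_le_norm_embedding hK σ (sub_ne_zero.2 hne)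
      have h4 := Complex.sq_norm (σ ((u - v : 𝓞 K) : K))
      rw [Complex.normSq_apply] at h4
      simp only [map_sub, Complex.sub_re, Complex.sub_im] at h3 h4
      have h5 := sq_abs ((σ u).re - (σ v).re)
      have h6 := sq_abs ((σ u).im - (σ v).im)
      nlinarith [abs_nonneg ((σ u).re - (σ v).re), abs_nonneg ((σ u).im - (σ v).im)]
    rcases id hK with h1 | ⟨h2, -⟩
    · have him : ∀ z : K, (σ z).im = 0 := by
        intro z
        have hc : Fintype.card (K →+* ℂ) = 1 := by rw [Embeddings.card, h1]
        obtain ⟨τ, hτ⟩ := Fintype.card_eq_one_iff.1 hc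
        have : ComplexEmbedding.conjugate σ = σ := by rw [hτ σ, hτ (ComplexEmbedding.conjugate τ)]
        exact Complex.conj_eq_iff_im.1 (RingHom.congr_fun this z)
      refine ⟨Finset.Icc (-⌈2 * R⌉) ⌈2 * R⌉ ×ˢ {0}, fun u => (⌊2 * (σ u).re⌋, 0), ?_, ?_, ?_⟩
      · intro u v huv
        refine inj u v (abs_sub_le_of_floor_eq (Prod.ext_iff.1 huv).1) ?_
        simp [him]
      · intro u hu
        exact Finset.mem_product.2
          ⟨floor_mem_of_abs_le ((Complex.abs_re_le_norm _).trans hu), by simp⟩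
      · rw [Finset.card_product, Finset.card_singleton, mul_one, h1, pow_one]
        linarith [card_Icc_ceil_le hR]
    · refine ⟨Finset.Icc (-⌈2 * R⌉) ⌈2 * R⌉ ×ˢ Finset.Icc (-⌈2 * R⌉) ⌈2 * R⌉,
        fun u => (⌊2 * (σ u).re⌋, ⌊2 * (σ u).im⌋), ?_, ?_, ?_⟩
      · intro u v huv
        exact inj u v (abs_sub_le_of_floor_eq (Prod.ext_iff.1 huv).1)
          (abs_sub_le_of_floor_eq (Prod.ext_iff.1 huv).2)
      · intro u hu
        exact Finset.mem_product.2
          ⟨floor_mem_of_abs_le ((Complex.abs_re_le_norm _).trans hu),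
            floor_mem_of_abs_le ((Complex.abs_im_le_norm _).trans hu)⟩
      · rw [Finset.card_product, h2]
        push_cast
        nlinarith [card_Icc_ceil_le hR]
  obtain ⟨I, f, hf, hI, hc⟩ := key
  have hfin : {u : 𝓞 K | ‖σ u‖ ≤ R}.Finite :=
    (I.finite_toSet.preimage hf.injOn).subset fun u hu => hI u hu
  refine ⟨hfin.toFinset, fun u => by simp, le_trans ?_ hc⟩
  exact_mod_cast Finset.card_le_card_of_injOn f (fun u hu => hI u (by simpa using hu)) hf.injOn

theorem card_ringOfIntegers_unit_ball_le {K : Type*} [Field K] [NumberField K]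
    (hK : Module.finrank ℚ K = 1 ∨ (Module.finrank ℚ K = 2 ∧ IsEmpty (K →+* ℝ)))
    (σ : K →+* ℂ) :
    ∃ N : ℕ, ∀ z : ℂ, ∃ s : Finset (𝓞 K), (∀ u : 𝓞 K, ‖σ u - z‖ ≤ 1 → u ∈ s) ∧ s.card ≤ N := by
  classical
  obtain ⟨t, ht, -⟩ := card_ringOfIntegers_ball_le hK σ (R := 2) (by norm_num)
  refine ⟨t.card, fun z => ?_⟩
  by_cases h : ∃ u₀ : 𝓞 K, ‖σ u₀ - z‖ ≤ 1
  · obtain ⟨u₀, h₀⟩ := h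
    refine ⟨t.image (· + u₀), fun u hu => ?_, Finset.card_image_le⟩
    refine Finset.mem_image.2 ⟨u - u₀, (ht _).2 ?_, by ring⟩
    have : σ ((u - u₀ : 𝓞 K) : K) = (σ u - z) - (σ u₀ - z) := by simp
    rw [this]
    linarith [norm_sub_le (σ u - z) (σ u₀ - z)]
  · exact ⟨∅, fun u hu => (h ⟨u, hu⟩).elim, by simp⟩

/-- Integral points of bounded size lying within horizontal distance one of a plane curve. -/
theorem card_points_near_curve_le {K : Type*} [Field K] [NumberField K]
    (hK : Module.finrank ℚ K = 1 ∨ (Module.finrank ℚ K = 2 ∧ IsEmpty (K →+* ℝ)))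
    (σ : K →+* ℂ) {h : MvPolynomial (Fin 2) K} (hh : h ≠ 0) :
    ∃ c : ℝ, 0 < c ∧ ∀ R : ℝ, 1 ≤ R → ∃ s : Finset (𝓞 K × 𝓞 K),
      (∀ p : 𝓞 K × 𝓞 K, ‖σ p.1‖ ≤ R → ‖σ p.2‖ ≤ R →
        (∃ z : ℂ, ‖z‖ ≤ 1 ∧ eval₂ σ ![σ p.1 + z, σ p.2] h = 0) → p ∈ s) ∧
      (s.card : ℝ) ≤ c * R ^ Module.finrank ℚ K := by
  classical
  obtain ⟨N, hN⟩ := card_ringOfIntegers_unit_ball_le hK σ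
  choose ball hball hballc using hN
  let g : ℂ → Polynomial ℂ := fun v =>
    aeval ![Polynomial.X, Polynomial.C v] (MvPolynomial.map σ h)
  have hg : ∀ u v : ℂ, (g v).eval u = eval₂ σ ![u, v] h := by
    intro u v
    rw [← eval_map]
    simp only [g]
    rw [← Polynomial.coe_evalRingHom, aeval_def, hom_eval₂, eval]
    congr 1
    · ext; simp
    · ext i; fin_cases i <;> simp
  have hdeg : ∀ v, (g v).natDegree ≤ h.totalDegree := by
    intro v
    refine (aeval_natDegree_le (m := h.totalDegree) (n := 1) _ (Finset.sup_mono (support_map_subset _ _)) _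
      fun i => ?_).trans_eq (mul_one _)
    fin_cases i
    · simp
    · simp
  obtain ⟨E, hE⟩ : ∃ E : Finset (𝓞 K), ∀ v : 𝓞 K, g (σ v) = 0 → v ∈ E := by
    have hm : MvPolynomial.map σ h ≠ 0 := by
      rwa [Ne, map_eq_zero_iff _ (map_injective σ σ.injective)]
    obtain ⟨w, hw⟩ : ∃ w, eval w (MvPolynomial.map σ h) ≠ 0 := by
      by_contra! H
      exact hm (MvPolynomial.funext (by simpa using H))
    let k : Polynomial ℂ := aeval ![Polynomial.C (w 0), Polynomial.X] (MvPolynomial.map σ h)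
    have hk : ∀ v : ℂ, k.eval v = eval₂ σ ![w 0, v] h := by
      intro v
      rw [← eval_map]
      simp only [k]
      rw [← Polynomial.coe_evalRingHom, aeval_def, hom_eval₂, eval]
      congr 1
      · ext; simp
      · ext i; fin_cases i <;> simp
    have hk0 : k ≠ 0 := by
      intro h0
      apply hw
      have := hk (w 1)
      rw [h0, Polynomial.eval_zero, ← eval_map] at this
      rw [this]
      congr 2
      ext i; fin_cases i <;> rfl
    have hinj : Function.Injective fun v : 𝓞 K => σ v :=
      σ.injective.comp RingOfIntegers.coe_injective
    refine ⟨(k.roots.toFinset.finite_toSet.preimage hinj.injOn).toFinset, fun v hv => ?_⟩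
    simp [hk0, hk, ← hg, hv]
  refine ⟨49 * E.card + 49 * (h.totalDegree * N) + 1, by positivity, fun R hR => ?_⟩
  obtain ⟨B, hB, hBc⟩ := card_ringOfIntegers_ball_le hK σ hR
  refine ⟨B ×ˢ E ∪ B.biUnion fun v => ((g (σ v)).roots.toFinset.biUnion ball) ×ˢ {v}, ?_, ?_⟩
  · rintro ⟨u, v⟩ hu hv ⟨z, hz, hz0⟩
    rw [Finset.mem_union]
    by_cases h0 : g (σ v) = 0
    · exact Or.inl (Finset.mem_product.2 ⟨(hB u).2 hu, hE v h0⟩)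
    · refine Or.inr (Finset.mem_biUnion.2 ⟨v, (hB v).2 hv, Finset.mem_product.2
        ⟨Finset.mem_biUnion.2 ⟨σ u + z, ?_, hball _ _ ?_⟩, by simp⟩⟩)
      · simp only [Multiset.mem_toFinset, Polynomial.mem_roots', Polynomial.IsRoot.def]
        exact ⟨h0, (hg _ _).trans hz0⟩
      · simpa using hz
  · have h1 : ∀ v ∈ B, (((g (σ v)).roots.toFinset.biUnion ball) ×ˢ {v}).card ≤
        h.totalDegree * N := by
      intro v _
      rw [Finset.card_product, Finset.card_singleton, mul_one]
      refine (Finset.card_biUnion_le_card_mul _ _ N fun z _ => hballc z).trans ?_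
      exact Nat.mul_le_mul_right _ ((Multiset.toFinset_card_le _).trans
        ((Polynomial.card_roots' _).trans (hdeg _)))
    have h2 := (Finset.card_union_le (B ×ˢ E) _).trans
      (Nat.add_le_add_left (Finset.card_biUnion_le_card_mul B _ _ h1) _)
    rw [Finset.card_product] at h2
    have h3 : ((_ : ℕ) : ℝ) ≤ _ := Nat.cast_le.2 h2
    push_cast at h3
    have hR0 : 0 ≤ R ^ Module.finrank ℚ K := by positivity
    refine h3.trans ?_
    have a1 := mul_le_mul_of_nonneg_right hBc (Nat.cast_nonneg (α := ℝ) E.card)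
    have a2 := mul_le_mul_of_nonneg_right hBc
      (by positivity : (0 : ℝ) ≤ h.totalDegree * N)
    nlinarith

/-- The power series `f` converges absolutely on the closed disc of radius `ρ`. -/
def PowerSeries.AbsConverges (ρ : ℝ) (f : PowerSeries ℂ) : Prop :=
  Summable fun n => ‖PowerSeries.coeff n f‖ * ρ ^ n

namespace PowerSeries.AbsConverges

theorem mono {r ρ : ℝ} {f : PowerSeries ℂ} (hr : 0 ≤ r) (h : r ≤ ρ) (hf : f.AbsConverges ρ) :
    f.AbsConverges r :=
  Summable.of_nonneg_of_le (fun n => by positivity) (fun n => by gcongr) hf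

theorem mul {ρ : ℝ} (hρ : 0 ≤ ρ) {f g : PowerSeries ℂ} (hf : f.AbsConverges ρ)
    (hg : g.AbsConverges ρ) : (f * g).AbsConverges ρ := by
  have h0 : Summable fun x : ℕ × ℕ =>
      (‖coeff x.1 f‖ * ρ ^ x.1) * (‖coeff x.2 g‖ * ρ ^ x.2) :=
    Summable.mul_of_nonneg (f := fun n => ‖coeff n f‖ * ρ ^ n)
      (g := fun n => ‖coeff n g‖ * ρ ^ n) hf hg
      (fun n => mul_nonneg (norm_nonneg _) (pow_nonneg hρ n))
      (fun n => mul_nonneg (norm_nonneg _) (pow_nonneg hρ n))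
  have h := summable_sum_mul_antidiagonal_of_summable_mul
    (f := fun n => ‖coeff n f‖ * ρ ^ n) (g := fun n => ‖coeff n g‖ * ρ ^ n) h0
  refine Summable.of_nonneg_of_le
    (fun n => mul_nonneg (norm_nonneg _) (pow_nonneg hρ n)) (fun n => ?_) h
  rw [coeff_mul]
  refine (mul_le_mul_of_nonneg_right (norm_sum_le _ _) (pow_nonneg hρ n)).trans_eq ?_
  rw [Finset.sum_mul]
  refine Finset.sum_congr rfl fun p hp => ?_
  rw [← Finset.HasAntidiagonal.mem_antidiagonal.1 hp, norm_mul, pow_add]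
  ring

theorem coe (ρ : ℝ) (p : Polynomial ℂ) : (p : PowerSeries ℂ).AbsConverges ρ := by
  refine summable_of_ne_finset_zero (s := Finset.range (p.natDegree + 1)) fun n hn => ?_
  rw [Polynomial.coeff_coe, Polynomial.coeff_eq_zero_of_natDegree_lt (by simpa using hn)]
  simp

theorem exists_inverse_X_sub_C {a : ℂ} (ha : 1 < ‖a‖) :
    ∃ ρ : ℝ, 1 < ρ ∧ ∃ G : PowerSeries ℂ, G.AbsConverges ρ ∧
      G * ((Polynomial.X - Polynomial.C a : Polynomial ℂ) : PowerSeries ℂ) = 1 := by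
  obtain ⟨ρ, h1, h2⟩ := exists_between ha
  have ha0 : a ≠ 0 := by rintro rfl; simp at ha; linarith
  refine ⟨ρ, h1, PowerSeries.mk fun n => -(a⁻¹) ^ (n + 1), ?_, ?_⟩
  · have : Summable fun n : ℕ => ‖a‖⁻¹ * (ρ / ‖a‖) ^ n :=
      (summable_geometric_of_lt_one (by positivity) ((div_lt_one (by linarith)).2 h2)).mul_left _
    refine this.congr fun n => ?_
    rw [PowerSeries.coeff_mk, norm_neg, norm_pow, norm_inv, div_pow, pow_succ, inv_pow]
    field_simp
  · ext n
    rw [Polynomial.coe_sub, Polynomial.coe_X, Polynomial.coe_C, mul_sub, map_sub,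
      PowerSeries.coeff_mul_C]
    cases n with
    | zero => simp [ha0]
    | succ n =>
      rw [PowerSeries.coeff_succ_mul_X, coeff_mk, coeff_mk, coeff_one, if_neg (by omega),
        pow_succ _ (n + 1)]
      field_simp
      ring

theorem exists_inverse {H : Polynomial ℂ} (hH : ∀ z : ℂ, ‖z‖ ≤ 1 → H.eval z ≠ 0) :
    ∃ ρ : ℝ, 1 < ρ ∧ ∃ G : PowerSeries ℂ, G.AbsConverges ρ ∧ G * (H : PowerSeries ℂ) = 1 := by
  have hH0 : H ≠ 0 := by rintro rfl; exact hH 0 (by simp) (by simp)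
  have key : ∀ s : Multiset ℂ, (∀ a ∈ s, 1 < ‖a‖) → ∃ ρ : ℝ, 1 < ρ ∧ ∃ G : PowerSeries ℂ,
      G.AbsConverges ρ ∧
      G * ((s.map fun a => Polynomial.X - Polynomial.C a).prod : Polynomial ℂ) = 1 := by
    intro s
    induction s using Multiset.induction_on with
    | empty => exact fun _ => ⟨2, by norm_num, 1, by simpa using coe 2 1, by simp⟩
    | cons a s ih =>
      intro hs
      obtain ⟨ρ, hρ, G, hG, hG1⟩ := ih fun b hb => hs b (Multiset.mem_cons_of_mem hb)
      obtain ⟨ρ', hρ', G', hG', hG1'⟩ := exists_inverse_X_sub_C (hs a (Multiset.mem_cons_self a s))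
      refine ⟨min ρ ρ', lt_min hρ hρ', G' * G, mul ?_ (hG'.mono ?_ (min_le_right _ _))
        (hG.mono ?_ (min_le_left _ _)), ?_⟩
      · exact (lt_min (by linarith) (by linarith)).le
      · exact (lt_min (by linarith) (by linarith)).le
      · exact (lt_min (by linarith) (by linarith)).le
      · rw [Multiset.map_cons, Multiset.prod_cons, Polynomial.coe_mul, mul_mul_mul_comm, hG1, hG1',
          one_mul]
  obtain ⟨ρ, hρ, G, hG, hG1⟩ := key H.roots fun a ha => by
    by_contra! h
    exact hH a h ((Polynomial.mem_roots hH0).1 ha)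
  have hl : H.leadingCoeff ≠ 0 := Polynomial.leadingCoeff_ne_zero.2 hH0
  refine ⟨ρ, hρ, G * ((Polynomial.C H.leadingCoeff⁻¹ : Polynomial ℂ) : PowerSeries ℂ),
    hG.mul (by linarith) (coe _ _), ?_⟩
  have hs := (IsAlgClosed.splits H).eq_prod_roots
  generalize H.leadingCoeff = l at hs hl ⊢
  generalize (H.roots.map fun a => Polynomial.X - Polynomial.C a).prod = q at hs hG1
  rw [hs, mul_assoc, ← Polynomial.coe_mul, ← mul_assoc, ← Polynomial.C_mul, inv_mul_cancel₀ hl,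
    Polynomial.C_1, one_mul, hG1]

end PowerSeries.AbsConverges

/-- Formal solutions of a linear differential system without singularities in the closed
unit disc have coefficients tending to zero. -/
theorem PowerSeries.tendsto_coeff_of_linear_system {ι : Type*} [Fintype ι]
    {E : ι → PowerSeries ℂ} {H : Polynomial ℂ} {C : ι → ι → Polynomial ℂ}
    (hH : ∀ z : ℂ, ‖z‖ ≤ 1 → H.eval z ≠ 0)
    (hE : ∀ i, (H : PowerSeries ℂ) * PowerSeries.derivative ℂ (E i) =
      ∑ j, (C i j : PowerSeries ℂ) * E j) (i : ι) :
    Filter.Tendsto (fun n => PowerSeries.coeff n (E i)) Filter.atTop (nhds 0) := by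
  obtain ⟨ρ, hρ, G, hG, hG1⟩ := AbsConverges.exists_inverse hH
  have hρ0 : 0 < ρ := by linarith
  let A : ι → ι → PowerSeries ℂ := fun i j => G * (C i j : PowerSeries ℂ)
  have hA : ∀ i j, (A i j).AbsConverges ρ := fun i j => hG.mul hρ0.le (AbsConverges.coe _ _)
  have hEA : ∀ i, PowerSeries.derivative ℂ (E i) = ∑ j, A i j * E j := by
    intro i
    rw [← one_mul (PowerSeries.derivative ℂ (E i)), ← hG1, mul_assoc, hE, Finset.mul_sum]
    simp only [A, mul_assoc]
  let α : ℕ → ℝ := fun k => ∑ i, ∑ j, ‖coeff k (A i j)‖ * ρ ^ k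
  have hα : Summable α := summable_sum fun i _ => summable_sum fun j _ => hA i j
  let f : ℕ → ℝ := fun n => ∑ i, ‖coeff n (E i)‖ * ρ ^ n
  have hα0 : ∀ k, 0 ≤ α k := fun k => by positivity
  have hf0 : ∀ k, 0 ≤ f k := fun k => by positivity
  have hrec : ∀ n, (n + 1) * f (n + 1) ≤
      ρ * ∑ p ∈ Finset.HasAntidiagonal.antidiagonal n, α p.1 * f p.2 := by
    intro n
    have h1 : ∀ i, (n + 1) * (‖coeff (n + 1) (E i)‖ * ρ ^ (n + 1)) ≤
        ρ * ∑ p ∈ Finset.HasAntidiagonal.antidiagonal n, ∑ j, (‖coeff p.1 (A i j)‖ * ρ ^ p.1) * f p.2 := by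
      intro i
      have h2 := congrArg (coeff n) (hEA i)
      rw [coeff_derivative, map_sum] at h2
      have h3 : (n + 1) * ‖coeff (n + 1) (E i)‖ ≤
          ∑ j, ∑ p ∈ Finset.HasAntidiagonal.antidiagonal n, ‖coeff p.1 (A i j)‖ * ‖coeff p.2 (E j)‖ := by
        have h4 : ‖(n + 1 : ℂ)‖ = n + 1 := by
          exact_mod_cast Complex.norm_natCast (n + 1)
        rw [← h4, mul_comm, ← norm_mul, h2]
        refine (norm_sum_le _ _).trans (Finset.sum_le_sum fun j _ => ?_)
        rw [coeff_mul]
        refine (norm_sum_le _ _).trans_eq (Finset.sum_congr rfl fun p _ => norm_mul _ _)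
      rw [Finset.sum_comm] at h3
      calc (n + 1) * (‖coeff (n + 1) (E i)‖ * ρ ^ (n + 1))
          = ρ * (((n + 1) * ‖coeff (n + 1) (E i)‖) * ρ ^ n) := by ring
        _ ≤ ρ * ((∑ p ∈ Finset.HasAntidiagonal.antidiagonal n, ∑ j,
              ‖coeff p.1 (A i j)‖ * ‖coeff p.2 (E j)‖) * ρ ^ n) := by gcongr
        _ ≤ _ := by
          rw [Finset.sum_mul]
          refine mul_le_mul_of_nonneg_left (Finset.sum_le_sum fun p hp => ?_) hρ0.le
          rw [Finset.sum_mul]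
          refine Finset.sum_le_sum fun j _ => ?_
          rw [← Finset.HasAntidiagonal.mem_antidiagonal.1 hp, pow_add]
          have h5 : ‖coeff p.2 (E j)‖ * ρ ^ p.2 ≤ f p.2 :=
            Finset.single_le_sum (f := fun j => ‖coeff p.2 (E j)‖ * ρ ^ p.2)
              (fun j _ => by positivity) (Finset.mem_univ j)
          calc _ = (‖coeff p.1 (A i j)‖ * ρ ^ p.1) * (‖coeff p.2 (E j)‖ * ρ ^ p.2) := by ring
            _ ≤ _ := by gcongr
    simp only [f]
    rw [Finset.mul_sum]
    refine (Finset.sum_le_sum fun i _ => h1 i).trans_eq ?_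
    rw [← Finset.mul_sum, Finset.sum_comm]
    simp only [α, f, Finset.sum_mul]
  have hbd : ∃ M, ∀ n, f n ≤ M := by
    obtain ⟨N, hN⟩ := exists_nat_ge (ρ * ∑' k, α k)
    refine ⟨∑ j ∈ Finset.range (N + 1), f j, fun n => ?_⟩
    have hM0 : 0 ≤ ∑ j ∈ Finset.range (N + 1), f j := Finset.sum_nonneg fun j _ => hf0 j
    induction n using Nat.strong_induction_on with
    | _ n ih =>
      by_cases hn : n ∈ Finset.range (N + 1)
      · exact Finset.single_le_sum (fun j _ => hf0 j) hn
      · obtain ⟨m, rfl⟩ : ∃ m, n = m + 1 := ⟨n - 1, by simp at hn; omega⟩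
        have hm : (N : ℝ) ≤ m := by
          simp only [Finset.mem_range, not_lt] at hn
          exact_mod_cast (by omega : N ≤ m)
        have h1 : ∑ p ∈ Finset.HasAntidiagonal.antidiagonal m, α p.1 * f p.2 ≤
            (∑' k, α k) * ∑ j ∈ Finset.range (N + 1), f j := by
          have h2 : ∑ p ∈ Finset.HasAntidiagonal.antidiagonal m, α p.1 ≤ ∑' k, α k := by
            rw [Finset.Nat.sum_antidiagonal_eq_sum_range_succ_mk]
            exact hα.sum_le_tsum _ fun k _ => hα0 k
          refine le_trans ?_ (mul_le_mul_of_nonneg_right h2 hM0)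
          rw [Finset.sum_mul]
          refine Finset.sum_le_sum fun p hp => mul_le_mul_of_nonneg_left (ih _ ?_) (hα0 _)
          have := Finset.HasAntidiagonal.mem_antidiagonal.1 hp
          omega
        have h3 := hrec m
        have h4 : ρ * ∑ p ∈ Finset.HasAntidiagonal.antidiagonal m, α p.1 * f p.2 ≤
            m * ∑ j ∈ Finset.range (N + 1), f j := by
          refine (mul_le_mul_of_nonneg_left h1 hρ0.le).trans ?_
          rw [← mul_assoc]
          exact mul_le_mul_of_nonneg_right (hN.trans hm) hM0
        have h5 : (0 : ℝ) < m + 1 := by positivity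
        refine le_of_mul_le_mul_left ?_ h5
        linarith
  obtain ⟨M, hM⟩ := hbd
  have hlim : Filter.Tendsto (fun n : ℕ => M * (ρ⁻¹) ^ n) Filter.atTop (nhds 0) := by
    simpa using (tendsto_pow_atTop_nhds_zero_of_lt_one (by positivity)
      (inv_lt_one_of_one_lt₀ hρ)).const_mul M
  refine squeeze_zero_norm (fun n => ?_) hlim
  rw [inv_pow, ← div_eq_mul_inv, le_div_iff₀ (by positivity)]
  exact (Finset.single_le_sum (f := fun i => ‖coeff n (E i)‖ * ρ ^ n)
    (fun i _ => by positivity) (Finset.mem_univ i)).trans (hM n)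

section TaylorSeries

variable {K A : Type*} [Field K] [CommRing A] [Algebra K A]

/-- The series `exp(sD)(f)` in the variable `s`. -/
noncomputable def Derivation.taylorSeries (D : Derivation K A A) (f : A) : PowerSeries A :=
  PowerSeries.mk fun n => ((n.factorial : K)⁻¹) • (D^[n] f)

theorem Derivation.taylorSeries_add (D : Derivation K A A) (f g : A) :
    D.taylorSeries (f + g) = D.taylorSeries f + D.taylorSeries g := by
  ext n
  simp [taylorSeries, iterate_map_add]

theorem Derivation.constantCoeff_taylorSeries (D : Derivation K A A) (f : A) :
    PowerSeries.constantCoeff (D.taylorSeries f) = f := by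
  simp [taylorSeries, ← PowerSeries.coeff_zero_eq_constantCoeff_apply]

variable [CharZero K]

theorem Derivation.derivative_taylorSeries (D : Derivation K A A) (f : A) :
    PowerSeries.derivative A (D.taylorSeries f) = D.taylorSeries (D f) := by
  ext n
  have h : ((n : K) + 1) ≠ 0 := by exact_mod_cast n.succ_ne_zero
  rw [PowerSeries.coeff_derivative, taylorSeries, taylorSeries, PowerSeries.coeff_mk,
    PowerSeries.coeff_mk, Function.iterate_succ_apply, Nat.factorial_succ]
  have h2 : ((n : A) + 1) = algebraMap K A (n + 1) := by simp
  rw [h2, mul_comm, ← Algebra.smul_def, smul_smul]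
  congr 1
  push_cast
  field_simp

variable [IsDomain A] [CharZero A]

theorem Derivation.taylorSeries_of_map_eq_zero (D : Derivation K A A) {f : A} (hf : D f = 0) :
    D.taylorSeries f = PowerSeries.C f := by
  apply PowerSeries.derivative.ext
  · rw [derivative_taylorSeries, hf, PowerSeries.derivative_C]
    ext n
    simp [taylorSeries]
  · simp [constantCoeff_taylorSeries]

theorem Derivation.taylorSeries_of_map_eq_one (D : Derivation K A A) {f : A} (hf : D f = 1) :
    D.taylorSeries f = PowerSeries.C f + PowerSeries.X := by
  apply PowerSeries.derivative.ext
  · rw [derivative_taylorSeries, hf, taylorSeries_of_map_eq_zero _ D.map_one_eq_zero]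
    simp
  · simp [constantCoeff_taylorSeries]

theorem Derivation.taylorSeries_mul (D : Derivation K A A) (f g : A) :
    D.taylorSeries (f * g) = D.taylorSeries f * D.taylorSeries g := by
  ext n
  induction n generalizing f g with
  | zero =>
    simp only [PowerSeries.coeff_zero_eq_constantCoeff, map_mul, constantCoeff_taylorSeries]
  | succ n ih =>
    have h : ((n : A) + 1) ≠ 0 := by exact_mod_cast n.succ_ne_zero
    apply mul_right_cancel₀ h
    rw [← PowerSeries.coeff_derivative, ← PowerSeries.coeff_derivative, derivative_taylorSeries,
      D.leibniz, Derivation.leibniz, smul_eq_mul, smul_eq_mul, taylorSeries_add, map_add, ih, ih,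
      derivative_taylorSeries, derivative_taylorSeries, smul_eq_mul, smul_eq_mul, map_add]

/-- `Derivation.taylorSeries` as a ring homomorphism. -/
noncomputable def Derivation.taylorHom (D : Derivation K A A) : A →+* PowerSeries A where
  toFun := D.taylorSeries
  map_one' := by rw [D.taylorSeries_of_map_eq_zero D.map_one_eq_zero, map_one]
  map_mul' := D.taylorSeries_mul
  map_zero' := by rw [D.taylorSeries_of_map_eq_zero (map_zero D), map_zero]
  map_add' := D.taylorSeries_add

end TaylorSeries

section JacobianPair

variable {K : Type*} [Field K]

/-- The derivation `f ↦ ∂(f, Q) / ∂(x, y)`. -/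
noncomputable def hamDer (Q : MvPolynomial (Fin 2) K) :
    Derivation K (MvPolynomial (Fin 2) K) (MvPolynomial (Fin 2) K) :=
  pderiv 1 Q • pderiv 0 - pderiv 0 Q • pderiv 1

theorem hamDer_apply (Q f : MvPolynomial (Fin 2) K) :
    hamDer Q f = pderiv 1 Q * pderiv 0 f - pderiv 0 Q * pderiv 1 f := rfl

theorem hamDer_self (Q : MvPolynomial (Fin 2) K) : hamDer Q Q = 0 := by
  rw [hamDer_apply]; ring

theorem MvPolynomial.pderiv_comm {σ R : Type*} [CommRing R] (i j : σ) (f : MvPolynomial σ R) :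
    pderiv i (pderiv j f) = pderiv j (pderiv i f) := by
  let D : σ → Derivation R (MvPolynomial σ R) (MvPolynomial σ R) := pderiv
  have : ⁅D i, D j⁆ = 0 := by
    classical
    refine derivation_ext fun k => ?_
    simp only [D, Derivation.commutator_apply, pderiv_X]
    simp only [Pi.single_apply]
    split_ifs <;> simp
  have h := Derivation.congr_fun this f
  rwa [Derivation.commutator_apply, Derivation.zero_apply, sub_eq_zero] at h

theorem MvPolynomial.eq_C_of_pderiv_eq_zero {σ R : Type*} [CommRing R] [IsDomain R] [CharZero R]
    {f : MvPolynomial σ R} (hf : ∀ i, pderiv i f = 0) : f = C (coeff 0 f) := by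
  classical
  ext m
  rw [coeff_C]
  split_ifs with hm
  · rw [hm]
  · obtain ⟨i, hi⟩ : ∃ i, m i ≠ 0 := by
      by_contra! h
      exact hm (Finsupp.ext h).symm
    have h := congrArg (coeff (m - Finsupp.single i 1)) (hf i)
    have hle : Finsupp.single i 1 ≤ m := by
      rw [Finsupp.single_le_iff]; omega
    rw [coeff_pderiv, tsub_add_cancel_of_le hle, coeff_zero] at h
    rcases mul_eq_zero.1 h with h | h
    · exact h
    · exact absurd h (Nat.cast_add_one_ne_zero _)

theorem MvPolynomial.totalDegree_pderiv_lt {σ R : Type*} [CommRing R]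
    {f : MvPolynomial σ R} (hf : f.totalDegree ≠ 0) (i : σ) :
    (pderiv i f).totalDegree < f.totalDegree := by
  classical
  rw [totalDegree, Finset.sup_lt_iff (by simpa using Nat.pos_of_ne_zero hf)]
  intro m hm
  rw [mem_support_iff, coeff_pderiv] at hm
  have h := le_totalDegree (mem_support_iff.2 (left_ne_zero_of_mul hm))
  rw [Finsupp.sum_add_index' (by simp) (by simp), Finsupp.sum_single_index rfl] at h
  omega

theorem Derivation.map_mvPolynomial_aeval {σ R A : Type*} [Fintype σ] [CommRing R] [CommRing A]
    [Algebra R A] (D : Derivation R A A) (g : σ → A) (f : MvPolynomial σ R) :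
    D (aeval g f) = ∑ i, aeval g (pderiv i f) * D (g i) := by
  classical
  induction f using MvPolynomial.induction_on with
  | C a => simp
  | add p q hp hq => simp [hp, hq, add_mul, Finset.sum_add_distrib]
  | mul_X p n hp =>
    simp only [map_mul, aeval_X, Derivation.leibniz, smul_eq_mul, hp, map_add, add_mul,
      Finset.sum_add_distrib, Finset.mul_sum, pderiv_X]
    congr 1
    · rw [Finset.sum_eq_single n]
      · simp
      · intro i _ hi
        simp [hi.symm]
      · simp
    · exact Finset.sum_congr rfl fun i _ => by ring

variable {P Q : MvPolynomial (Fin 2) K}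

theorem hamDer_right (hJ : pderiv 0 P * pderiv 1 Q - pderiv 1 P * pderiv 0 Q = 1) :
    hamDer Q P = 1 := by
  rw [hamDer_apply, ← hJ]; ring

theorem jacobian_swap {R : Type*} [CommRing R] {P Q : MvPolynomial (Fin 2) R}
    (hJ : pderiv 0 P * pderiv 1 Q - pderiv 1 P * pderiv 0 Q = 1) :
    pderiv 0 Q * pderiv 1 (-P) - pderiv 1 Q * pderiv 0 (-P) = 1 := by
  rw [map_neg, map_neg, ← hJ]; ring

theorem hamDer_neg_self (P : MvPolynomial (Fin 2) K) : hamDer (-P) P = 0 := by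
  rw [hamDer_apply, map_neg, map_neg]; ring

theorem hamDer_comm (hJ : pderiv 0 P * pderiv 1 Q - pderiv 1 P * pderiv 0 Q = 1)
    (f : MvPolynomial (Fin 2) K) :
    hamDer Q (hamDer (-P) f) = hamDer (-P) (hamDer Q f) := by
  have : ⁅hamDer Q, hamDer (-P)⁆ = 0 := by
    refine derivation_ext fun k => ?_
    have h0 := congrArg (pderiv 0) hJ
    have h1 := congrArg (pderiv 1) hJ
    have hP := pderiv_comm 0 1 P
    have hQ := pderiv_comm 0 1 Q
    simp only [map_sub, Derivation.leibniz, smul_eq_mul, pderiv_one] at h0 h1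
    rw [Derivation.commutator_apply]
    fin_cases k
    · simp [hamDer_apply, pderiv_X]
      linear_combination -h1 - pderiv 1 Q * hP + pderiv 1 P * hQ
    · simp [hamDer_apply, pderiv_X]
      linear_combination h0 + pderiv 0 Q * hP - pderiv 0 P * hQ
  have h := Derivation.congr_fun this f
  rwa [Derivation.commutator_apply, Derivation.zero_apply, sub_eq_zero] at h

variable [CharZero K]

theorem eq_C_of_hamDer_eq_zero
    (hJ : pderiv 0 P * pderiv 1 Q - pderiv 1 P * pderiv 0 Q = 1)
    {f : MvPolynomial (Fin 2) K} (h1 : hamDer Q f = 0) (h2 : hamDer (-P) f = 0) :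
    f = C (coeff 0 f) := by
  rw [hamDer_apply] at h1 h2
  rw [map_neg, map_neg] at h2
  refine eq_C_of_pderiv_eq_zero fun i => ?_
  fin_cases i
  · change pderiv 0 f = 0
    linear_combination pderiv 0 P * h1 + pderiv 0 Q * h2 - pderiv 0 f * hJ
  · change pderiv 1 f = 0
    linear_combination pderiv 1 P * h1 + pderiv 1 Q * h2 - pderiv 1 f * hJ

theorem aeval_jacobian_pair_injective
    (hJ : pderiv 0 P * pderiv 1 Q - pderiv 1 P * pderiv 0 Q = 1) :
    Function.Injective (aeval (R := K) ![P, Q]) := by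
  rw [injective_iff_map_eq_zero]
  intro w
  induction hn : w.totalDegree using Nat.strong_induction_on generalizing w with
  | _ n ih =>
    intro hw
    have hconst : w = C (coeff 0 w) := by
      by_cases h0 : w.totalDegree = 0
      · exact totalDegree_eq_zero_iff_eq_C.1 h0
      · refine eq_C_of_pderiv_eq_zero fun i => ih _ (hn ▸ totalDegree_pderiv_lt h0 i) _ rfl ?_
        have h1 := congrArg (hamDer Q) hw
        have h2 := congrArg (hamDer (-P)) hw
        rw [Derivation.map_mvPolynomial_aeval, Fin.sum_univ_two] at h1 h2
        simp only [Matrix.cons_val_zero, Matrix.cons_val_one, hamDer_right hJ, hamDer_self,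
          hamDer_right (jacobian_swap hJ), hamDer_neg_self, map_zero, mul_zero, mul_one, add_zero,
          zero_add] at h1 h2
        fin_cases i
        exacts [h1, h2]
    rw [hconst, aeval_C, algebraMap_eq] at hw
    rw [hconst, C_injective (Fin 2) K (hw.trans C_0.symm), C_0]

theorem isAlgebraic_jacobian_pair
    (hJ : pderiv 0 P * pderiv 1 Q - pderiv 1 P * pderiv 0 Q = 1) :
    Algebra.IsAlgebraic (Algebra.adjoin K (Set.range ![P, Q])) (MvPolynomial (Fin 2) K) := by
  have h : AlgebraicIndependent K ![P, Q] := aeval_jacobian_pair_injective hJ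
  refine (h.isTranscendenceBasis_of_lift_trdeg_le_of_finite ?_).isAlgebraic
  rw [MvPolynomial.trdeg_of_isDomain]
  simp

theorem Derivation.exists_iterate_eq_zero
    {D : Derivation K (MvPolynomial (Fin 2) K) (MvPolynomial (Fin 2) K)}
    (hD : ∀ i, ∃ N, ∀ n, N ≤ n → D^[n] (X i) = 0) (f : MvPolynomial (Fin 2) K) :
    ∃ n, D^[n] f = 0 := by
  have key : D.taylorHom f ∈ (Polynomial.coeToPowerSeries.ringHom
      (R := MvPolynomial (Fin 2) K)).range := by
    induction f using MvPolynomial.induction_on with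
    | C a =>
      refine ⟨Polynomial.C (C a), ?_⟩
      have : D (C a) = 0 := D.map_algebraMap a
      rw [Polynomial.coeToPowerSeries.ringHom_apply, Polynomial.coe_C]
      exact (D.taylorSeries_of_map_eq_zero this).symm
    | add p q hp hq => rw [map_add]; exact add_mem hp hq
    | mul_X p i hp =>
      rw [map_mul]
      refine mul_mem hp ?_
      obtain ⟨N, hN⟩ := hD i
      refine ⟨PowerSeries.trunc N (D.taylorHom (X i)), ?_⟩
      rw [Polynomial.coeToPowerSeries.ringHom_apply]
      ext1 n
      rw [Polynomial.coeff_coe, PowerSeries.coeff_trunc]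
      split_ifs with h
      · rfl
      · change 0 = PowerSeries.coeff n (D.taylorSeries (X i))
        rw [taylorSeries, PowerSeries.coeff_mk, hN n (not_lt.1 h), smul_zero]
  obtain ⟨p, hp⟩ := key
  refine ⟨p.natDegree + 1, ?_⟩
  have h := congrArg (PowerSeries.coeff (p.natDegree + 1)) hp
  rw [Polynomial.coeToPowerSeries.ringHom_apply, Polynomial.coeff_coe,
    Polynomial.coeff_eq_zero_of_natDegree_lt (by omega)] at h
  change 0 = PowerSeries.coeff _ (D.taylorSeries f) at h
  rw [taylorSeries, PowerSeries.coeff_mk, eq_comm, smul_eq_zero] at h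
  refine h.resolve_left (inv_ne_zero ?_)
  exact_mod_cast Nat.factorial_ne_zero _

theorem mem_range_aeval_of_hamDer_eq_zero
    (hJ : pderiv 0 P * pderiv 1 Q - pderiv 1 P * pderiv 0 Q = 1) (m : ℕ)
    {f : MvPolynomial (Fin 2) K} (hm : (hamDer Q)^[m] f = 0) (hf : hamDer (-P) f = 0) :
    ∃ w : Polynomial K, Polynomial.aeval P w = f := by
  induction m generalizing f with
  | zero => exact ⟨0, by simpa using hm.symm⟩
  | succ m ih =>
    obtain ⟨w, hw⟩ := ih (f := hamDer Q f) (by simpa using hm) (by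
      rw [← hamDer_comm hJ, hf, map_zero])
    obtain ⟨W, rfl⟩ : ∃ W, Polynomial.derivative W = w := by
      clear hw
      induction w using Polynomial.induction_on' with
      | add p q hp hq =>
        obtain ⟨p', rfl⟩ := hp
        obtain ⟨q', rfl⟩ := hq
        exact ⟨p' + q', by simp⟩
      | monomial n a =>
        refine ⟨Polynomial.monomial (n + 1) (a / (n + 1)), ?_⟩
        have : (n : K) + 1 ≠ 0 := Nat.cast_add_one_ne_zero n
        rw [Polynomial.derivative_monomial]
        congr 1
        push_cast
        field_simp
    have h1 : hamDer Q (f - Polynomial.aeval P W) = 0 := by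
      rw [map_sub, Derivation.map_aeval, hamDer_right hJ, hw, smul_eq_mul, mul_one, sub_self]
    have h2 : hamDer (-P) (f - Polynomial.aeval P W) = 0 := by
      rw [map_sub, Derivation.map_aeval, hf, hamDer_neg_self, smul_zero, sub_zero]
    refine ⟨W + Polynomial.C (coeff 0 (f - Polynomial.aeval P W)), ?_⟩
    rw [map_add, Polynomial.aeval_C, algebraMap_eq, ← eq_C_of_hamDer_eq_zero hJ h1 h2]
    ring

theorem MvPolynomial.exists_pderiv_eq {σ : Type*} (i : σ) (w : MvPolynomial σ K) :
    ∃ W, pderiv i W = w := by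
  classical
  induction w using MvPolynomial.induction_on' with
  | monomial u a =>
    refine ⟨monomial (u + Finsupp.single i 1) (a / (u i + 1)), ?_⟩
    have : (u i : K) + 1 ≠ 0 := Nat.cast_add_one_ne_zero _
    rw [pderiv_monomial, add_tsub_cancel_right]
    congr 1
    simp
    field_simp
  | add p q hp hq =>
    obtain ⟨p', rfl⟩ := hp
    obtain ⟨q', rfl⟩ := hq
    exact ⟨p' + q', by simp⟩

theorem mem_range_aeval_of_iterate_hamDer_eq_zero
    (hJ : pderiv 0 P * pderiv 1 Q - pderiv 1 P * pderiv 0 Q = 1)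
    (hnil : ∀ f, ∃ n, (hamDer Q)^[n] f = 0) (m : ℕ)
    {f : MvPolynomial (Fin 2) K} (hm : (hamDer (-P))^[m] f = 0) :
    ∃ w : MvPolynomial (Fin 2) K, aeval ![P, Q] w = f := by
  induction m generalizing f with
  | zero => exact ⟨0, by simpa using hm.symm⟩
  | succ m ih =>
    obtain ⟨w, hw⟩ := ih (f := hamDer (-P) f) (by simpa using hm)
    obtain ⟨W, rfl⟩ := exists_pderiv_eq 1 w
    have h : hamDer (-P) (f - aeval ![P, Q] W) = 0 := by
      rw [map_sub, Derivation.map_mvPolynomial_aeval, Fin.sum_univ_two]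
      simp only [Matrix.cons_val_zero, Matrix.cons_val_one, hamDer_neg_self,
        hamDer_right (jacobian_swap hJ), mul_zero, zero_add, mul_one, hw, sub_self]
    obtain ⟨n, hn⟩ := hnil (f - aeval ![P, Q] W)
    obtain ⟨v, hv⟩ := mem_range_aeval_of_hamDer_eq_zero hJ n hn h
    refine ⟨W + Polynomial.aeval (X 0) v, ?_⟩
    rw [map_add, ← Polynomial.aeval_algHom_apply, aeval_X, Matrix.cons_val_zero, hv]
    ring

theorem exists_inverse_of_hamDer_nilpotent
    (hJ : pderiv 0 P * pderiv 1 Q - pderiv 1 P * pderiv 0 Q = 1)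
    (h1 : ∀ i, ∃ N, ∀ n, N ≤ n → (hamDer Q)^[n] (X i) = 0)
    (h2 : ∀ i, ∃ N, ∀ n, N ≤ n → (hamDer (-P))^[n] (X i) = 0) :
    ∃ U V : MvPolynomial (Fin 2) K, aeval ![P, Q] U = X 0 ∧ aeval ![P, Q] V = X 1 ∧
      aeval ![U, V] P = X 0 ∧ aeval ![U, V] Q = X 1 := by
  have key : ∀ i : Fin 2, ∃ w : MvPolynomial (Fin 2) K, aeval ![P, Q] w = X i := fun i =>
    mem_range_aeval_of_iterate_hamDer_eq_zero hJ (Derivation.exists_iterate_eq_zero h1) _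
      (Derivation.exists_iterate_eq_zero h2 (X i)).choose_spec
  obtain ⟨U, hU⟩ := key 0
  obtain ⟨V, hV⟩ := key 1
  have hcomp : (aeval ![P, Q]).comp (aeval ![U, V]) = AlgHom.id K (MvPolynomial (Fin 2) K) := by
    refine algHom_ext fun i => ?_
    fin_cases i
    · simpa using hU
    · simpa using hV
  refine ⟨U, V, hU, hV, aeval_jacobian_pair_injective hJ ?_, aeval_jacobian_pair_injective hJ ?_⟩
  · simpa using AlgHom.congr_fun hcomp P
  · simpa using AlgHom.congr_fun hcomp Q

/-- The coordinate ring is spanned, up to powers of a polynomial in `P` and `Q`, by a finite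
set on which the derivation `hamDer Q` acts through polynomials in `P` and `Q`. -/
theorem exists_linear_system_of_jacobian_pair
    (hJ : pderiv 0 P * pderiv 1 Q - pderiv 1 P * pderiv 0 Q = 1) :
    ∃ h : MvPolynomial (Fin 2) K, h ≠ 0 ∧
      (∀ i, ∃ p : Polynomial (MvPolynomial (Fin 2) K), p.Monic ∧
        p.eval₂ (aeval (R := K) ![P, Q] : _ →ₐ[K] MvPolynomial (Fin 2) K)
          (aeval ![P, Q] h * X i) = 0) ∧
      ∃ S : Finset (MvPolynomial (Fin 2) K), (∀ i, X i ∈ S) ∧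
        ∃ c : S → S → MvPolynomial (Fin 2) K, ∀ e : S,
          aeval ![P, Q] h * hamDer Q e = ∑ e', aeval ![P, Q] (c e e') * (e' : MvPolynomial _ K) := by
  classical
  let B := Algebra.adjoin K (Set.range ![P, Q])
  have halg : Algebra.IsAlgebraic B (MvPolynomial (Fin 2) K) := isAlgebraic_jacobian_pair hJ
  have hB : ∀ b : B, ∃ w, aeval ![P, Q] w = (b : MvPolynomial (Fin 2) K) := fun b =>
    (Algebra.adjoin_range_eq_range_aeval K ![P, Q]).le b.2
  choose lift hlift using hB
  obtain ⟨y, hy0, hy⟩ := Algebra.IsAlgebraic.exists_integral_multiples B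
    (Finset.univ.image (X : Fin 2 → MvPolynomial (Fin 2) K))
  replace hy : ∀ i, IsIntegral B (y • (X i : MvPolynomial (Fin 2) K)) := fun i =>
    hy _ (Finset.mem_image_of_mem _ (Finset.mem_univ i))
  let M := Algebra.adjoin B (Set.range fun i => y • (X i : MvPolynomial (Fin 2) K))
  obtain ⟨s, hs⟩ : (Subalgebra.toSubmodule M).FG :=
    fg_adjoin_of_finite (Set.finite_range _) (by rintro _ ⟨i, rfl⟩; exact hy i)
  have hclear : ∀ f : MvPolynomial (Fin 2) K, ∃ m : ℕ, ∀ n, m ≤ n → y ^ n • f ∈ M := by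
    intro f
    induction f using MvPolynomial.induction_on with
    | C a =>
      refine ⟨0, fun n _ => M.smul_mem ?_ _⟩
      exact M.algebraMap_mem (algebraMap K B a)
    | add p q hp hq =>
      obtain ⟨m, hm⟩ := hp
      obtain ⟨m', hm'⟩ := hq
      refine ⟨max m m', fun n hn => ?_⟩
      rw [smul_add]
      exact add_mem (hm n (le_of_max_le_left hn)) (hm' n (le_of_max_le_right hn))
    | mul_X p i hp =>
      obtain ⟨m, hm⟩ := hp
      refine ⟨m + 1, fun n hn => ?_⟩
      obtain ⟨k, rfl⟩ : ∃ k, n = k + 1 := ⟨n - 1, by omega⟩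
      rw [pow_succ, ← smul_mul_smul_comm]
      exact mul_mem (hm k (by omega)) (Algebra.subset_adjoin ⟨i, rfl⟩)
  choose m hm using hclear
  let S := s ∪ Finset.univ.image (X : Fin 2 → MvPolynomial (Fin 2) K)
  let n := S.sup (fun e => m (hamDer Q e)) + 1
  have hh : aeval ![P, Q] (lift y ^ n) = ((y ^ n : B) : MvPolynomial (Fin 2) K) := by
    rw [map_pow, hlift]; rfl
  refine ⟨lift y ^ n, pow_ne_zero _ ?_, fun i => ?_, S, fun i => ?_, ?_⟩
  · rintro h0
    have := hlift y
    rw [h0, map_zero] at this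
    exact hy0 (Subtype.ext this.symm)
  · have hyn : IsIntegral B (y ^ n • (X i : MvPolynomial (Fin 2) K)) := by
      rw [show n = (n - 1) + 1 by simp [n], pow_succ, mul_smul]
      exact (hy i).smul _
    obtain ⟨p, hp, hp0⟩ := hyn
    let e : B ≃+* MvPolynomial (Fin 2) K :=
      (AlgebraicIndependent.aevalEquiv (R := K) (x := ![P, Q])
        (aeval_jacobian_pair_injective hJ)).symm.toRingEquiv
    refine ⟨p.map e.toRingHom, hp.map _, ?_⟩
    rw [Polynomial.eval₂_map, hh]
    rw [Algebra.smul_def] at hp0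
    convert hp0 using 1
    congr 1
    ext1 b
    change aeval ![P, Q] (e b) = (b : MvPolynomial (Fin 2) K)
    conv_rhs => rw [← e.symm_apply_apply b]
    exact (AlgebraicIndependent.algebraMap_aevalEquiv (aeval_jacobian_pair_injective hJ) _).symm
  · exact Finset.mem_union_right _ (Finset.mem_image_of_mem _ (Finset.mem_univ i))
  · have hspan : ∀ e : S, ∃ c : S → B, ∑ e', c e' • (e' : MvPolynomial (Fin 2) K) =
        y ^ n • hamDer Q e := by
      intro e
      rw [← Submodule.mem_span_finset']
      have h1 : y ^ n • hamDer Q (e : MvPolynomial (Fin 2) K) ∈ Subalgebra.toSubmodule M :=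
        hm _ n ((Finset.le_sup (f := fun e => m (hamDer Q e)) e.2).trans (Nat.le_succ _))
      rw [← hs] at h1
      exact Submodule.span_mono (Finset.coe_subset.2 Finset.subset_union_left) h1
    choose c hc using hspan
    refine ⟨fun e e' => lift (c e e'), fun e => ?_⟩
    rw [hh]
    simp only [hlift]
    exact (hc e).symm

theorem exists_dvd_aeval_of_ne_zero
    (hJ : pderiv 0 P * pderiv 1 Q - pderiv 1 P * pderiv 0 Q = 1)
    {f : MvPolynomial (Fin 2) K} (hf : f ≠ 0) :
    ∃ w : MvPolynomial (Fin 2) K, w ≠ 0 ∧ f ∣ aeval ![P, Q] w := by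
  have halg := isAlgebraic_jacobian_pair hJ
  obtain ⟨b, hb, hd⟩ := (halg.isAlgebraic f).exists_nonzero_dvd (mem_nonZeroDivisors_of_ne_zero hf)
  obtain ⟨w, hw⟩ := (Algebra.adjoin_range_eq_range_aeval K ![P, Q]).le b.2
  refine ⟨w, ?_, ?_⟩
  · rintro rfl
    exact hb (Subtype.ext (by simpa using hw.symm))
  · exact hd.trans (dvd_of_eq hw.symm)

end JacobianPair

section Integrality

theorem MvPolynomial.sq_dvd_aeval_add_sub {R S σ : Type*} [Fintype σ] [CommRing R] [CommRing S]
    [Algebra R S] {g d : σ → S} {c : S} (hd : ∀ i, c ∣ d i) (p : MvPolynomial σ R) :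
    c ^ 2 ∣ aeval (fun i => g i + d i) p - aeval g p - ∑ i, aeval g (pderiv i p) * d i := by
  classical
  have hL : ∀ q : MvPolynomial σ R, c ∣ ∑ i, aeval g (pderiv i q) * d i := fun q =>
    Finset.dvd_sum fun i _ => (hd i).mul_left _
  induction p using MvPolynomial.induction_on with
  | C a => simp
  | add p q hp hq =>
    convert dvd_add hp hq using 1
    simp only [map_add, add_mul, Finset.sum_add_distrib]
    ring
  | mul_X p k hp =>
    have hsum : ∑ i, aeval g (pderiv i (p * X k)) * d i =
        (∑ i, aeval g (pderiv i p) * d i) * g k + aeval g p * d k := by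
      rw [Finset.sum_mul, ← Finset.sum_erase_add _ _ (Finset.mem_univ k),
        ← Finset.sum_erase_add Finset.univ (fun i => aeval g (pderiv i p) * d i * g k)
          (Finset.mem_univ k), add_assoc]
      congr 1
      · refine Finset.sum_congr rfl fun i hi => ?_
        rw [Derivation.leibniz, pderiv_X_of_ne (Finset.ne_of_mem_erase hi).symm]
        simp only [smul_eq_mul, mul_zero, zero_add, map_mul, aeval_X]
        ring
      · rw [Derivation.leibniz, pderiv_X_self]
        simp only [smul_eq_mul, mul_one, map_add, map_mul, aeval_X]
        ring
    have := dvd_add (hp.mul_right (g k + d k)) (pow_two c ▸ mul_dvd_mul (hL p) (hd k))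
    convert this using 1
    rw [hsum, map_mul, map_mul, aeval_X, aeval_X]
    ring

variable {R K : Type*} [CommRing R] [CommRing K] [Algebra R K]

theorem coeff_aeval_sub_mem_range {n : ℕ} (hn : n ≠ 0) {x : Fin 2 → PowerSeries K}
    (hx : ∀ i, ∀ m < n, PowerSeries.coeff m (x i) ∈ (algebraMap R K).range)
    (p : MvPolynomial (Fin 2) R) :
    PowerSeries.coeff n (aeval x p) -
      ∑ i, aeval (fun j => PowerSeries.constantCoeff (x j)) (pderiv i p) *
        PowerSeries.coeff n (x i) ∈ (algebraMap R K).range := by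
  classical
  choose t ht using hx
  let T : Fin 2 → PowerSeries R := fun i => PowerSeries.mk fun m =>
    if h : m < n then t i m h else 0
  let g : Fin 2 → PowerSeries K := fun i => PowerSeries.map (algebraMap R K) (T i)
  have hd : ∀ i, (PowerSeries.X : PowerSeries K) ^ n ∣ x i - g i := by
    intro i
    rw [PowerSeries.X_pow_dvd_iff]
    intro m hm
    simp [g, T, hm, ht]
  have hg : ∀ q : MvPolynomial (Fin 2) R,
      aeval g q = PowerSeries.map (algebraMap R K) (aeval T q) := by
    intro q
    rw [map_aeval, aeval_def, coe_eval₂Hom]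
    congr 1
  have hg0 : ∀ i, PowerSeries.constantCoeff (g i) = PowerSeries.constantCoeff (x i) := by
    intro i
    have := (PowerSeries.X_pow_dvd_iff.1 (hd i)) 0 (Nat.pos_of_ne_zero hn)
    rw [map_sub, PowerSeries.coeff_zero_eq_constantCoeff_apply,
      PowerSeries.coeff_zero_eq_constantCoeff_apply, sub_eq_zero] at this
    exact this.symm
  have hgn : ∀ i, PowerSeries.coeff n (g i) = 0 := by
    intro i
    simp [g, T]
  have key := sq_dvd_aeval_add_sub (g := g) hd p
  rw [← pow_mul, PowerSeries.X_pow_dvd_iff] at key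
  specialize key n (by omega)
  simp only [add_sub_cancel] at key
  rw [map_sub, map_sub, map_sum] at key
  refine ⟨PowerSeries.coeff n (aeval T p), ?_⟩
  have hterm : ∀ i, PowerSeries.coeff n (aeval g (pderiv i p) * (x i - g i)) =
      aeval (fun j => PowerSeries.constantCoeff (x j)) (pderiv i p) *
        PowerSeries.coeff n (x i) := by
    intro i
    obtain ⟨e, he⟩ := hd i
    have h1 : PowerSeries.coeff n (x i) = PowerSeries.constantCoeff e := by
      have := congrArg (PowerSeries.coeff n) he
      rw [map_sub, hgn, sub_zero, PowerSeries.coeff_X_pow_mul', if_pos le_rfl, Nat.sub_self] at this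
      simpa using this
    rw [he, mul_left_comm, PowerSeries.coeff_X_pow_mul', if_pos le_rfl, Nat.sub_self, h1,
      PowerSeries.coeff_zero_eq_constantCoeff_apply, map_mul, map_aeval]
    congr 1
    simp only [hg0]
    rw [aeval_def, coe_eval₂Hom]
    congr 1
  simp only [hterm] at key
  rw [← PowerSeries.coeff_map, ← hg]
  linear_combination -key

/-- Solutions of a system with unimodular Jacobian have integral Taylor coefficients. -/
theorem coeff_mem_range_of_jacobian_pair {P Q : MvPolynomial (Fin 2) R}
    (hJ : pderiv 0 P * pderiv 1 Q - pderiv 1 P * pderiv 0 Q = 1) {x : Fin 2 → PowerSeries K}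
    (hx : ∀ i, PowerSeries.constantCoeff (x i) ∈ (algebraMap R K).range)
    (hP : ∀ n, PowerSeries.coeff n (aeval x P) ∈ (algebraMap R K).range)
    (hQ : ∀ n, PowerSeries.coeff n (aeval x Q) ∈ (algebraMap R K).range) (n : ℕ) :
    ∀ i, PowerSeries.coeff n (x i) ∈ (algebraMap R K).range := by
  induction n using Nat.strong_induction_on with
  | _ n ih =>
    rcases eq_or_ne n 0 with rfl | hn
    · simpa using hx
    have h1 := sub_mem (hP n) (coeff_aeval_sub_mem_range hn (fun i m hm => ih m hm i) P)
    have h2 := sub_mem (hQ n) (coeff_aeval_sub_mem_range hn (fun i m hm => ih m hm i) Q)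
    rw [sub_sub_cancel, Fin.sum_univ_two] at h1 h2
    have hmem : ∀ p : MvPolynomial (Fin 2) R,
        aeval (fun j => PowerSeries.constantCoeff (x j)) p ∈ (algebraMap R K).range := by
      intro p
      choose y hy using hx
      refine ⟨aeval y p, ?_⟩
      rw [map_aeval, aeval_def, coe_eval₂Hom]
      simp only [hy, Algebra.algebraMap_self, RingHom.comp_id]
    have hJ' := congrArg (aeval fun j => PowerSeries.constantCoeff (x j)) hJ
    rw [map_sub, map_mul, map_mul, map_one] at hJ'
    intro i
    fin_cases i
    · change PowerSeries.coeff n (x 0) ∈ _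
      convert sub_mem (mul_mem (hmem (pderiv 1 Q)) h1) (mul_mem (hmem (pderiv 1 P)) h2) using 1
      linear_combination (-PowerSeries.coeff n (x 0)) * hJ'
    · change PowerSeries.coeff n (x 1) ∈ _
      convert sub_mem (mul_mem (hmem (pderiv 0 P)) h2) (mul_mem (hmem (pderiv 0 Q)) h1) using 1
      linear_combination (-PowerSeries.coeff n (x 1)) * hJ'

end Integrality

section Orbit

variable {K : Type*} [Field K]

theorem Polynomial.natDegree_le_of_eval₂_eq_zero {A : Type*} [CommRing A] {p : Polynomial A}
    (hp : p.Monic) (ψ : A →+* Polynomial K) {N : ℕ}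
    (hN : ∀ k, (ψ (p.coeff k)).natDegree ≤ N) {Z : Polynomial K} (hZ : p.eval₂ ψ Z = 0) :
    Z.natDegree ≤ N := by
  by_contra! hlt
  have hZ0 : Z ≠ 0 := by rintro rfl; simp at hlt
  set d := p.natDegree with hd
  have hsum : ∑ k ∈ Finset.range d, ψ (p.coeff k) * Z ^ k + Z ^ d = 0 := by
    rw [← hZ, Polynomial.eval₂_eq_sum_range, Finset.sum_range_succ, ← hd, hp.coeff_natDegree,
      map_one, one_mul]
  have hdpos : d ≠ 0 := by
    intro h0
    rw [h0] at hsum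
    simp at hsum
  have hle : (∑ k ∈ Finset.range d, ψ (p.coeff k) * Z ^ k).natDegree < d * Z.natDegree := by
    refine lt_of_le_of_lt (Polynomial.natDegree_sum_le_of_forall_le (n := N + (d - 1) * Z.natDegree)
      _ _ fun k hk => ?_) ?_
    · refine Polynomial.natDegree_mul_le.trans (add_le_add (hN k) ?_)
      rw [Polynomial.natDegree_pow]
      exact Nat.mul_le_mul_right _ (by have := Finset.mem_range.1 hk; omega)
    · obtain ⟨e, he⟩ := Nat.exists_eq_succ_of_ne_zero hdpos
      rw [he, Nat.succ_sub_one, Nat.succ_mul]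
      omega
  have h2 : (∑ k ∈ Finset.range d, ψ (p.coeff k) * Z ^ k) = -Z ^ d := by
    linear_combination hsum
  rw [h2, Polynomial.natDegree_neg, Polynomial.natDegree_pow] at hle
  exact lt_irrefl _ hle

/-- Restriction of a polynomial to the horizontal line through `(u, v)`. -/
noncomputable def horizontalRestriction (u v : K) : MvPolynomial (Fin 2) K →ₐ[K] Polynomial K :=
  aeval ![Polynomial.C u + Polynomial.X, Polynomial.C v]

theorem natDegree_horizontalRestriction_le (u v : K) (f : MvPolynomial (Fin 2) K) :
    (horizontalRestriction u v f).natDegree ≤ f.totalDegree := by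
  have := aeval_natDegree_le (n := 1) f le_rfl ![Polynomial.C u + Polynomial.X, Polynomial.C v]
    (by
      intro i
      fin_cases i
      · exact (Polynomial.natDegree_C_add).trans_le Polynomial.natDegree_X_le
      · simp)
  rwa [mul_one] at this

theorem eval_map_horizontalRestriction {L : Type*} [CommRing L] (σ : K →+* L) (u v : K)
    (f : MvPolynomial (Fin 2) K) (z : L) :
    ((horizontalRestriction u v f).map σ).eval z = eval₂ σ ![σ u + z, σ v] f := by
  have : ((Polynomial.evalRingHom z).comp (Polynomial.mapRingHom σ)).comp
      (horizontalRestriction u v : MvPolynomial (Fin 2) K →+* Polynomial K) =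
      eval₂Hom σ ![σ u + z, σ v] := by
    refine ringHom_ext (fun r => ?_) fun i => ?_
    · simp [horizontalRestriction]
    · fin_cases i <;> simp [horizontalRestriction]
  exact RingHom.congr_fun this f

variable [CharZero K]

/-- Taylor expansion of polynomials along the flow of `D` through the point `x`. -/
noncomputable def Derivation.orbitHom
    (D : Derivation K (MvPolynomial (Fin 2) K) (MvPolynomial (Fin 2) K)) (x : Fin 2 → K) :
    MvPolynomial (Fin 2) K →+* PowerSeries K :=
  (PowerSeries.map (eval x)).comp D.taylorHom

variable (D : Derivation K (MvPolynomial (Fin 2) K) (MvPolynomial (Fin 2) K)) (x : Fin 2 → K)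

theorem Derivation.orbitHom_apply (f : MvPolynomial (Fin 2) K) :
    D.orbitHom x f = PowerSeries.map (eval x) (D.taylorSeries f) := rfl

theorem Derivation.coeff_orbitHom (f : MvPolynomial (Fin 2) K) (n : ℕ) :
    PowerSeries.coeff n (D.orbitHom x f) = (n.factorial : K)⁻¹ * eval x (D^[n] f) := by
  rw [orbitHom_apply, PowerSeries.coeff_map, taylorSeries, PowerSeries.coeff_mk, smul_eval]

theorem Derivation.derivative_orbitHom (f : MvPolynomial (Fin 2) K) :
    PowerSeries.derivative K (D.orbitHom x f) = D.orbitHom x (D f) := by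
  rw [orbitHom_apply, orbitHom_apply, ← derivative_taylorSeries]
  ext n
  simp [PowerSeries.coeff_derivative]

theorem Derivation.orbitHom_of_map_eq_zero {f : MvPolynomial (Fin 2) K} (hf : D f = 0) :
    D.orbitHom x f = PowerSeries.C (eval x f) := by
  rw [orbitHom_apply, taylorSeries_of_map_eq_zero _ hf, PowerSeries.map_C]

theorem Derivation.orbitHom_of_map_eq_one {f : MvPolynomial (Fin 2) K} (hf : D f = 1) :
    D.orbitHom x f = PowerSeries.C (eval x f) + PowerSeries.X := by
  rw [orbitHom_apply, taylorSeries_of_map_eq_one _ hf, map_add, PowerSeries.map_C,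
    PowerSeries.map_X]

theorem Derivation.constantCoeff_orbitHom (f : MvPolynomial (Fin 2) K) :
    PowerSeries.constantCoeff (D.orbitHom x f) = eval x f := by
  rw [← PowerSeries.coeff_zero_eq_constantCoeff_apply, coeff_orbitHom]
  simp

theorem orbitHom_aeval_jacobian_pair {P Q : MvPolynomial (Fin 2) K}
    (hJ : pderiv 0 P * pderiv 1 Q - pderiv 1 P * pderiv 0 Q = 1) (f : MvPolynomial (Fin 2) K) :
    (hamDer Q).orbitHom x (aeval ![P, Q] f) =
      (horizontalRestriction (eval x P) (eval x Q) f : PowerSeries K) := by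
  have : ((hamDer Q).orbitHom x).comp
      (aeval (R := K) ![P, Q] : MvPolynomial (Fin 2) K →+* MvPolynomial (Fin 2) K) =
      Polynomial.coeToPowerSeries.ringHom.comp
        (horizontalRestriction (eval x P) (eval x Q) :
          MvPolynomial (Fin 2) K →+* Polynomial K) := by
    refine ringHom_ext (fun r => ?_) fun i => ?_
    · have := (hamDer Q).orbitHom_of_map_eq_zero x
        ((hamDer Q).map_algebraMap r : hamDer Q (C r) = 0)
      simpa [horizontalRestriction] using this
    · fin_cases i
      · simp [horizontalRestriction, (hamDer Q).orbitHom_of_map_eq_one x (hamDer_right hJ)]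
      · simp [horizontalRestriction, (hamDer Q).orbitHom_of_map_eq_zero x (hamDer_self Q)]
  exact RingHom.congr_fun this f

end Orbit

section JacobianPairMap

variable {R K : Type*} [CommRing R] [Field K] [Algebra R K] {P Q : MvPolynomial (Fin 2) R}

theorem jacobian_map (hJ : pderiv 0 P * pderiv 1 Q - pderiv 1 P * pderiv 0 Q = 1) :
    pderiv 0 (map (algebraMap R K) P) * pderiv 1 (map (algebraMap R K) Q) -
      pderiv 1 (map (algebraMap R K) P) * pderiv 0 (map (algebraMap R K) Q) = 1 := by
  simp only [pderiv_map, ← map_mul, ← map_sub, hJ, map_one]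

theorem eval_map_algebraMap (x : Fin 2 → R) (f : MvPolynomial (Fin 2) R) :
    eval (fun i => algebraMap R K (x i)) (map (algebraMap R K) f) = algebraMap R K (eval x f) := by
  rw [eval_map]
  exact (map_eval₂Hom (RingHom.id _) x (algebraMap R K) f).symm

variable [CharZero K]

theorem coeff_orbitHom_mem_range
    (hJ : pderiv 0 P * pderiv 1 Q - pderiv 1 P * pderiv 0 Q = 1) (x : Fin 2 → R) (n : ℕ)
    (i : Fin 2) :
    PowerSeries.coeff n ((hamDer (map (algebraMap R K) Q)).orbitHom
      (fun j => algebraMap R K (x j)) (X i)) ∈ (algebraMap R K).range := by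
  classical
  have hJ' := jacobian_map (K := K) hJ
  set D := hamDer (map (algebraMap R K) Q) with hD
  let y : Fin 2 → K := fun j => algebraMap R K (x j)
  have hae : ∀ f : MvPolynomial (Fin 2) R,
      aeval (fun i => D.orbitHom y (X i)) f = D.orbitHom y (map (algebraMap R K) f) := by
    intro f
    have : (aeval (R := R) (fun i => D.orbitHom y (X i)) :
        MvPolynomial (Fin 2) R →+* PowerSeries K) =
        (D.orbitHom y).comp (map (algebraMap R K)) := by
      refine ringHom_ext (fun r => ?_) fun i => by simp
      have h0 := D.orbitHom_of_map_eq_zero y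
        (D.map_algebraMap (algebraMap R K r) : D (C (algebraMap R K r)) = 0)
      rw [algebraMap_eq, eval_C] at h0
      rw [RingHom.comp_apply, map_C, h0]
      simp [PowerSeries.algebraMap_apply]
    exact RingHom.congr_fun this f
  refine coeff_mem_range_of_jacobian_pair hJ (x := fun i => D.orbitHom y (X i))
    (fun j => ?_) (fun m => ?_) (fun m => ?_) n i
  · rw [D.constantCoeff_orbitHom, eval_X]
    exact ⟨x j, rfl⟩
  · rw [hae, D.orbitHom_of_map_eq_one y (hamDer_right hJ'), eval_map_algebraMap, map_add,
      PowerSeries.coeff_C, PowerSeries.coeff_X]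
    refine add_mem ?_ ?_ <;> split_ifs
    exacts [⟨_, rfl⟩, zero_mem _, one_mem _, zero_mem _]
  · rw [hae, D.orbitHom_of_map_eq_zero y (hamDer_self _), eval_map_algebraMap,
      PowerSeries.coeff_C]
    split_ifs
    exacts [⟨_, rfl⟩, zero_mem _]

end JacobianPairMap

section Counting

variable {K : Type*} [Field K] [NumberField K] {P Q : MvPolynomial (Fin 2) (𝓞 K)}

theorem exists_iterate_hamDer_eval_eq_zero
    (hK : Module.finrank ℚ K = 1 ∨ (Module.finrank ℚ K = 2 ∧ IsEmpty (K →+* ℝ)))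
    (σ : K →+* ℂ) (hJ : pderiv 0 P * pderiv 1 Q - pderiv 1 P * pderiv 0 Q = 1) :
    ∃ h : MvPolynomial (Fin 2) K, h ≠ 0 ∧ ∃ N : ℕ, ∀ x : Fin 2 → 𝓞 K,
      (∀ z : ℂ, ‖z‖ ≤ 1 → eval₂ σ ![σ (eval x P : 𝓞 K) + z, σ (eval x Q : 𝓞 K)] h ≠ 0) →
      ∀ i : Fin 2, ∀ n, N < n → eval (fun j => (x j : K))
        ((hamDer (map (algebraMap (𝓞 K) K) Q))^[n] (X i)) = 0 := by
  classical
  have hJ' := jacobian_map (K := K) hJ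
  obtain ⟨h, h0, hmonic, S, hS, c, hc⟩ := exists_linear_system_of_jacobian_pair hJ'
  choose p hp hp0 using hmonic
  refine ⟨h, h0, Finset.univ.sup fun i => (p i).support.sup fun k =>
    ((p i).coeff k).totalDegree, fun x hx i n hn => ?_⟩
  set D := hamDer (map (algebraMap (𝓞 K) K) Q) with hD
  let y : Fin 2 → K := fun j => x j
  let ℓ := horizontalRestriction (eval y (map (algebraMap (𝓞 K) K) P))
    (eval y (map (algebraMap (𝓞 K) K) Q))
  have hℓ : ∀ f, D.orbitHom y (aeval ![map (algebraMap (𝓞 K) K) P, map (algebraMap (𝓞 K) K) Q] f) =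
      (ℓ f : PowerSeries K) := orbitHom_aeval_jacobian_pair y hJ'
  have hev : ∀ z : ℂ, ‖z‖ ≤ 1 → ((ℓ h).map σ).eval z ≠ 0 := by
    intro z hz
    rw [eval_map_horizontalRestriction, eval_map_algebraMap, eval_map_algebraMap]
    exact hx z hz
  have hH0 : ℓ h ≠ 0 := by
    intro H
    refine hev 0 (by simp) ?_
    rw [H]; simp
  have htend := PowerSeries.tendsto_coeff_of_linear_system hev
    (E := fun e : S => PowerSeries.map σ (D.orbitHom y e))
    (C := fun e e' => (ℓ (c e e')).map σ) (fun e => by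
      have hder : PowerSeries.derivative ℂ (PowerSeries.map σ (D.orbitHom y e)) =
          PowerSeries.map σ (D.orbitHom y (D e)) := by
        rw [← D.derivative_orbitHom]
        ext m
        simp [PowerSeries.coeff_derivative]
      have := congrArg (fun f => PowerSeries.map σ (D.orbitHom y f)) (hc e)
      simp only [map_mul, map_sum, hℓ] at this
      simpa only [hder, Polynomial.polynomial_map_coe] using this) ⟨X i, hS i⟩
  have hev0 : ∃ m, ∀ k, m ≤ k → PowerSeries.coeff k (D.orbitHom y (X i)) = 0 := by
    have h1 := htend.eventually (Metric.ball_mem_nhds 0 one_pos)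
    obtain ⟨m, hm⟩ := Filter.eventually_atTop.1 h1
    refine ⟨m, fun k hk => ?_⟩
    obtain ⟨z, hz⟩ := coeff_orbitHom_mem_range (K := K) hJ x k i
    have h2 := hm k hk
    rw [dist_zero_right, PowerSeries.coeff_map, ← hz] at h2
    rw [← hz]
    by_contra hz0
    exact h2.not_ge (one_le_norm_embedding hK σ (fun h => hz0 (by rw [h, map_zero])))
  obtain ⟨m, hm⟩ := hev0
  obtain ⟨q, hq⟩ : ∃ q : Polynomial K, (q : PowerSeries K) = D.orbitHom y (X i) := by
    refine ⟨PowerSeries.trunc m (D.orbitHom y (X i)), ?_⟩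
    ext k
    rw [Polynomial.coeff_coe, PowerSeries.coeff_trunc]
    split_ifs with hk
    · rfl
    · exact (hm k (not_lt.1 hk)).symm
  have hZ : (p i).eval₂ (ℓ : MvPolynomial (Fin 2) K →+* Polynomial K) (ℓ h * q) = 0 := by
    apply Polynomial.coe_injective
    have := congrArg (D.orbitHom y) (hp0 i)
    rw [Polynomial.hom_eval₂, map_mul, hℓ, ← hq, map_zero] at this
    rw [← Polynomial.coeToPowerSeries.ringHom_apply, Polynomial.hom_eval₂,
      Polynomial.coeToPowerSeries.ringHom_apply, Polynomial.coe_mul, Polynomial.coe_zero]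
    convert this using 2
    exact RingHom.ext fun r => (hℓ r).symm
  have hdeg := Polynomial.natDegree_le_of_eval₂_eq_zero (hp i) _ (N := Finset.univ.sup fun i =>
    (p i).support.sup fun k => ((p i).coeff k).totalDegree) (fun k => by
      refine (natDegree_horizontalRestriction_le _ _ _).trans ?_
      by_cases hk : k ∈ (p i).support
      · exact (Finset.le_sup (f := fun k => ((p i).coeff k).totalDegree) hk).trans
          (Finset.le_sup (f := fun i => (p i).support.sup fun k => ((p i).coeff k).totalDegree)
            (Finset.mem_univ i))
      · rw [Polynomial.notMem_support_iff.1 hk]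
        simp) hZ
  have hqn : q.coeff n = 0 := by
    by_cases hq0 : q = 0
    · rw [hq0, Polynomial.coeff_zero]
    · refine Polynomial.coeff_eq_zero_of_natDegree_lt (lt_of_le_of_lt ?_ hn)
      rw [Polynomial.natDegree_mul hH0 hq0] at hdeg
      exact (Nat.le_add_left _ _).trans hdeg
  rw [← Polynomial.coeff_coe, hq, D.coeff_orbitHom, mul_eq_zero] at hqn
  exact hqn.resolve_left (inv_ne_zero (by exact_mod_cast n.factorial_ne_zero))

/-- Either the derivation attached to `Q` is nilpotent on the coordinates, or the image of the
integral points is contained in a sparse set. -/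
theorem hamDer_nilpotent_or_card_image_le
    (hK : Module.finrank ℚ K = 1 ∨ (Module.finrank ℚ K = 2 ∧ IsEmpty (K →+* ℝ)))
    (σ : K →+* ℂ) (hJ : pderiv 0 P * pderiv 1 Q - pderiv 1 P * pderiv 0 Q = 1) :
    (∀ i, ∃ N, ∀ n, N ≤ n → (hamDer (map (algebraMap (𝓞 K) K) Q))^[n] (X i) = 0) ∨
    ∃ c : ℝ, 0 < c ∧ ∀ R : ℝ, 1 ≤ R → ∃ s : Finset (𝓞 K × 𝓞 K),
      (∀ x : Fin 2 → 𝓞 K, ‖σ (eval x P : 𝓞 K)‖ ≤ R → ‖σ (eval x Q : 𝓞 K)‖ ≤ R →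
        (eval x P, eval x Q) ∈ s) ∧
      (s.card : ℝ) ≤ c * R ^ Module.finrank ℚ K := by
  obtain ⟨h, h0, N, hN⟩ := exists_iterate_hamDer_eval_eq_zero hK σ hJ
  refine or_iff_not_imp_left.2 fun hnil => ?_
  push Not at hnil
  obtain ⟨i, hi⟩ := hnil
  obtain ⟨n, hn, hne⟩ := hi (N + 1)
  obtain ⟨w, w0, g, hg⟩ := exists_dvd_aeval_of_ne_zero (jacobian_map (K := K) hJ) hne
  obtain ⟨c, hc, H⟩ := card_points_near_curve_le hK σ (mul_ne_zero h0 w0)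
  refine ⟨c, hc, fun R hR => ?_⟩
  obtain ⟨s, hs, hcard⟩ := H R hR
  refine ⟨s, fun x hP hQ => hs _ hP hQ ?_, hcard⟩
  by_cases hx : ∀ z : ℂ, ‖z‖ ≤ 1 →
      eval₂ σ ![σ (eval x P : 𝓞 K) + z, σ (eval x Q : 𝓞 K)] h ≠ 0
  · refine ⟨0, by simp, ?_⟩
    have h1 := congrArg (eval fun j => (x j : K)) hg
    rw [map_mul, hN x hx i n hn, zero_mul] at h1
    have h2 : eval₂ σ ![σ (eval x P : 𝓞 K), σ (eval x Q : 𝓞 K)] w = 0 := by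
      have h3 := congrArg σ h1
      have h4 : (σ.comp (eval fun j => (x j : K))).comp (aeval (R := K)
          ![map (algebraMap (𝓞 K) K) P, map (algebraMap (𝓞 K) K) Q] :
          MvPolynomial (Fin 2) K →+* MvPolynomial (Fin 2) K) =
          eval₂Hom σ ![σ (eval x P : 𝓞 K), σ (eval x Q : 𝓞 K)] := by
        refine ringHom_ext (fun r => by simp) fun j => ?_
        fin_cases j
        · simpa using congrArg σ (eval_map_algebraMap x P)
        · simpa using congrArg σ (eval_map_algebraMap x Q)
      rw [map_zero] at h3
      exact (RingHom.congr_fun h4 w).symm.trans h3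
    rw [eval₂_mul, add_zero, h2, mul_zero]
  · push Not at hx
    obtain ⟨z, hz, hz0⟩ := hx
    exact ⟨z, hz, by rw [eval₂_mul, hz0, zero_mul]⟩

end Counting

/-- Let `K` be `ℚ` or an imaginary quadratic field, `d = [K:ℚ]`, and let `F = (P,Q)` be a
Jacobian pair over `𝓞 K` that is not invertible over `K`. Then the number of points of the
image set `F((𝓞 K)²)` whose coordinates have house at most `R` is eventually bounded by
`c·R^d` for some constant `c > 0`. -/
theorem counting_image_of_noninvertible_jacobian_pair
    (K : Type*) [Field K] [NumberField K]
    (hK : Module.finrank ℚ K = 1 ∨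
      (Module.finrank ℚ K = 2 ∧ IsEmpty (K →+* ℝ)))
    (P Q : MvPolynomial (Fin 2) (𝓞 K))
    (hJac : pderiv 0 P * pderiv 1 Q - pderiv 1 P * pderiv 0 Q = 1)
    (hnotinv : ¬ ∃ U V : MvPolynomial (Fin 2) K,
      aeval ![MvPolynomial.map (algebraMap (𝓞 K) K) P,
              MvPolynomial.map (algebraMap (𝓞 K) K) Q] U = X 0 ∧
      aeval ![MvPolynomial.map (algebraMap (𝓞 K) K) P,
              MvPolynomial.map (algebraMap (𝓞 K) K) Q] V = X 1 ∧
      aeval ![U, V] (MvPolynomial.map (algebraMap (𝓞 K) K) P) = X 0 ∧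
      aeval ![U, V] (MvPolynomial.map (algebraMap (𝓞 K) K) Q) = X 1) :
    ∃ c : ℝ, 0 < c ∧ ∃ R₀ : ℝ, ∀ R : ℝ, R₀ ≤ R →
      (Nat.card {p : 𝓞 K × 𝓞 K |
          (∃ a b : 𝓞 K, eval ![a, b] P = p.1 ∧ eval ![a, b] Q = p.2) ∧
          house (algebraMap (𝓞 K) K p.1) ≤ R ∧
          house (algebraMap (𝓞 K) K p.2) ≤ R} : ℝ)
        ≤ c * R ^ (Module.finrank ℚ K) := by
  classical
  obtain ⟨σ⟩ : Nonempty (K →+* ℂ) := inferInstance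
  have key : ∃ c : ℝ, 0 < c ∧ ∀ R : ℝ, 1 ≤ R → ∃ s : Finset (𝓞 K × 𝓞 K),
      (∀ x : Fin 2 → 𝓞 K, ‖σ (eval x P : 𝓞 K)‖ ≤ R → ‖σ (eval x Q : 𝓞 K)‖ ≤ R →
        (eval x P, eval x Q) ∈ s) ∧
      (s.card : ℝ) ≤ c * R ^ Module.finrank ℚ K := by
    rcases hamDer_nilpotent_or_card_image_le hK σ hJac with h1 | h1
    · rcases hamDer_nilpotent_or_card_image_le hK σ (jacobian_swap hJac) with h2 | h2
      · rw [map_neg] at h2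
        exact absurd (exists_inverse_of_hamDer_nilpotent (jacobian_map hJac) h1 h2) hnotinv
      · obtain ⟨c, hc, H⟩ := h2
        refine ⟨c, hc, fun R hR => ?_⟩
        obtain ⟨s, hs, hcard⟩ := H R hR
        refine ⟨s.image fun p => (-p.2, p.1), fun x hP hQ => ?_,
          le_trans (by exact_mod_cast Finset.card_image_le) hcard⟩
        refine Finset.mem_image.2 ⟨_, hs x hQ ?_, ?_⟩
        · rwa [map_neg, ← norm_neg, ← map_neg, ← map_neg, neg_neg]
        · simp
    · exact h1
  obtain ⟨c, hc, H⟩ := key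
  refine ⟨c, hc, 1, fun R hR => ?_⟩
  obtain ⟨s, hs, hcard⟩ := H R hR
  refine le_trans ?_ hcard
  rw [Nat.cast_le, ← Nat.card_eq_finsetCard]
  refine Nat.card_mono s.finite_toSet ?_
  rintro ⟨u, v⟩ ⟨⟨a, b, hP, hQ⟩, hu, hv⟩
  simp only at hP hQ hu hv
  subst hP hQ
  rw [house_eq_norm_embedding hK σ] at hu hv
  exact hs _ hu hv
end
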